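/- Fix σ > 0 and constants α, β ∈ (0,1). For each n let m = ⌈α·n⌉, k = ⌈β·n⌉; let A be a random m×n matrix with i.i.d. N(0,1) entries, v ∈ ℝᵐ independent with i.i.d. N(0,σ²) entries; for a k-sparse nonnegative x̃ set y = A·x̃ + v and ζ_obj = inf { ‖y − A·x‖₂ : ‖x‖₁ ≤ ‖x̃‖₁ }. Let g ∈ ℝᵐ, h ∈ ℝⁿ be independent standard normal vectors and assume there exist δ > 0 and N₀ such that for all n ≥ N₀, E[H_gen(g, h)] ≤ (1 − δ)·E[‖g‖₂]. Define w_gen(g, h) = σ·H_gen(g, h)/√(‖g‖₂² − H_gen(g, h)²). Then for every ε₁ ∈ (0,1) there exist ε₂, ε₃ > 0 and N such that for all n ≥ N: (i) there exists a k-sparse nonnegative x̃ such that, with probability at least 1 − e^{−ε₂·n}, some minimizer x̂ of ζ_obj satisfies (1 − ε₁)·E[w_gen(g, h)] ≤ ‖x̂ − x̃‖₂ ≤ (1 + ε₁)·E[w_gen(g, h)]; and (ii) for every k-sparse nonnegative x̃, with probability at least 1 − e^{−ε₃·n}, every minimizer x̂ of ζ_obj satisfies ‖x̂ − x̃‖₂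 ≤ (1 + ε₁)·E[w_gen(g, h)]. -/

import Mathlib

open MeasureTheory ProbabilityTheory

noncomputable def e2norm {d : ℕ} (x : Fin d → ℝ) : ℝ := Real.sqrt (∑ i, x i ^ 2)

noncomputable def l1norm {d : ℕ} (x : Fin d → ℝ) : ℝ := ∑ i, |x i|

def kSparseNonneg (n k : ℕ) (x : Fin n → ℝ) : Prop :=
  (∀ i : Fin n, (i : ℕ) < n - k → x i = 0) ∧ ∀ i, 0 ≤ x i

noncomputable def mDim (α : ℝ) (n : ℕ) : ℕ := ⌈α * (n : ℝ)⌉₊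

noncomputable def kDim (β : ℝ) (n : ℕ) : ℕ := ⌈β * (n : ℝ)⌉₊

noncomputable def muGH (m n : ℕ) : Measure ((Fin m → ℝ) × (Fin n → ℝ)) :=
  (Measure.pi fun _ : Fin m => gaussianReal 0 1).prod
    (Measure.pi fun _ : Fin n => gaussianReal 0 1)

noncomputable def muAv (m n : ℕ) (σ : ℝ) :
    Measure ((Fin m → Fin n → ℝ) × (Fin m → ℝ)) :=
  (Measure.pi fun _ : Fin m => Measure.pi fun _ : Fin n => gaussianReal 0 1).prod
    (Measure.pi fun _ : Fin m => gaussianReal 0 (σ ^ 2).toNNReal)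

/-- ‖y − A·x‖₂ with y = A·x̃ + v, for the sample ω = (A, v). -/
noncomputable def lassoVal (m n : ℕ) (xt : Fin n → ℝ)
    (ω : (Fin m → Fin n → ℝ) × (Fin m → ℝ)) (x : Fin n → ℝ) : ℝ :=
  e2norm (fun i => ((∑ j, ω.1 i j * xt j) + ω.2 i) - ∑ j, ω.1 i j * x j)

/-- ζ_obj(A, v): the optimal value of the LASSO (1.9). -/
noncomputable def zetaObj (m n : ℕ) (xt : Fin n → ℝ)
    (ω : (Fin m → Fin n → ℝ) × (Fin m → ℝ)) : ℝ :=
  sInf {r : ℝ | ∃ x : Fin n → ℝ, l1norm x ≤ l1norm xt ∧ r = lassoVal m n xt ω x}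

/-- H_gen(g, h): the generic (infinite-magnitude) optimal value (2.110). -/
noncomputable def HgenFun (m n k : ℕ) (p : (Fin m → ℝ) × (Fin n → ℝ)) : ℝ :=
  sInf {y : ℝ | ∃ ν : ℝ, ∃ lam : Fin n → ℝ, 0 ≤ ν ∧
    (∀ i : Fin n, n - k ≤ (i : ℕ) → lam i = 0) ∧
    (∀ i : Fin n, (i : ℕ) < n - k → 0 ≤ lam i ∧ lam i ≤ 2 * ν) ∧
    y = e2norm (fun i => p.2 i + ν - lam i)}

/-- w_gen(g, h) = σ·H_gen/√(‖g‖² − H_gen²). -/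
noncomputable def wgen (m n k : ℕ) (σ : ℝ) (p : (Fin m → ℝ) × (Fin n → ℝ)) : ℝ :=
  σ * HgenFun m n k p / Real.sqrt (e2norm p.1 ^ 2 - HgenFun m n k p ^ 2)


section
open MeasureTheory ProbabilityTheory Filter Topology

/-! ### e2norm basics -/
lemma e2norm_eq {d : ℕ} (x : Fin d → ℝ) : e2norm x = ‖(WithLp.toLp 2 x : EuclideanSpace ℝ (Fin d))‖ := by
  simp [e2norm, EuclideanSpace.norm_eq]

lemma e2norm_nonneg {d : ℕ} (x : Fin d → ℝ) : 0 ≤ e2norm x := Real.sqrt_nonneg _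

lemma e2norm_sq {d : ℕ} (x : Fin d → ℝ) : e2norm x ^ 2 = ∑ i, x i ^ 2 :=
  Real.sq_sqrt (Finset.sum_nonneg fun _ _ => sq_nonneg _)

lemma e2norm_zero {d : ℕ} : e2norm (0 : Fin d → ℝ) = 0 := by simp [e2norm]

lemma e2norm_add_le {d : ℕ} (x y : Fin d → ℝ) : e2norm (x + y) ≤ e2norm x + e2norm y := by
  simp only [e2norm_eq, WithLp.toLp_add]; exact norm_add_le _ _

lemma e2norm_sub_le {d : ℕ} (x y : Fin d → ℝ) : e2norm (x - y) ≤ e2norm x + e2norm y := by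
  simp only [e2norm_eq, WithLp.toLp_sub]; exact norm_sub_le _ _

lemma e2norm_neg {d : ℕ} (x : Fin d → ℝ) : e2norm (-x) = e2norm x := by
  simp [e2norm]

lemma e2norm_sub_comm {d : ℕ} (x y : Fin d → ℝ) : e2norm (x - y) = e2norm (y - x) := by
  rw [← e2norm_neg, neg_sub]

lemma e2norm_smul {d : ℕ} (c : ℝ) (x : Fin d → ℝ) : e2norm (c • x) = |c| * e2norm x := by
  simp only [e2norm_eq, WithLp.toLp_smul, norm_smul, Real.norm_eq_abs]

lemma abs_e2norm_sub_le {d : ℕ} (x y : Fin d → ℝ) : |e2norm x - e2norm y| ≤ e2norm (x - y) := by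
  simp only [e2norm_eq, WithLp.toLp_sub]; exact abs_norm_sub_norm_le _ _

lemma sum_mul_le_e2norm {d : ℕ} (x y : Fin d → ℝ) : ∑ i, x i * y i ≤ e2norm x * e2norm y :=
  Real.sum_mul_le_sqrt_mul_sqrt _ _ _

lemma abs_sum_mul_le_e2norm {d : ℕ} (x y : Fin d → ℝ) : |∑ i, x i * y i| ≤ e2norm x * e2norm y := by
  rw [abs_le]; refine ⟨?_, sum_mul_le_e2norm x y⟩
  have := sum_mul_le_e2norm (-x) y
  rw [e2norm_neg] at this; simp only [Pi.neg_apply, neg_mul, Finset.sum_neg_distrib] at this; linarith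

lemma abs_coord_le_e2norm {d : ℕ} (x : Fin d → ℝ) (i : Fin d) : |x i| ≤ e2norm x := by
  rw [e2norm_eq]; exact PiLp.norm_apply_le (WithLp.toLp 2 x : EuclideanSpace ℝ (Fin d)) i

lemma e2norm_le_sum_abs {d : ℕ} (x : Fin d → ℝ) : e2norm x ≤ ∑ i, |x i| := by
  apply Real.sqrt_le_iff.2 ⟨Finset.sum_nonneg fun _ _ => abs_nonneg _, ?_⟩
  have := Finset.sum_sq_le_sq_sum_of_nonneg (s := Finset.univ) (f := fun i => |x i|) (fun i _ => abs_nonneg _)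
  simpa using this

lemma continuous_e2norm {d : ℕ} : Continuous (e2norm : (Fin d → ℝ) → ℝ) := by
  unfold e2norm; fun_prop

@[fun_prop]
lemma measurable_e2norm {d : ℕ} : Measurable (e2norm : (Fin d → ℝ) → ℝ) := continuous_e2norm.measurable

lemma continuous_of_e2lip {d : ℕ} {F : (Fin d → ℝ) → ℝ} {L : ℝ}
    (hF : ∀ x y, |F x - F y| ≤ L * e2norm (x - y)) : Continuous F := by
  rw [continuous_iff_continuousAt]; intro x
  rw [ContinuousAt, tendsto_iff_dist_tendsto_zero]
  have h : Tendsto (fun y => L * e2norm (y - x)) (𝓝 x) (𝓝 (L * e2norm (x - x))) := by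
    apply Continuous.tendsto; have := @continuous_e2norm d; fun_prop
  rw [sub_self, e2norm_zero, mul_zero] at h
  exact squeeze_zero (fun _ => dist_nonneg) (fun y => by rw [Real.dist_eq]; exact hF y x) h

/-! ### standard Gaussian on Fin d → ℝ -/
noncomputable abbrev stdG (d : ℕ) : Measure (Fin d → ℝ) := Measure.pi fun _ : Fin d => gaussianReal 0 1

lemma isGaussian_pi {ι : Type*} [Fintype ι] {E : ι → Type*} [∀ i, NormedAddCommGroup (E i)]
    [∀ i, NormedSpace ℝ (E i)] [∀ i, MeasurableSpace (E i)] [∀ i, BorelSpace (E i)]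
    [∀ i, SecondCountableTopology (E i)] [∀ i, CompleteSpace (E i)]
    (μ : ∀ i, Measure (E i)) [∀ i, IsGaussian (μ i)] : IsGaussian (Measure.pi μ) := by
  have h := iIndepFun.hasGaussianLaw (X := fun i (x : ∀ i, E i) => x i) (P := Measure.pi μ)
    (fun i => ⟨by rw [(measurePreserving_eval μ i).map_eq]; infer_instance⟩)
    (iIndepFun_pi (X := fun _ ↦ id) (fun _ ↦ aemeasurable_id))
  have h2 := h.isGaussian_map
  have : (fun (x : ∀ i, E i) i => x i) = id := rfl
  rwa [this, Measure.map_id] at h2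

instance (d : ℕ) : IsGaussian (stdG d) := isGaussian_pi _

lemma pi_ac {d : ℕ} (μ ν : Fin d → Measure ℝ) [∀ i, SigmaFinite (μ i)] [∀ i, SigmaFinite (ν i)]
    (h : ∀ i, μ i ≪ ν i) : Measure.pi μ ≪ Measure.pi ν := by
  induction d with
  | zero => rw [Measure.pi_of_empty μ 0, Measure.pi_of_empty ν 0]
  | succ d ih =>
    have h1 := (measurePreserving_piFinSuccAbove μ 0).symm
    have h2 := (measurePreserving_piFinSuccAbove ν 0).symm
    rw [← h1.map_eq, ← h2.map_eq]
    apply Measure.AbsolutelyContinuous.map _ h1.measurable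
    exact Measure.AbsolutelyContinuous.prod (h 0) (ih _ _ fun i => h _)

lemma stdG_ac (d : ℕ) : stdG d ≪ volume := by
  rw [volume_pi]; exact pi_ac _ _ fun _ => gaussianReal_absolutelyContinuous _ one_ne_zero

lemma stdG_mean (d : ℕ) : ∫ x, x ∂(stdG d) = 0 := by
  ext i
  have := (ContinuousLinearMap.proj (R := ℝ) (φ := fun _ : Fin d => ℝ) i).integral_comp_comm
    (IsGaussian.integrable_id (μ := stdG d))
  simp only [id, ContinuousLinearMap.proj_apply] at this
  rw [← this]
  have := integral_comp_eval (μ := fun _ : Fin d => gaussianReal 0 1) (i := i) (f := fun x => x)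
    (by fun_prop)
  simpa using this

lemma integrable_exp_abs (c : ℝ) : Integrable (fun x => Real.exp (c * |x|)) (gaussianReal 0 1) := by
  have h1 := integrable_exp_mul_gaussianReal (μ := 0) (v := 1) c
  have h2 := integrable_exp_mul_gaussianReal (μ := 0) (v := 1) (-c)
  refine (h1.add h2).mono' (by fun_prop) (ae_of_all _ fun x => ?_)
  rw [Real.norm_eq_abs, Real.abs_exp]
  simp only [Pi.add_apply]
  rcases abs_cases x with ⟨h, _⟩ | ⟨h, _⟩ <;> rw [h]
  · have := Real.exp_pos (-c * x); linarith
  · have := Real.exp_pos (c * x); have h3 : c * -x = -c * x := by ring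
    rw [h3]; linarith

lemma integrable_exp_e2norm {d : ℕ} {c : ℝ} (hc : 0 ≤ c) :
    Integrable (fun x => Real.exp (c * e2norm x)) (stdG d) := by
  have h := Integrable.fintype_prod (𝕜 := ℝ) (μ := fun _ : Fin d => gaussianReal 0 1)
    (f := fun _ x => Real.exp (c * |x|)) (fun _ => integrable_exp_abs c)
  refine h.mono' (by fun_prop) (ae_of_all _ fun x => ?_)
  rw [Real.norm_eq_abs, Real.abs_exp, ← Real.exp_sum, ← Finset.mul_sum]
  exact Real.exp_le_exp.2 (mul_le_mul_of_nonneg_left (e2norm_le_sum_abs x) hc)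

lemma integrable_e2norm {d : ℕ} : Integrable (fun x => e2norm x) (stdG d) := by
  refine (integrable_exp_e2norm (d := d) zero_le_one).mono' (by fun_prop) (ae_of_all _ fun x => ?_)
  rw [Real.norm_eq_abs, abs_of_nonneg (e2norm_nonneg x), one_mul]
  have := Real.add_one_le_exp (e2norm x); linarith

lemma integrable_of_e2lip {d : ℕ} {F : (Fin d → ℝ) → ℝ} {L : ℝ}
    (hF : ∀ x y, |F x - F y| ≤ L * e2norm (x - y)) : Integrable F (stdG d) := by
  have hc := continuous_of_e2lip hF
  refine ((integrable_const |F 0|).add (integrable_e2norm.const_mul L)).mono'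
    hc.measurable.aestronglyMeasurable (ae_of_all _ fun x => ?_)
  have := hF x 0
  rw [sub_zero] at this
  have h2 := abs_add_le (F x - F 0) (F 0)
  simp only [sub_add_cancel] at h2
  simp only [Pi.add_apply, Real.norm_eq_abs]; linarith

lemma integral_exp_linear {d : ℕ} (c : Fin d → ℝ) :
    ∫ y, Real.exp (∑ i, c i * y i) ∂(stdG d) = Real.exp ((∑ i, c i ^ 2) / 2) := by
  simp_rw [Real.exp_sum]
  rw [integral_fintype_prod_eq_prod (𝕜 := ℝ) (μ := fun _ : Fin d => gaussianReal 0 1)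
    (f := fun i x => Real.exp (c i * x))]
  have : ∀ i, ∫ x, Real.exp (c i * x) ∂(gaussianReal 0 1) = Real.exp (c i ^ 2 / 2) := fun i => by
    have := congrFun (mgf_fun_id_gaussianReal (μ := 0) (v := 1)) (c i)
    simpa [mgf] using this
  simp_rw [this, ← Real.exp_sum, Finset.sum_div]
end

section
open MeasureTheory ProbabilityTheory Filter Topology

lemma e2lip_bound {d : ℕ} {F : (Fin d → ℝ) → ℝ} {L : ℝ} (hL : 0 ≤ L)
    (hF : ∀ x y, |F x - F y| ≤ L * e2norm (x - y)) {s c' : ℝ} (x y : Fin d → ℝ) (M : ℝ) (hM : 0 ≤ M)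
    (hs : M * |s| ≤ 2) (hc : M * |c' - 1| ≤ 2) :
    M * |F (c' • x + s • y) - F x| ≤ 2 * L * (e2norm x + e2norm y) := by
  have h1 := hF (c' • x + s • y) x
  have h2 : c' • x + s • y - x = (c' - 1) • x + s • y := by
    rw [sub_smul, one_smul]; abel
  rw [h2] at h1
  have h3 := e2norm_add_le ((c' - 1) • x) (s • y)
  rw [e2norm_smul, e2norm_smul] at h3
  have hx := e2norm_nonneg x
  have hy := e2norm_nonneg y
  calc M * |F (c' • x + s • y) - F x| ≤ M * (L * (|c' - 1| * e2norm x + |s| * e2norm y)) := by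
        gcongr; exact h1.trans (by gcongr)
    _ = L * ((M * |c' - 1|) * e2norm x + (M * |s|) * e2norm y) := by ring
    _ ≤ L * (2 * e2norm x + 2 * e2norm y) := by gcongr
    _ = _ := by ring

/-- angle step -/
noncomputable def stp (M : ℕ) : ℝ := Real.pi / (2 * (M + 1))

lemma stp_pos (M : ℕ) : 0 < stp M := by unfold stp; positivity

lemma stp_mul (M : ℕ) : ((M : ℝ) + 1) * stp M = Real.pi / 2 := by
  unfold stp; field_simp

lemma stp_sin (M : ℕ) : ((M : ℝ) + 1) * |Real.sin (stp M)| ≤ 2 := by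
  have h1 : |Real.sin (stp M)| ≤ stp M := by
    have := @Real.abs_sin_le_abs (stp M)
    rwa [abs_of_pos (stp_pos M)] at this
  have h2 : ((M : ℝ) + 1) * |Real.sin (stp M)| ≤ (M + 1) * stp M := by gcongr
  rw [stp_mul] at h2
  have := Real.pi_le_four; linarith

lemma stp_cos (M : ℕ) : ((M : ℝ) + 1) * |Real.cos (stp M) - 1| ≤ 2 := by
  have h1 : |Real.cos (stp M) - 1| ≤ stp M := by
    rw [abs_sub_comm, abs_of_nonneg (by linarith [Real.cos_le_one (stp M)])]
    have h := Real.one_sub_sq_div_two_le_cos (x := stp M)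
    by_cases h2 : stp M ≤ 2
    · nlinarith [stp_pos M]
    · have := Real.neg_one_le_cos (stp M); linarith
  have h2 : ((M : ℝ) + 1) * |Real.cos (stp M) - 1| ≤ (M + 1) * stp M := by gcongr
  rw [stp_mul] at h2
  have := Real.pi_le_four; linarith

lemma integrable_exp_two {d : ℕ} {c : ℝ} (hc : 0 ≤ c) :
    Integrable (fun p : (Fin d → ℝ) × (Fin d → ℝ) => Real.exp (c * (e2norm p.1 + e2norm p.2)))
      ((stdG d).prod (stdG d)) := by
  have := (integrable_exp_e2norm (d := d) hc).mul_prod (integrable_exp_e2norm (d := d) hc)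
  refine this.congr (ae_of_all _ fun p => ?_)
  simp only [← Real.exp_add]; ring_nf

lemma conc_step {d : ℕ} {F : (Fin d → ℝ) → ℝ} {L : ℝ} (hL : 0 ≤ L)
    (hF : ∀ x y, |F x - F y| ≤ L * e2norm (x - y)) (l : ℝ) (M : ℕ) :
    ∫ p, Real.exp (l * (F p.2 - F p.1)) ∂((stdG d).prod (stdG d)) ≤
    ∫ p, Real.exp (l * ((M + 1) * (F (Real.cos (stp M) • p.1 + Real.sin (stp M) • p.2) - F p.1)))
      ∂((stdG d).prod (stdG d)) := by
  set μ := (stdG d).prod (stdG d) with hμ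
  have hFc := continuous_of_e2lip hF
  set B : (Fin d → ℝ) × (Fin d → ℝ) → ℝ := fun p =>
    Real.exp (l * ((M + 1) * (F (Real.cos (stp M) • p.1 + Real.sin (stp M) • p.2) - F p.1))) with hB
  have hBi : Integrable B μ := by
    refine (integrable_exp_two (d := d) (c := |l| * (2 * L)) (by positivity)).mono'
      (by apply Continuous.aestronglyMeasurable; fun_prop) (ae_of_all _ fun p => ?_)
    rw [Real.norm_eq_abs, Real.abs_exp]
    apply Real.exp_le_exp.2
    have := e2lip_bound hL hF p.1 p.2 (M + 1) (by positivity) (stp_sin M) (stp_cos M)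
    calc _ ≤ |l * ((M + 1) * (F (Real.cos (stp M) • p.1 + Real.sin (stp M) • p.2) - F p.1))| := le_abs_self _
      _ = |l| * ((M + 1) * |F (Real.cos (stp M) • p.1 + Real.sin (stp M) • p.2) - F p.1|) := by
          rw [abs_mul, abs_mul, abs_of_pos (by positivity : (0:ℝ) < M + 1)]
      _ ≤ |l| * (2 * L * (e2norm p.1 + e2norm p.2)) := by gcongr
      _ = _ := by ring
  let R : ℕ → ((Fin d → ℝ) × (Fin d → ℝ)) →L[ℝ] ((Fin d → ℝ) × (Fin d → ℝ)) := fun j =>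
    ContinuousLinearMap.rotation (j * stp M)
  have hrot : ∀ j, μ.map (R j) = μ := fun j =>
    IsGaussian.map_rotation_eq_self (μ := stdG d) (by simpa using stdG_mean d) _
  have hmp : ∀ j, MeasurePreserving (R j) μ μ := fun j => ⟨(R j).measurable, hrot j⟩
  have hRi : ∀ j, Integrable (fun p => B (R j p)) μ := fun j =>
    (hmp j).integrable_comp_of_integrable hBi
  have hRe : ∀ j, ∫ p, B (R j p) ∂μ = ∫ p, B p ∂μ := fun j => by
    conv_rhs => rw [← hrot j]
    rw [integral_map (R j).measurable.aemeasurable]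
    rw [hrot j]; exact hBi.aestronglyMeasurable
  have hpt : ∀ p, Real.exp (l * (F p.2 - F p.1)) ≤
      ∑ j ∈ Finset.range (M + 1), (1 / ((M:ℝ) + 1)) * B (R j p) := by
    intro p
    let Z : ℕ → (Fin d → ℝ) := fun j => (R j p).1
    have hZ0 : Z 0 = p.1 := by simp [Z, R, ContinuousLinearMap.rotation_apply]
    have hZM : Z (M + 1) = p.2 := by
      simp only [Z, R, ContinuousLinearMap.rotation_apply]
      push_cast; rw [stp_mul]; simp
    have hZs : ∀ j, Real.cos (stp M) • (R j p).1 + Real.sin (stp M) • (R j p).2 = Z (j + 1) := by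
      intro j
      simp only [Z, R, ContinuousLinearMap.rotation_apply]
      push_cast
      rw [add_mul, one_mul, Real.cos_add, Real.sin_add]
      ext i; simp; ring
    have htel : F p.2 - F p.1 = ∑ j ∈ Finset.range (M + 1), (F (Z (j + 1)) - F (Z j)) := by
      rw [Finset.sum_range_sub (fun j => F (Z j)), hZ0, hZM]
    have hconv := convexOn_exp.map_sum_le (t := Finset.range (M + 1)) (w := fun _ => 1 / ((M:ℝ) + 1))
      (p := fun j => l * ((M + 1) * (F (Z (j + 1)) - F (Z j)))) (fun _ _ => by positivity)
      (by simp; field_simp) (fun _ _ => Set.mem_univ _)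
    have he : l * (F p.2 - F p.1) = ∑ j ∈ Finset.range (M + 1), (1 / ((M:ℝ) + 1)) •
        (l * ((M + 1) * (F (Z (j + 1)) - F (Z j)))) := by
      rw [htel, Finset.mul_sum]; refine Finset.sum_congr rfl fun j _ => ?_
      simp only [smul_eq_mul]; field_simp
    rw [he]; refine hconv.trans (le_of_eq ?_)
    refine Finset.sum_congr rfl fun j _ => ?_
    simp only [smul_eq_mul, hB, hZs]; rfl
  calc _ ≤ ∫ p, ∑ j ∈ Finset.range (M + 1), (1 / ((M:ℝ) + 1)) * B (R j p) ∂μ := by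
        apply integral_mono_of_nonneg (ae_of_all _ fun p => (Real.exp_pos _).le)
        · exact integrable_finsetSum _ fun j _ => (hRi j).const_mul _
        · exact ae_of_all _ hpt
    _ = ∫ p, B p ∂μ := by
        rw [integral_finsetSum _ fun j _ => (hRi j).const_mul _]
        simp_rw [integral_const_mul, hRe]; simp; field_simp
end

section
open MeasureTheory ProbabilityTheory Filter Topology

lemma e2lip_fderiv {d : ℕ} {F : (Fin d → ℝ) → ℝ} {L : ℝ}
    (hF : ∀ x y, |F x - F y| ≤ L * e2norm (x - y)) {x : Fin d → ℝ} (hd : DifferentiableAt ℝ F x)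
    (y : Fin d → ℝ) : |fderiv ℝ F x y| ≤ L * e2norm y := by
  have hline : HasDerivAt (fun t : ℝ => F (x + t • y)) (fderiv ℝ F x y) 0 := by
    have h1 : HasDerivAt (fun t : ℝ => x + t • y) y 0 := by
      simpa using ((hasDerivAt_id (0:ℝ)).smul_const y).const_add x
    have h2 : HasFDerivAt F (fderiv ℝ F x) (x + (0:ℝ) • y) := by simpa using hd.hasFDerivAt
    exact h2.comp_hasDerivAt 0 h1
  have hl := (hline.tendsto_slope).norm
  refine le_of_tendsto hl ?_
  filter_upwards [self_mem_nhdsWithin] with t ht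
  have ht' : t ≠ 0 := ht
  have := hF (x + t • y) x
  rw [add_sub_cancel_left, e2norm_smul] at this
  simp only [slope, sub_zero, zero_smul, add_zero, vsub_eq_sub, smul_eq_mul, norm_mul, norm_inv, Real.norm_eq_abs]
  rw [inv_mul_le_iff₀ (abs_pos.2 ht')]; linarith

lemma e2lip_grad {d : ℕ} {F : (Fin d → ℝ) → ℝ} {L : ℝ} (hL : 0 ≤ L)
    (hF : ∀ x y, |F x - F y| ≤ L * e2norm (x - y)) {x : Fin d → ℝ} (hd : DifferentiableAt ℝ F x) :
    ∑ i, (fderiv ℝ F x (Pi.single i 1)) ^ 2 ≤ L ^ 2 := by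
  set c : Fin d → ℝ := fun i => fderiv ℝ F x (Pi.single i 1) with hc
  have h1 : fderiv ℝ F x c = ∑ i, c i ^ 2 := by
    conv_lhs => rw [← Finset.univ_sum_single c]
    rw [map_sum]; refine Finset.sum_congr rfl fun i _ => ?_
    have : (Pi.single i (c i) : Fin d → ℝ) = c i • Pi.single i 1 := by
      rw [← Pi.single_smul, smul_eq_mul, mul_one]
    rw [this, map_smul, smul_eq_mul, sq]
  have h2 := (le_abs_self _).trans (e2lip_fderiv hF hd c)
  rw [h1, ← e2norm_sq] at h2
  change ∑ i, c i ^ 2 ≤ L ^ 2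
  rw [← e2norm_sq]
  have h0 := e2norm_nonneg c
  have : e2norm c ≤ L := by
    by_contra hlt; push Not at hlt; nlinarith
  gcongr

lemma fderiv_eq_sum {d : ℕ} (A : (Fin d → ℝ) →L[ℝ] ℝ) (y : Fin d → ℝ) :
    A y = ∑ i, A (Pi.single i 1) * y i := by
  conv_lhs => rw [← Finset.univ_sum_single y]
  rw [map_sum]; refine Finset.sum_congr rfl fun i _ => ?_
  have : (Pi.single i (y i) : Fin d → ℝ) = y i • Pi.single i 1 := by
    rw [← Pi.single_smul, smul_eq_mul, mul_one]
  rw [this, map_smul, smul_eq_mul, mul_comm]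

lemma e2lip_ae_diff {d : ℕ} {F : (Fin d → ℝ) → ℝ} {L : ℝ} (hL : 0 ≤ L)
    (hF : ∀ x y, |F x - F y| ≤ L * e2norm (x - y)) : ∀ᵐ x ∂(stdG d), DifferentiableAt ℝ F x := by
  have hlip : LipschitzWith (Real.toNNReal (L * d)) F := by
    apply LipschitzWith.of_dist_le_mul
    intro x y
    rw [Real.dist_eq, Real.coe_toNNReal _ (by positivity)]
    refine (hF x y).trans ?_
    have : e2norm (x - y) ≤ d * dist x y := by
      refine (e2norm_le_sum_abs _).trans ?_
      calc ∑ i, |(x - y) i| ≤ ∑ _i : Fin d, dist x y := by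
            gcongr with i; rw [Pi.sub_apply, ← Real.dist_eq]; exact dist_le_pi_dist x y i
        _ = _ := by simp
    calc _ ≤ L * (d * dist x y) := by gcongr
      _ = _ := by ring
  exact (stdG_ac d).ae_le hlip.ae_differentiableAt

theorem conc_mgf2 {d : ℕ} {F : (Fin d → ℝ) → ℝ} {L : ℝ} (hL : 0 ≤ L)
    (hF : ∀ x y, |F x - F y| ≤ L * e2norm (x - y)) (l : ℝ) :
    ∫ p, Real.exp (l * (F p.2 - F p.1)) ∂((stdG d).prod (stdG d)) ≤
      Real.exp (l ^ 2 * Real.pi ^ 2 * L ^ 2 / 8) := by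
  set μ := (stdG d).prod (stdG d) with hμ
  have hFc := continuous_of_e2lip hF
  let c : (Fin d → ℝ) → Fin d → ℝ := fun x i => fderiv ℝ F x (Pi.single i 1)
  have hcm : ∀ i, Measurable fun x => c x i := fun i => measurable_fderiv_apply_const ℝ F _
  let G : (Fin d → ℝ) × (Fin d → ℝ) → ℝ := fun p => Real.exp (∑ i, (l * (Real.pi / 2) * c p.1 i) * p.2 i)
  have hdx := e2lip_ae_diff hL hF
  have hdp : ∀ᵐ p ∂μ, DifferentiableAt ℝ F p.1 :=
    Measure.quasiMeasurePreserving_fst.ae hdx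
  have hlim : Tendsto (fun M : ℕ => ∫ p, Real.exp (l * ((M + 1) *
      (F (Real.cos (stp M) • p.1 + Real.sin (stp M) • p.2) - F p.1))) ∂μ) atTop (𝓝 (∫ p, G p ∂μ)) := by
    refine tendsto_integral_of_dominated_convergence _ (fun M => ?_)
      (integrable_exp_two (d := d) (c := |l| * (2 * L)) (by positivity)) (fun M => ?_) ?_
    · apply Continuous.aestronglyMeasurable; fun_prop
    · refine ae_of_all _ fun p => ?_
      rw [Real.norm_eq_abs, Real.abs_exp]
      apply Real.exp_le_exp.2
      have := e2lip_bound hL hF p.1 p.2 (M + 1) (by positivity) (stp_sin M) (stp_cos M)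
      calc _ ≤ |l * ((M + 1) * (F (Real.cos (stp M) • p.1 + Real.sin (stp M) • p.2) - F p.1))| := le_abs_self _
        _ = |l| * ((M + 1) * |F (Real.cos (stp M) • p.1 + Real.sin (stp M) • p.2) - F p.1|) := by
            rw [abs_mul, abs_mul, abs_of_pos (by positivity : (0:ℝ) < M + 1)]
        _ ≤ |l| * (2 * L * (e2norm p.1 + e2norm p.2)) := by gcongr
        _ = _ := by ring
    · filter_upwards [hdp] with p hp
      refine (Real.continuous_exp.tendsto _).comp ?_
      have hcurve : HasDerivAt (fun t : ℝ => F (Real.cos t • p.1 + Real.sin t • p.2)) (fderiv ℝ F p.1 p.2) 0 := by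
        have h1 : HasDerivAt (fun t : ℝ => Real.cos t • p.1 + Real.sin t • p.2) p.2 0 := by
          have := ((Real.hasDerivAt_cos 0).smul_const p.1).add ((Real.hasDerivAt_sin 0).smul_const p.2)
          simp only [Real.sin_zero, neg_zero, zero_smul, Real.cos_zero, one_smul, zero_add] at this
          exact this
        have h2 : HasFDerivAt F (fderiv ℝ F p.1) (Real.cos 0 • p.1 + Real.sin 0 • p.2) := by
          simpa using hp.hasFDerivAt
        exact h2.comp_hasDerivAt 0 h1
      have hs0 : Tendsto stp atTop (𝓝[≠] 0) := by
        rw [tendsto_nhdsWithin_iff]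
        refine ⟨?_, Eventually.of_forall fun M => (stp_pos M).ne'⟩
        have : stp = fun M : ℕ => (Real.pi / 2) * (1 / ((M:ℝ) + 1)) := by
          ext M; unfold stp; field_simp
        rw [this]; simpa using tendsto_one_div_add_atTop_nhds_zero_nat.const_mul (Real.pi / 2)
      have h3 := ((hcurve.tendsto_slope).comp hs0).const_mul (l * (Real.pi / 2))
      have h4 : l * (Real.pi / 2) * (fderiv ℝ F p.1) p.2 = ∑ i, (l * (Real.pi / 2) * c p.1 i) * p.2 i := by
        rw [fderiv_eq_sum, Finset.mul_sum]; simp only [c, mul_assoc]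
      rw [h4] at h3
      refine h3.congr fun M => ?_
      simp only [Function.comp, slope, vsub_eq_sub, sub_zero, smul_eq_mul, Real.cos_zero, one_smul,
        Real.sin_zero, zero_smul, add_zero]
      have := stp_mul M
      have h5 := (stp_pos M).ne'
      rw [← this]; field_simp
  have hGm : Measurable G := by
    have : ∀ i, Measurable fun p : (Fin d → ℝ) × (Fin d → ℝ) => c p.1 i := fun i => (hcm i).comp measurable_fst
    fun_prop
  have hkey : ∀ x, DifferentiableAt ℝ F x → ∫ y, G (x, y) ∂(stdG d) ≤ Real.exp (l ^ 2 * Real.pi ^ 2 * L ^ 2 / 8) := by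
    intro x hx
    simp only [G]
    rw [integral_exp_linear]
    apply Real.exp_le_exp.2
    have := e2lip_grad hL hF hx
    calc _ = (l ^ 2 * Real.pi ^ 2 / 8) * ∑ i, c x i ^ 2 := by
          rw [Finset.mul_sum, Finset.sum_div]; refine Finset.sum_congr rfl fun i _ => by ring
      _ ≤ (l ^ 2 * Real.pi ^ 2 / 8) * L ^ 2 := by gcongr
      _ = _ := by ring
  have hGi : Integrable G μ := by
    refine (integrable_exp_two (d := d) (c := |l| * (2 * L)) (by positivity)).mono'
      hGm.aestronglyMeasurable ?_
    filter_upwards [hdp] with p hp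
    simp only [G]
    rw [Real.norm_eq_abs, Real.abs_exp]
    apply Real.exp_le_exp.2
    have h4 : ∑ i, (l * (Real.pi / 2) * c p.1 i) * p.2 i = l * (Real.pi / 2) * (fderiv ℝ F p.1) p.2 := by
      rw [fderiv_eq_sum, Finset.mul_sum]; simp only [c, mul_assoc]
    rw [h4]
    have h5 := e2lip_fderiv hF hp p.2
    have h6 := e2norm_nonneg p.1
    have h7 := e2norm_nonneg p.2
    have hpi := Real.pi_le_four
    calc _ ≤ |l * (Real.pi / 2) * (fderiv ℝ F p.1) p.2| := le_abs_self _
      _ = |l| * (Real.pi / 2) * |(fderiv ℝ F p.1) p.2| := by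
        rw [abs_mul, abs_mul, abs_of_pos (by positivity : (0:ℝ) < Real.pi / 2)]
      _ ≤ |l| * 2 * (L * (e2norm p.1 + e2norm p.2)) := by
        gcongr
        · linarith
        · refine h5.trans ?_; gcongr; linarith
      _ = _ := by ring
  refine (ge_of_tendsto' hlim fun M => conc_step hL hF l M).trans ?_
  rw [integral_prod _ hGi]
  calc _ ≤ ∫ _x, Real.exp (l ^ 2 * Real.pi ^ 2 * L ^ 2 / 8) ∂(stdG d) := by
        apply integral_mono_of_nonneg
        · exact ae_of_all _ fun x => integral_nonneg fun y => (Real.exp_pos _).le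
        · exact integrable_const _
        · filter_upwards [hdx] with x hx using hkey x hx
    _ = _ := by simp

lemma integrable_exp_lip {d : ℕ} {F : (Fin d → ℝ) → ℝ} {L : ℝ} (hL : 0 ≤ L)
    (hF : ∀ x y, |F x - F y| ≤ L * e2norm (x - y)) (l : ℝ) :
    Integrable (fun x => Real.exp (l * F x)) (stdG d) := by
  have hFc := continuous_of_e2lip hF
  refine ((integrable_exp_e2norm (d := d) (c := |l| * L) (by positivity)).const_mul
    (Real.exp (|l| * |F 0|))).mono' (by apply Continuous.aestronglyMeasurable; fun_prop) (ae_of_all _ fun x => ?_)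
  rw [Real.norm_eq_abs, Real.abs_exp, ← Real.exp_add]
  apply Real.exp_le_exp.2
  have h1 := hF x 0
  rw [sub_zero] at h1
  have h2 := abs_add_le (F x - F 0) (F 0)
  rw [sub_add_cancel] at h2
  calc l * F x ≤ |l * F x| := le_abs_self _
    _ = |l| * |F x| := abs_mul _ _
    _ ≤ |l| * (|F 0| + L * e2norm x) := by gcongr; linarith
    _ = _ := by ring

theorem conc_mgf {d : ℕ} {F : (Fin d → ℝ) → ℝ} {L : ℝ} (hL : 0 ≤ L)
    (hF : ∀ x y, |F x - F y| ≤ L * e2norm (x - y)) (l : ℝ) :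
    ∫ x, Real.exp (l * (F x - ∫ y, F y ∂(stdG d))) ∂(stdG d) ≤
      Real.exp (l ^ 2 * Real.pi ^ 2 * L ^ 2 / 8) := by
  have hFi := integrable_of_e2lip hF
  refine le_trans ?_ (conc_mgf2 hL hF l)
  have he : ∀ p : (Fin d → ℝ) × (Fin d → ℝ), Real.exp (l * (F p.2 - F p.1)) =
      Real.exp (-l * F p.1) * Real.exp (l * F p.2) := fun p => by rw [← Real.exp_add]; ring_nf
  have he2 : ∀ x, Real.exp (l * (F x - ∫ y, F y ∂(stdG d))) =
      Real.exp (-l * ∫ y, F y ∂(stdG d)) * Real.exp (l * F x) := fun p => by rw [← Real.exp_add]; ring_nf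
  simp_rw [he, he2]
  rw [integral_prod_mul (fun x => Real.exp (-l * F x)) (fun x => Real.exp (l * F x)), integral_const_mul]
  refine mul_le_mul_of_nonneg_right ?_ (integral_nonneg fun _ => (Real.exp_pos _).le)
  have := convexOn_exp.map_integral_le (μ := stdG d) (f := fun x => -l * F x) Real.continuous_exp.continuousOn
    isClosed_univ (ae_of_all _ fun _ => Set.mem_univ _) (hFi.const_mul _) (integrable_exp_lip hL hF (-l))
  rwa [integral_const_mul] at this

theorem gauss_conc_upper {d : ℕ} {F : (Fin d → ℝ) → ℝ} {L : ℝ} (hL : 0 < L)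
    (hF : ∀ x y, |F x - F y| ≤ L * e2norm (x - y)) {t : ℝ} (ht : 0 ≤ t) :
    (stdG d).real {x | (∫ y, F y ∂(stdG d)) + t ≤ F x} ≤ Real.exp (-(t ^ 2 / (5 * L ^ 2))) := by
  have hpi : Real.pi ^ 2 ≤ 10 := by nlinarith [Real.pi_lt_d2, Real.pi_pos]
  set m := ∫ y, F y ∂(stdG d)
  set l : ℝ := 2 * t / (5 * L ^ 2) with hl
  have hl0 : 0 ≤ l := by positivity
  have hint : Integrable (fun x => Real.exp (l * (F x - m))) (stdG d) := by
    have he2 : ∀ x, Real.exp (l * (F x - m)) =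
      Real.exp (-l * m) * Real.exp (l * F x) := fun p => by rw [← Real.exp_add]; ring_nf
    simp_rw [he2]; exact (integrable_exp_lip hL.le hF l).const_mul _
  have h1 := measure_ge_le_exp_mul_mgf (μ := stdG d) (X := fun x => F x - m) t hl0 hint
  have h2 : {x | t ≤ F x - m} = {x | m + t ≤ F x} := by
    ext x; simp only [Set.mem_ofPred_eq]; constructor <;> intro h <;> linarith
  rw [h2] at h1
  refine h1.trans ?_
  have h3 := conc_mgf hL.le hF l
  calc _ ≤ Real.exp (-l * t) * Real.exp (l ^ 2 * Real.pi ^ 2 * L ^ 2 / 8) := by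
        gcongr; exact h3
    _ ≤ Real.exp (-l * t) * Real.exp (l ^ 2 * 10 * L ^ 2 / 8) := by gcongr
    _ = Real.exp (-(t ^ 2 / (5 * L ^ 2))) := by
        rw [← Real.exp_add]; congr 1; rw [hl]; field_simp; ring

theorem gauss_conc_lower {d : ℕ} {F : (Fin d → ℝ) → ℝ} {L : ℝ} (hL : 0 < L)
    (hF : ∀ x y, |F x - F y| ≤ L * e2norm (x - y)) {t : ℝ} (ht : 0 ≤ t) :
    (stdG d).real {x | F x ≤ (∫ y, F y ∂(stdG d)) - t} ≤ Real.exp (-(t ^ 2 / (5 * L ^ 2))) := by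
  have := gauss_conc_upper (F := fun x => - F x) hL (fun x y => by
    have := hF x y; rwa [← abs_neg, show -(-F x - -F y) = F x - F y by ring]) ht
  rw [integral_neg] at this
  convert this using 3
  ext x; constructor <;> intro h <;> linarith
end

section
open MeasureTheory ProbabilityTheory Filter Topology
open scoped BoundedContinuousFunction

section Lindeberg
variable {κ : Type*} [Fintype κ]

lemma integrable_bcf_comp {μ : Measure (κ → ℝ)} [IsProbabilityMeasure μ] (f : (κ → ℝ) →ᵇ ℝ) (s : ℝ) (z : κ → ℝ) :
    Integrable (fun x => f (z + s • x)) μ :=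
  Integrable.of_bound (by apply Continuous.aestronglyMeasurable; fun_prop) ‖f‖
    (ae_of_all _ fun x => f.norm_coe_le_norm _)

noncomputable def Pop (μ : Measure (κ → ℝ)) [IsProbabilityMeasure μ] (s : ℝ) (f : (κ → ℝ) →ᵇ ℝ) : (κ → ℝ) →ᵇ ℝ :=
  BoundedContinuousFunction.ofNormedAddCommGroup (fun z => ∫ x, f (z + s • x) ∂μ)
    (by
      refine continuous_of_dominated (F := fun z x => f (z + s • x)) (bound := fun _ => ‖f‖) (fun z => ?_) (fun z => ?_) (integrable_const _) ?_
      · apply Continuous.aestronglyMeasurable; fun_prop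
      · exact ae_of_all _ fun x => f.norm_coe_le_norm _
      · exact ae_of_all _ fun x => by fun_prop)
    ‖f‖ (fun z => by
      refine (norm_integral_le_of_norm_le_const (ae_of_all _ fun x => f.norm_coe_le_norm _)).trans ?_
      simp)

lemma Pop_apply (μ : Measure (κ → ℝ)) [IsProbabilityMeasure μ] (s : ℝ) (f : (κ → ℝ) →ᵇ ℝ) (z : κ → ℝ) :
    Pop μ s f z = ∫ x, f (z + s • x) ∂μ := rfl

lemma Pop_mono (μ : Measure (κ → ℝ)) [IsProbabilityMeasure μ] (s : ℝ) (f g : (κ → ℝ) →ᵇ ℝ) (ε : ℝ)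
    (h : ∀ z, g z - ε ≤ f z) (z : κ → ℝ) : Pop μ s g z - ε ≤ Pop μ s f z := by
  simp only [Pop_apply]
  have : ∫ x, g (z + s • x) ∂μ - ε = ∫ x, (g (z + s • x) - ε) ∂μ := by
    rw [integral_sub (integrable_bcf_comp g s z) (integrable_const _)]; simp
  rw [this]
  exact integral_mono ((integrable_bcf_comp g s z).sub (integrable_const _)) (integrable_bcf_comp f s z)
    (fun x => h _)

lemma Pop_mono_iter (μ : Measure (κ → ℝ)) [IsProbabilityMeasure μ] (s : ℝ) (f g : (κ → ℝ) →ᵇ ℝ) (ε : ℝ)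
    (h : ∀ z, g z - ε ≤ f z) (j : ℕ) : ∀ z, (Pop μ s)^[j] g z - ε ≤ (Pop μ s)^[j] f z := by
  induction j with
  | zero => simpa using h
  | succ j ih => simp only [Function.iterate_succ_apply']; exact Pop_mono μ s _ _ ε ih

lemma Pop_comm (μ ν : Measure (κ → ℝ)) [IsProbabilityMeasure μ] [IsProbabilityMeasure ν] (s t : ℝ) :
    Function.Commute (Pop μ s) (Pop ν t) := by
  intro f; ext z
  simp only [Pop_apply]
  rw [integral_integral_swap]
  · congr 1; ext x; congr 1; ext y; congr 1; abel
  · refine Integrable.of_bound (by apply Continuous.aestronglyMeasurable; fun_prop) ‖f‖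
      (ae_of_all _ fun x => f.norm_coe_le_norm _)

lemma rot_fst {μ : Measure (κ → ℝ)} [IsGaussian μ] (hμ : ∫ x, x ∂μ = 0) (a b : ℝ) (hab : a ^ 2 + b ^ 2 = 1) (hb : 0 ≤ b)
    (f : (κ → ℝ) →ᵇ ℝ) : ∫ x, ∫ y, f (a • x + b • y) ∂μ ∂μ = ∫ x, f x ∂μ := by
  have ha1 : -1 ≤ a := by nlinarith
  have ha2 : a ≤ 1 := by nlinarith
  have hc : Real.cos (Real.arccos a) = a := Real.cos_arccos ha1 ha2
  have hs : Real.sin (Real.arccos a) = b := by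
    rw [Real.sin_arccos, show 1 - a ^ 2 = b ^ 2 by linarith, Real.sqrt_sq hb]
  have hrot := IsGaussian.map_rotation_eq_self (μ := μ) (by simpa using hμ) (Real.arccos a)
  rw [integral_integral (f := fun x y => f (a • x + b • y))]
  · calc ∫ p, f (a • p.1 + b • p.2) ∂(μ.prod μ) 
        = ∫ p, f ((ContinuousLinearMap.rotation (Real.arccos a) p).1) ∂(μ.prod μ) := by
          simp only [ContinuousLinearMap.rotation_apply, hc, hs]
      _ = ∫ p, f p.1 ∂((μ.prod μ).map (ContinuousLinearMap.rotation (Real.arccos a))) := by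
          rw [integral_map (ContinuousLinearMap.measurable _).aemeasurable]
          apply Continuous.aestronglyMeasurable; fun_prop
      _ = ∫ p, f p.1 ∂(μ.prod μ) := by rw [hrot]
      _ = _ := by
          rw [integral_fun_fst (f := fun x => f x)]; simp
  · refine Integrable.of_bound (by apply Continuous.aestronglyMeasurable; fun_prop) ‖f‖
      (ae_of_all _ fun x => f.norm_coe_le_norm _)

lemma Pop_iter {μ : Measure (κ → ℝ)} [IsGaussian μ] (hμ : ∫ x, x ∂μ = 0) (s : ℝ) (f : (κ → ℝ) →ᵇ ℝ) (j : ℕ) (z : κ → ℝ) :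
    (Pop μ s)^[j] f z = ∫ x, f (z + (√j * s) • x) ∂μ := by
  induction j generalizing z with
  | zero => simp
  | succ j ih =>
    rw [Function.iterate_succ_apply', Pop_apply]
    simp_rw [ih]
    have hj : (0:ℝ) < j + 1 := by positivity
    let g : (κ → ℝ) →ᵇ ℝ := f.compContinuous ⟨fun x => z + (√(j+1) * s) • x, by fun_prop⟩
    have := rot_fst hμ (1 / √(j + 1)) (√j / √(j+1)) (by
      rw [div_pow, div_pow, Real.sq_sqrt hj.le, Real.sq_sqrt (by positivity)]; field_simp; ring) (by positivity) g
    simp only [g, BoundedContinuousFunction.compContinuous_apply, ContinuousMap.coe_mk] at this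
    push_cast
    rw [← this]
    congr 1; ext x; congr 1; ext y; congr 1
    rw [smul_add, smul_smul, smul_smul, add_assoc]
    have h1 : √((j:ℝ) + 1) ≠ 0 := by positivity
    congr 3 <;> field_simp

theorem lindeberg {μ ν : Measure (κ → ℝ)} [IsGaussian μ] [IsGaussian ν] (hμ : ∫ x, x ∂μ = 0) (hν : ∫ x, x ∂ν = 0)
    (f : (κ → ℝ) →ᵇ ℝ) (A : (κ → ℝ) → (κ → ℝ) →L[ℝ] ℝ) (q : (κ → ℝ) → κ → κ → ℝ) (C : ℝ)
    (hT : ∀ z x, |f (z + x) - f z - A z x - (∑ k, ∑ l, q z k l * (x k * x l)) / 2| ≤ C * ‖x‖ ^ 3)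
    (hS : ∀ z, ∑ k, ∑ l, q z k l * (∫ x, x k * x l ∂ν) ≤ ∑ k, ∑ l, q z k l * (∫ x, x k * x l ∂μ)) :
    ∫ x, f x ∂ν ≤ ∫ x, f x ∂μ := by
  have h3 : ∀ (ρ : Measure (κ → ℝ)) [IsGaussian ρ], Integrable (fun x => ‖x‖ ^ 3) ρ := fun ρ _ => by
    have := (IsGaussian.memLp_id ρ 3 (by norm_num)).integrable_norm_pow (by norm_num)
    simpa using this
  have h2 : ∀ (ρ : Measure (κ → ℝ)) [IsGaussian ρ] (k l : κ), Integrable (fun x => x k * x l) ρ := fun ρ _ k l => by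
    have h : ∀ k, MemLp (fun x : κ → ℝ => x k) 2 ρ := fun k => by
      have := IsGaussian.memLp_dual ρ (ContinuousLinearMap.proj (R := ℝ) (φ := fun _ : κ => ℝ) k) 2 (by norm_num)
      exact this
    exact (h k).integrable_mul (h l)
  have h1 : ∀ (ρ : Measure (κ → ℝ)) [IsGaussian ρ] (B : (κ → ℝ) →L[ℝ] ℝ), Integrable (fun x => B x) ρ :=
    fun ρ _ B => IsGaussian.integrable_dual ρ B
  have hB0 : ∀ (ρ : Measure (κ → ℝ)) [IsGaussian ρ] (_ : ∫ x, x ∂ρ = 0) (B : (κ → ℝ) →L[ℝ] ℝ), ∫ x, B x ∂ρ = 0 :=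
    fun ρ _ h0 B => by
      have := IsGaussian.integral_dual (μ := ρ) B
      rw [h0, map_zero] at this; exact this
  -- one step estimate
  have key : ∀ (ρ : Measure (κ → ℝ)) [IsGaussian ρ] (_ : ∫ x, x ∂ρ = 0) (s : ℝ) (_ : 0 ≤ s) (z : κ → ℝ),
      |Pop ρ s f z - f z - s ^ 2 * (∑ k, ∑ l, q z k l * (∫ x, x k * x l ∂ρ)) / 2| ≤ s ^ 3 * (C * ∫ x, ‖x‖ ^ 3 ∂ρ) := by
    intro ρ _ h0 s hs z
    have hq : Integrable (fun x : κ → ℝ => ∑ k, ∑ l, q z k l * (x k * x l)) ρ :=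
      integrable_finsetSum _ fun k _ => integrable_finsetSum _ fun l _ => (h2 ρ k l).const_mul _
    have hqi : ∫ x, ∑ k, ∑ l, q z k l * (x k * x l) ∂ρ = ∑ k, ∑ l, q z k l * (∫ x, x k * x l ∂ρ) := by
      rw [integral_finsetSum _ fun k _ => integrable_finsetSum _ fun l _ => (h2 ρ k l).const_mul _]
      refine Finset.sum_congr rfl fun k _ => ?_
      rw [integral_finsetSum _ fun l _ => (h2 ρ k l).const_mul _]
      refine Finset.sum_congr rfl fun l _ => integral_const_mul _ _
    have e : Pop ρ s f z - f z - s ^ 2 * (∑ k, ∑ l, q z k l * (∫ x, x k * x l ∂ρ)) / 2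
        = ∫ x, (f (z + s • x) - f z - s * A z x - (s ^ 2 * ∑ k, ∑ l, q z k l * (x k * x l)) / 2) ∂ρ := by
      rw [integral_sub, integral_sub, integral_sub, integral_const_mul, hB0 ρ h0, integral_div, integral_const_mul, hqi, Pop_apply]
      · simp
      · exact integrable_bcf_comp f s z
      · exact integrable_const _
      · exact (integrable_bcf_comp f s z).sub (integrable_const _)
      · exact (h1 ρ _).const_mul _
      · exact ((integrable_bcf_comp f s z).sub (integrable_const _)).sub ((h1 ρ _).const_mul _)
      · exact (hq.const_mul _).div_const _
    rw [e]
    have e3 : ∀ x : κ → ℝ, |f (z + s • x) - f z - s * A z x - (s ^ 2 * ∑ k, ∑ l, q z k l * (x k * x l)) / 2| ≤ s ^ 3 * (C * ‖x‖ ^ 3) := by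
      intro x
      have := hT z (s • x)
      rw [norm_smul, Real.norm_eq_abs, abs_of_nonneg hs, map_smul, smul_eq_mul] at this
      have e2 : ∑ k, ∑ l, q z k l * ((s • x) k * (s • x) l) = s ^ 2 * ∑ k, ∑ l, q z k l * (x k * x l) := by
        simp only [Finset.mul_sum]
        refine Finset.sum_congr rfl fun k _ => Finset.sum_congr rfl fun l _ => ?_
        simp only [Pi.smul_apply, smul_eq_mul]; ring
      rw [e2] at this
      refine this.trans (le_of_eq (by ring))
    have e4 : ∫ x : κ → ℝ, s ^ 3 * (C * ‖x‖ ^ 3) ∂ρ = s ^ 3 * (C * ∫ x, ‖x‖ ^ 3 ∂ρ) := by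
      rw [integral_const_mul, integral_const_mul]
    rw [← e4, ← Real.norm_eq_abs]
    exact norm_integral_le_of_norm_le (((h3 ρ).const_mul _).const_mul _) (ae_of_all _ fun x => by
      rw [Real.norm_eq_abs]; exact e3 x)
  set K := C * (∫ x, ‖x‖ ^ 3 ∂μ) + C * ∫ x, ‖x‖ ^ 3 ∂ν with hK
  have step : ∀ s : ℝ, 0 ≤ s → ∀ z, Pop ν s f z - s ^ 3 * K ≤ Pop μ s f z := by
    intro s hs z
    have a1 := abs_le.1 (key μ hμ s hs z)
    have a2 := abs_le.1 (key ν hν s hs z)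
    have a3 := mul_le_mul_of_nonneg_left (hS z) (sq_nonneg s)
    rw [hK, mul_add]; linarith [a1.1, a2.2]
  have iter : ∀ s : ℝ, 0 ≤ s → ∀ j : ℕ, ∀ z, (Pop ν s)^[j] f z - j * (s ^ 3 * K) ≤ (Pop μ s)^[j] f z := by
    intro s hs j
    induction j with
    | zero => simp
    | succ j ih =>
      intro z
      have b1 := Pop_mono μ s _ _ _ ih z
      have b2 := Pop_mono_iter ν s _ _ _ (step s hs) j z
      have b3 : Pop μ s ((Pop ν s)^[j] f) = (Pop ν s)^[j] (Pop μ s f) :=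
        ((Pop_comm μ ν s s).iterate_right j) f
      rw [b3] at b1
      rw [Function.iterate_succ_apply' (Pop μ s), Function.iterate_succ_apply (Pop ν s)]
      push_cast; linarith
  have fin : ∀ M : ℕ, ∫ x, f x ∂ν - K * (1 / √((M:ℝ) + 1)) ≤ ∫ x, f x ∂μ := by
    intro M
    have hM : (0:ℝ) < √((M:ℝ) + 1) := by positivity
    have := iter (1 / √((M:ℝ) + 1)) (by positivity) (M + 1) 0
    rw [Pop_iter hμ, Pop_iter hν] at this
    push_cast at this
    have e1 : √((M:ℝ) + 1) * (1 / √((M:ℝ) + 1)) = 1 := by field_simp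
    have e2 : ((M:ℝ) + 1) * ((1 / √((M:ℝ) + 1)) ^ 3 * K) = K * (1 / √((M:ℝ) + 1)) := by
      have : ((M:ℝ) + 1) = √((M:ℝ) + 1) ^ 2 := (Real.sq_sqrt (by positivity)).symm
      generalize hg : √((M:ℝ) + 1) = g at *
      rw [this]; field_simp
    rw [e1, e2] at this
    simpa using this
  have lim : Tendsto (fun M : ℕ => ∫ x, f x ∂ν - K * (1 / √((M:ℝ) + 1))) atTop (𝓝 (∫ x, f x ∂ν - K * 0)) := by
    apply Tendsto.const_sub; apply Tendsto.const_mul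
    have h := tendsto_one_div_add_atTop_nhds_zero_nat (𝕜 := ℝ)
    have h' := (Real.continuous_sqrt.tendsto _).comp h
    simp only [Real.sqrt_zero] at h'
    refine h'.congr fun M => ?_
    simp
  simpa using le_of_tendsto' lim fin

end Lindeberg
end

section
open MeasureTheory ProbabilityTheory Filter Topology
open scoped BoundedContinuousFunction

section T3sec
variable {κ : Type*} [Fintype κ]

def T3 (f : (κ → ℝ) → ℝ) (a : (κ → ℝ) → κ → ℝ) (q : (κ → ℝ) → κ → κ → ℝ) : Prop :=
  ∃ C, 0 ≤ C ∧ (∀ z, |f z| ≤ C) ∧ (∀ (z x : κ → ℝ), |∑ k, a z k * x k| ≤ C * ‖x‖) ∧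
    (∀ (z x : κ → ℝ), |∑ k, ∑ l, q z k l * (x k * x l)| ≤ C * ‖x‖ ^ 2) ∧
    ∀ (z x : κ → ℝ), |f (z + x) - f z - (∑ k, a z k * x k) - (∑ k, ∑ l, q z k l * (x k * x l)) / 2| ≤ C * ‖x‖ ^ 3

lemma T3_scalar {C n F f A Q G g A' Q' : ℝ} (hC : 0 ≤ C) (hn : 0 ≤ n) (hf : |f| ≤ C) (hG : |G| ≤ C) (hg : |g| ≤ C)
    (hA : |A| ≤ C * n) (hA' : |A'| ≤ C * n) (hQ : |Q| ≤ C * n ^ 2) (hQ' : |Q'| ≤ C * n ^ 2)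
    (hR : |F - f - A - Q / 2| ≤ C * n ^ 3) (hR' : |G - g - A' - Q' / 2| ≤ C * n ^ 3) :
    |F * G - f * g - (f * A' + g * A) - (f * Q' + g * Q + 2 * (A * A')) / 2| ≤ (7 * C ^ 2) * n ^ 3 := by
  have h1 : |G - g - A'| ≤ 3 * C * n ^ 2 := by
    rcases le_total n 1 with h | h
    · have : C * n ^ 3 ≤ C * n ^ 2 := mul_le_mul_of_nonneg_left (pow_le_pow_of_le_one hn h (by norm_num)) hC
      rw [abs_le] at *; constructor <;> nlinarith
    · have e1 : n ≤ n ^ 2 := by nlinarith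
      have : C * n ≤ C * n ^ 2 := mul_le_mul_of_nonneg_left e1 hC
      have : C * 1 ≤ C * n ^ 2 := mul_le_mul_of_nonneg_left (h.trans e1) hC
      rw [abs_le] at *; constructor <;> nlinarith
  have h2 : |G - g| ≤ 3 * C * n := by
    rcases le_total n 1 with h | h
    · have : C * n ^ 3 ≤ C * n := mul_le_mul_of_nonneg_left (by nlinarith [pow_le_pow_of_le_one hn h (show 1 ≤ 3 by norm_num)]) hC
      have : C * n ^ 2 ≤ C * n := mul_le_mul_of_nonneg_left (by nlinarith) hC
      rw [abs_le] at *; constructor <;> nlinarith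
    · have : C * 1 ≤ C * n := mul_le_mul_of_nonneg_left h hC
      rw [abs_le] at *; constructor <;> nlinarith
  have e : F * G - f * g - (f * A' + g * A) - (f * Q' + g * Q + 2 * (A * A')) / 2
      = (F - f - A - Q / 2) * G + f * (G - g - A' - Q' / 2) + A * (G - g - A') + Q / 2 * (G - g) := by ring
  rw [e]
  have a1 : |(F - f - A - Q / 2) * G| ≤ C * n ^ 3 * C := by
    rw [abs_mul]; exact mul_le_mul hR hG (abs_nonneg _) (by positivity)
  have a2 : |f * (G - g - A' - Q' / 2)| ≤ C * (C * n ^ 3) := by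
    rw [abs_mul]; exact mul_le_mul hf hR' (abs_nonneg _) (by positivity)
  have a3 : |A * (G - g - A')| ≤ C * n * (3 * C * n ^ 2) := by
    rw [abs_mul]; exact mul_le_mul hA h1 (abs_nonneg _) (by positivity)
  have a4 : |Q / 2 * (G - g)| ≤ (C * n ^ 2 / 2) * (3 * C * n) := by
    rw [abs_mul]; refine mul_le_mul ?_ h2 (abs_nonneg _) (by positivity)
    rw [abs_div, abs_two]; linarith
  have := abs_add_le ((F - f - A - Q / 2) * G + f * (G - g - A' - Q' / 2) + A * (G - g - A')) (Q / 2 * (G - g))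
  have := abs_add_le ((F - f - A - Q / 2) * G + f * (G - g - A' - Q' / 2)) (A * (G - g - A'))
  have := abs_add_le ((F - f - A - Q / 2) * G) (f * (G - g - A' - Q' / 2))
  have : 0 ≤ C ^ 2 * n ^ 3 := by positivity
  nlinarith

lemma T3.mul {f g : (κ → ℝ) → ℝ} {a b q r} (hf : T3 f a q) (hg : T3 g b r) :
    T3 (fun z => f z * g z) (fun z k => f z * b z k + g z * a z k)
      (fun z k l => f z * r z k l + g z * q z k l + (a z k * b z l + b z k * a z l)) := by
  obtain ⟨C, hC, f0, f1, f2, f3⟩ := hf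
  obtain ⟨D, hD, g0, g1, g2, g3⟩ := hg
  have hE : ∀ {x y t : ℝ}, 0 ≤ t → x ≤ C * t → x ≤ (max C D) * t := fun ht h =>
    h.trans (mul_le_mul_of_nonneg_right (le_max_left _ _) ht)
  have hE' : ∀ {x y t : ℝ}, 0 ≤ t → x ≤ D * t → x ≤ (max C D) * t := fun ht h =>
    h.trans (mul_le_mul_of_nonneg_right (le_max_right _ _) ht)
  set E := max C D with hEdef
  have hE0 : 0 ≤ E := hC.trans (le_max_left _ _)
  have s1 : ∀ z x : κ → ℝ, ∑ k, (f z * b z k + g z * a z k) * x k = f z * (∑ k, b z k * x k) + g z * ∑ k, a z k * x k := by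
    intro z x; simp only [Finset.mul_sum, ← Finset.sum_add_distrib]
    exact Finset.sum_congr rfl fun k _ => by ring
  have s2 : ∀ z x : κ → ℝ, ∑ k, ∑ l, (f z * r z k l + g z * q z k l + (a z k * b z l + b z k * a z l)) * (x k * x l)
      = f z * (∑ k, ∑ l, r z k l * (x k * x l)) + g z * (∑ k, ∑ l, q z k l * (x k * x l))
        + 2 * ((∑ k, a z k * x k) * (∑ k, b z k * x k)) := by
    intro z x
    have : 2 * ((∑ k, a z k * x k) * (∑ k, b z k * x k)) = (∑ k, a z k * x k) * (∑ k, b z k * x k) + (∑ k, b z k * x k) * (∑ k, a z k * x k) := by ring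
    rw [this, Finset.sum_mul_sum, Finset.sum_mul_sum]
    simp only [Finset.mul_sum, ← Finset.sum_add_distrib]
    exact Finset.sum_congr rfl fun k _ => Finset.sum_congr rfl fun l _ => by ring
  have f0' : ∀ z, |f z| ≤ E := fun z => (f0 z).trans (le_max_left _ _)
  have g0' : ∀ z, |g z| ≤ E := fun z => (g0 z).trans (le_max_right _ _)
  have f1' := fun z x => hE (y := 0) (norm_nonneg x) (f1 z x)
  have g1' := fun z x => hE' (y := 0) (norm_nonneg x) (g1 z x)
  have f2' := fun z x => hE (y := 0) (pow_nonneg (norm_nonneg x) 2) (f2 z x)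
  have g2' := fun z x => hE' (y := 0) (pow_nonneg (norm_nonneg x) 2) (g2 z x)
  have f3' := fun z x => hE (y := 0) (pow_nonneg (norm_nonneg x) 3) (f3 z x)
  have g3' := fun z x => hE' (y := 0) (pow_nonneg (norm_nonneg x) 3) (g3 z x)
  refine ⟨7 * E ^ 2, by positivity, fun z => ?_, fun z x => ?_, fun z x => ?_, fun z x => ?_⟩
  · rw [abs_mul]; nlinarith [mul_le_mul (f0' z) (g0' z) (abs_nonneg _) hE0]
  · rw [s1]
    refine (abs_add_le _ _).trans ?_
    rw [abs_mul, abs_mul]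
    have := mul_le_mul (f0' z) (g1' z x) (abs_nonneg _) hE0
    have := mul_le_mul (g0' z) (f1' z x) (abs_nonneg _) hE0
    have : 0 ≤ E ^ 2 * ‖x‖ := by positivity
    nlinarith
  · rw [s2]
    refine (abs_add_le _ _).trans ?_
    refine (add_le_add_left (abs_add_le _ _) _).trans ?_
    rw [abs_mul, abs_mul, abs_mul, abs_mul, abs_two]
    have := mul_le_mul (f0' z) (g2' z x) (abs_nonneg _) hE0
    have := mul_le_mul (g0' z) (f2' z x) (abs_nonneg _) hE0
    have := mul_le_mul (f1' z x) (g1' z x) (abs_nonneg _) (by positivity)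
    have : 0 ≤ E ^ 2 * ‖x‖ ^ 2 := by positivity
    nlinarith
  · rw [s1, s2]
    exact T3_scalar hE0 (norm_nonneg x) (f0' _) (g0' _) (g0' _) (f1' z x) (g1' z x) (f2' z x) (g2' z x) (f3' z x) (g3' z x)

lemma T3.const_sub {f : (κ → ℝ) → ℝ} {a q} (hf : T3 f a q) (c : ℝ) :
    T3 (fun z => c - f z) (fun z k => - a z k) (fun z k l => - q z k l) := by
  obtain ⟨C, hC, f0, f1, f2, f3⟩ := hf
  refine ⟨|c| + C, by positivity, fun z => ?_, fun z x => ?_, fun z x => ?_, fun z x => ?_⟩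
  · exact (abs_sub _ _).trans (by linarith [f0 z])
  · simp only [neg_mul, Finset.sum_neg_distrib, abs_neg]
    nlinarith [f1 z x, mul_nonneg (abs_nonneg c) (norm_nonneg x)]
  · simp only [neg_mul, Finset.sum_neg_distrib, abs_neg]
    nlinarith [f2 z x, mul_nonneg (abs_nonneg c) (pow_nonneg (norm_nonneg x) 2)]
  · simp only [neg_mul, Finset.sum_neg_distrib]
    rw [← abs_neg]
    refine le_trans (le_of_eq ?_) ((f3 z x).trans ?_)
    · congr 1; ring
    · nlinarith [mul_nonneg (abs_nonneg c) (pow_nonneg (norm_nonneg x) 3)]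

lemma T3.const (c : ℝ) : T3 (κ := κ) (fun _ => c) (fun _ _ => 0) (fun _ _ _ => 0) :=
  ⟨|c|, abs_nonneg c, fun _ => le_rfl, fun z x => by simp; positivity, fun z x => by simp; positivity, fun z x => by simp; positivity⟩

lemma taylor_step {g g' : ℝ → ℝ} {C : ℝ} (hC : 0 ≤ C) (n : ℕ) (h : ∀ y, HasDerivAt g (g' y) y) (h0 : g 0 = 0)
    (hb : ∀ y, |g' y| ≤ C * |y| ^ n) (y : ℝ) : |g y| ≤ C * |y| ^ (n + 1) := by
  have := Convex.norm_image_sub_le_of_norm_hasDerivWithin_le (f := g) (f' := g') (C := C * |y| ^ n) (s := Metric.closedBall 0 |y|)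
    (x := 0) (y := y) (fun x _ => (h x).hasDerivWithinAt) (fun x hx => by
      rw [Real.norm_eq_abs]
      refine (hb x).trans (mul_le_mul_of_nonneg_left (pow_le_pow_left₀ (abs_nonneg _) ?_ _) hC)
      simpa using hx) (convex_closedBall _ _) (by simp) (by simp)
  rw [h0] at this
  simp only [sub_zero, Real.norm_eq_abs] at this
  rw [pow_succ, ← mul_assoc]; exact this

end T3sec
end

section
open MeasureTheory ProbabilityTheory Filter Topology
open scoped BoundedContinuousFunction

section Gordon

lemma sig_taylor (b s : ℝ) (hs : 0 ≤ s) : ∃ C, 0 ≤ C ∧ ∀ t y : ℝ,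
    |Real.sigmoid (b - s * (t + y)) - Real.sigmoid (b - s * t)
      - (-(s * (Real.sigmoid (b - s * t) * (1 - Real.sigmoid (b - s * t))))) * y
      - (s ^ 2 * (Real.sigmoid (b - s * t) * (1 - Real.sigmoid (b - s * t)) * (1 - 2 * Real.sigmoid (b - s * t)))) * y ^ 2 / 2|
      ≤ C * |y| ^ 3 := by
  refine ⟨s ^ 3 * 10, by positivity, fun t y => ?_⟩
  set S : ℝ → ℝ := fun y => Real.sigmoid (b - s * (t + y)) with hS
  have hS01 : ∀ y, 0 ≤ S y ∧ S y ≤ 1 := fun y => ⟨Real.sigmoid_nonneg _, Real.sigmoid_le_one _⟩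
  have d0 : ∀ y, HasDerivAt S (-(s * (S y * (1 - S y)))) y := fun y => by
    have h1 : HasDerivAt (fun y => b - s * (t + y)) (-s) y := by
      have := (((hasDerivAt_id y).const_add t).const_mul s).const_sub b
      simpa using this
    have := (Real.hasDerivAt_sigmoid (b - s * (t + y))).comp y h1
    refine this.congr_deriv ?_
    simp only [hS]; ring
  have e0 : Real.sigmoid (b - s * t) = S 0 := by simp [hS]
  rw [e0]
  change |S y - S 0 - _ - _| ≤ _
  have d1 : ∀ y, HasDerivAt (fun y => -(s * (S y * (1 - S y)))) (s ^ 2 * (S y * (1 - S y) * (1 - 2 * S y))) y := fun y => by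
    have := (((d0 y).mul ((d0 y).const_sub 1)).const_mul s).neg
    refine this.congr_deriv ?_
    ring
  have d2 : ∀ y, HasDerivAt (fun y => s ^ 2 * (S y * (1 - S y) * (1 - 2 * S y)))
      (s ^ 2 * ((-(s * (S y * (1 - S y)))) * (1 - S y) * (1 - 2 * S y) + S y * (s * (S y * (1 - S y))) * (1 - 2 * S y)
        + S y * (1 - S y) * (2 * (s * (S y * (1 - S y)))))) y := fun y => by
    have := (((d0 y).mul ((d0 y).const_sub 1)).mul (((d0 y).const_mul 2).const_sub 1)).const_mul (s ^ 2)
    refine this.congr_deriv ?_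
    simp only [Pi.mul_apply]; ring
  have b3 : ∀ y, |s ^ 2 * ((-(s * (S y * (1 - S y)))) * (1 - S y) * (1 - 2 * S y) + S y * (s * (S y * (1 - S y))) * (1 - 2 * S y)
        + S y * (1 - S y) * (2 * (s * (S y * (1 - S y)))))| ≤ (s ^ 3 * 10) * |y| ^ 0 := fun y => by
    obtain ⟨h0, h1⟩ := hS01 y
    have : s ^ 2 * ((-(s * (S y * (1 - S y)))) * (1 - S y) * (1 - 2 * S y) + S y * (s * (S y * (1 - S y))) * (1 - 2 * S y)
        + S y * (1 - S y) * (2 * (s * (S y * (1 - S y))))) = s ^ 3 * ((S y * (1 - S y)) * (6 * (S y * (1 - S y)) - 1)) := by ring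
    rw [this, abs_mul, abs_of_nonneg (by positivity), pow_zero, mul_one]
    refine mul_le_mul_of_nonneg_left ?_ (by positivity)
    have hp : 0 ≤ S y * (1 - S y) := mul_nonneg h0 (by linarith)
    have hp1 : S y * (1 - S y) ≤ 1 := by nlinarith
    generalize S y * (1 - S y) = p at hp hp1
    rw [abs_le]; constructor <;> nlinarith
  set A2 := s ^ 2 * (S 0 * (1 - S 0) * (1 - 2 * S 0)) with hA2
  set A1 := -(s * (S 0 * (1 - S 0))) with hA1
  have hC : (0:ℝ) ≤ s ^ 3 * 10 := by positivity
  have t2 := taylor_step hC 0 (fun y => (d2 y).sub_const A2) (by simp [hA2]) b3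
  have t1 := taylor_step (g := fun y => -(s * (S y * (1 - S y))) - A1 - A2 * y) hC 1 (fun y => by
    have := ((d1 y).sub_const A1).sub ((hasDerivAt_id y).const_mul A2)
    refine this.congr_deriv ?_
    simp) (by simp [hA1]) t2
  have t0 := taylor_step (g := fun y => S y - S 0 - A1 * y - A2 * y ^ 2 / 2) hC 2 (fun y => by
    have := (((d0 y).sub_const (S 0)).sub ((hasDerivAt_id y).const_mul A1)).sub ((((hasDerivAt_id y).pow 2).const_mul A2).div_const 2)
    refine this.congr_deriv ?_
    simp; ring) (by simp) t1 y
  exact t0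


lemma T3_coord {κ : Type*} [Fintype κ] [DecidableEq κ] (k0 : κ) (b s : ℝ) (hs : 0 ≤ s) :
    T3 (κ := κ) (fun z => Real.sigmoid (b - s * z k0))
      (fun z k => if k = k0 then (-(s * (Real.sigmoid (b - s * z k0) * (1 - Real.sigmoid (b - s * z k0))))) else 0)
      (fun z k l => if k = k0 then if l = k0 then
        (s ^ 2 * (Real.sigmoid (b - s * z k0) * (1 - Real.sigmoid (b - s * z k0)) * (1 - 2 * Real.sigmoid (b - s * z k0)))) else 0 else 0) := by
  obtain ⟨C, hC, h⟩ := sig_taylor b s hs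
  have hS01 : ∀ y, 0 ≤ Real.sigmoid y ∧ Real.sigmoid y ≤ 1 := fun y => ⟨Real.sigmoid_nonneg _, Real.sigmoid_le_one _⟩
  have key : ∀ y, |(-(s * (Real.sigmoid y * (1 - Real.sigmoid y))))| ≤ s ∧
      |s ^ 2 * (Real.sigmoid y * (1 - Real.sigmoid y) * (1 - 2 * Real.sigmoid y))| ≤ s ^ 2 := by
    intro y
    obtain ⟨h0, h1⟩ := hS01 y
    generalize Real.sigmoid y = S at h0 h1
    have hp : 0 ≤ S * (1 - S) := mul_nonneg h0 (by linarith)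
    have hp1 : S * (1 - S) ≤ 1 := by nlinarith
    generalize S * (1 - S) = p at hp hp1
    constructor
    · rw [abs_neg, abs_mul, abs_of_nonneg hs, abs_of_nonneg hp]; nlinarith
    · rw [abs_mul, abs_of_nonneg (sq_nonneg s)]
      have : |p * (1 - 2 * S)| ≤ 1 := by rw [abs_le]; constructor <;> nlinarith
      nlinarith [sq_nonneg s]
  have hx : ∀ x : κ → ℝ, |x k0| ≤ ‖x‖ := fun x => norm_le_pi_norm x k0
  refine ⟨1 + s + s ^ 2 + C, by positivity, fun z => ?_, fun z x => ?_, fun z x => ?_, fun z x => ?_⟩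
  · rw [abs_of_nonneg (hS01 _).1]; nlinarith [(hS01 (b - s * z k0)).2]
  · simp only [ite_mul, zero_mul, Finset.sum_ite_eq', Finset.mem_univ, if_true]
    rw [abs_mul]
    refine (mul_le_mul (key _).1 (hx x) (abs_nonneg _) hs).trans ?_
    refine mul_le_mul_of_nonneg_right (by nlinarith) (norm_nonneg _)
  · simp only [ite_mul, zero_mul, Finset.sum_ite_eq', Finset.mem_univ, if_true, Finset.sum_ite_irrel, Finset.sum_const_zero]
    rw [abs_mul, abs_mul (x k0)]
    refine (mul_le_mul (key _).2 (mul_le_mul (hx x) (hx x) (abs_nonneg _) (norm_nonneg _)) (by positivity) (by positivity)).trans ?_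
    rw [← pow_two]
    refine mul_le_mul_of_nonneg_right (by nlinarith) (by positivity)
  · simp only [ite_mul, zero_mul, Finset.sum_ite_eq', Finset.mem_univ, if_true, Finset.sum_ite_irrel, Finset.sum_const_zero, Pi.add_apply]
    rw [← pow_two]
    refine (h (z k0) (x k0)).trans ?_
    refine mul_le_mul (by nlinarith) (pow_le_pow_left₀ (abs_nonneg _) (hx x) 3) (by positivity) (by positivity)

variable {I J : Type*} [Fintype I] [Fintype J] [DecidableEq I] [DecidableEq J]

def RowP (i : I) (f : (I × J → ℝ) → ℝ) : Prop := Continuous f ∧ ∃ a q, T3 f a q ∧ (∀ z, 0 ≤ f z ∧ f z ≤ 1) ∧ (∀ z k, a z k ≤ 0) ∧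
  (∀ z k, k.1 ≠ i → a z k = 0) ∧ (∀ z k l, k.1 ≠ l.1 → q z k l = 0)

def PosP (f : (I × J → ℝ) → ℝ) : Prop := Continuous f ∧ ∃ a q, T3 f a q ∧ (∀ z, 0 ≤ f z ∧ f z ≤ 1) ∧ (∀ z k, 0 ≤ a z k) ∧
  (∀ z k l, k.1 ≠ l.1 → 0 ≤ q z k l)

lemma RowP.mul {i : I} {f g : (I × J → ℝ) → ℝ} (hf : RowP i f) (hg : RowP i g) : RowP i (fun z => f z * g z) := by
  obtain ⟨cf, a, q, h, hp, ha, ha0, hq⟩ := hf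
  obtain ⟨cg, b, r, h', hp', hb, hb0, hr⟩ := hg
  refine ⟨cf.mul cg, _, _, h.mul h', fun z => ⟨mul_nonneg (hp z).1 (hp' z).1, mul_le_one₀ (hp z).2 (hp' z).1 (hp' z).2⟩, fun z k => ?_, fun z k hk => ?_, fun z k l hkl => ?_⟩
  · nlinarith [mul_nonneg (hp z).1 (neg_nonneg.2 (hb z k)), mul_nonneg (hp' z).1 (neg_nonneg.2 (ha z k))]
  · simp [ha0 z k hk, hb0 z k hk]
  · simp only [hq z k l hkl, hr z k l hkl]
    by_cases hk : k.1 = i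
    · have hl : l.1 ≠ i := fun h => hkl (hk.trans h.symm)
      simp [ha0 z l hl, hb0 z l hl]
    · simp [ha0 z k hk, hb0 z k hk]

lemma RowP_one (i : I) : RowP (J := J) i (fun _ => 1) :=
  ⟨continuous_const, _, _, T3.const 1, fun _ => ⟨zero_le_one, le_rfl⟩, fun _ _ => le_rfl, fun _ _ _ => rfl, fun _ _ _ _ => rfl⟩

lemma RowP_coord (i : I) (j : J) (b s : ℝ) (hs : 0 ≤ s) : RowP (J := J) i (fun z => Real.sigmoid (b - s * z (i, j))) := by
  refine ⟨by have := continuous_sigmoid; fun_prop, _, _, T3_coord (i, j) b s hs, fun _ => ⟨Real.sigmoid_nonneg _, Real.sigmoid_le_one _⟩, fun z k => ?_, fun z k hk => ?_, fun z k l hkl => ?_⟩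
  · split_ifs
    · rw [neg_nonpos]
      exact mul_nonneg hs (mul_nonneg (Real.sigmoid_nonneg _) (by linarith [Real.sigmoid_le_one (b - s * z (i, j))]))
    · exact le_rfl
  · rw [if_neg]; rintro rfl; exact hk rfl
  · split_ifs with h1 h2
    · exact absurd (by rw [h1, h2]) hkl
    · rfl
    · rfl

lemma RowP_prod (i : I) (b : J → ℝ) (s : ℝ) (hs : 0 ≤ s) (T : Finset J) :
    RowP (J := J) i (fun z => ∏ j ∈ T, Real.sigmoid (b j - s * z (i, j))) := by
  induction T using Finset.induction_on with
  | empty => simpa using RowP_one i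
  | insert j T hj ih =>
    simp only [Finset.prod_insert hj]
    exact (RowP_coord i j (b j) s hs).mul ih

lemma PosP.mul {f g : (I × J → ℝ) → ℝ} (hf : PosP f) (hg : PosP g) : PosP (fun z => f z * g z) := by
  obtain ⟨cf, a, q, h, hp, ha, hq⟩ := hf
  obtain ⟨cg, b, r, h', hp', hb, hr⟩ := hg
  refine ⟨cf.mul cg, _, _, h.mul h', fun z => ⟨mul_nonneg (hp z).1 (hp' z).1, mul_le_one₀ (hp z).2 (hp' z).1 (hp' z).2⟩, fun z k => ?_, fun z k l hkl => ?_⟩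
  · exact add_nonneg (mul_nonneg (hp z).1 (hb z k)) (mul_nonneg (hp' z).1 (ha z k))
  · exact add_nonneg (add_nonneg (mul_nonneg (hp z).1 (hr z k l hkl)) (mul_nonneg (hp' z).1 (hq z k l hkl)))
      (add_nonneg (mul_nonneg (ha z k) (hb z l)) (mul_nonneg (hb z k) (ha z l)))

lemma RowP.pos {i : I} {f : (I × J → ℝ) → ℝ} (hf : RowP i f) : PosP (fun z => 1 - f z) := by
  obtain ⟨cf, a, q, h, hp, ha, ha0, hq⟩ := hf
  refine ⟨continuous_const.sub cf, _, _, h.const_sub 1, fun z => ⟨by linarith [(hp z).2], by linarith [(hp z).1]⟩, fun z k => ?_, fun z k l hkl => ?_⟩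
  · simpa using ha z k
  · simp [hq z k l hkl]

lemma PosP_gordon (b : I → J → ℝ) (s : ℝ) (hs : 0 ≤ s) (T : Finset I) :
    PosP (fun z : I × J → ℝ => ∏ i ∈ T, (1 - ∏ j, Real.sigmoid (b i j - s * z (i, j)))) := by
  induction T using Finset.induction_on with
  | empty =>
    refine ⟨by simpa using continuous_const, fun _ _ => 0, fun _ _ _ => 0, by simpa using T3.const 1, fun _ => by simp, fun _ _ => le_rfl, fun _ _ _ _ => le_rfl⟩
  | insert i T hi ih =>
    simp only [Finset.prod_insert hi]
    exact (RowP_prod i (b i) s hs Finset.univ).pos.mul ih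

lemma PosP.compare {f : (I × J → ℝ) → ℝ} (hf : PosP f) {μ ν : Measure (I × J → ℝ)} [IsGaussian μ] [IsGaussian ν]
    (hμ : ∫ x, x ∂μ = 0) (hν : ∫ x, x ∂ν = 0)
    (h1 : ∀ i j j', ∫ x, x (i, j) * x (i, j') ∂ν = ∫ x, x (i, j) * x (i, j') ∂μ)
    (h2 : ∀ i i' j j', i ≠ i' → ∫ x, x (i, j) * x (i', j') ∂ν ≤ ∫ x, x (i, j) * x (i', j') ∂μ) :
    ∫ x, f x ∂ν ≤ ∫ x, f x ∂μ := by
  obtain ⟨cf, a, q, ⟨C, hC, -, -, -, hT⟩, hp, ha, hq⟩ := hf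
  let F : (I × J → ℝ) →ᵇ ℝ := BoundedContinuousFunction.ofNormedAddCommGroup f cf 1 (fun z => by
    rw [Real.norm_eq_abs, abs_of_nonneg (hp z).1]; exact (hp z).2)
  refine lindeberg hμ hν F (fun z => ∑ k, a z k • ContinuousLinearMap.proj (R := ℝ) (φ := fun _ : I × J => ℝ) k) q C (fun z x => ?_) (fun z => ?_)
  · have := hT z x
    simpa [F, ContinuousLinearMap.sum_apply] using this
  · refine Finset.sum_le_sum fun k _ => Finset.sum_le_sum fun l _ => ?_
    by_cases h : k.1 = l.1
    · obtain ⟨i, j⟩ := k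
      obtain ⟨i', j'⟩ := l
      simp only at h; subst h
      rw [h1]
    · exact mul_le_mul_of_nonneg_left (h2 k.1 l.1 k.2 l.2 h) (hq z k l h)

theorem gordon_finite {μ ν : Measure (I × J → ℝ)} [IsGaussian μ] [IsGaussian ν]
    (hμ : ∫ x, x ∂μ = 0) (hν : ∫ x, x ∂ν = 0)
    (h1 : ∀ i j j', ∫ x, x (i, j) * x (i, j') ∂ν = ∫ x, x (i, j) * x (i, j') ∂μ)
    (h2 : ∀ i i' j j', i ≠ i' → ∫ x, x (i, j) * x (i', j') ∂ν ≤ ∫ x, x (i, j) * x (i', j') ∂μ) (c : I → J → ℝ) :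
    ν.real {x | ∀ i, ∃ j, c i j < x (i, j)} ≤ μ.real {x | ∀ i, ∃ j, c i j < x (i, j)} := by
  classical
  set E : Set (I × J → ℝ) := {x | ∀ i, ∃ j, c i j < x (i, j)} with hE
  have hEm : MeasurableSet E := by
    have : E = ⋂ i, ⋃ j, {x | c i j < x (i, j)} := by ext x; simp [hE]
    rw [this]
    exact MeasurableSet.iInter fun i => MeasurableSet.iUnion fun j => measurableSet_lt measurable_const (measurable_pi_apply _)
  let f : ℕ → (I × J → ℝ) → ℝ := fun n z => ∏ i, (1 - ∏ j, Real.sigmoid ((√n + n * c i j) - n * z (i, j)))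
  have hP : ∀ n, PosP (f n) := fun n => PosP_gordon (fun i j => √n + n * c i j) n (Nat.cast_nonneg n) Finset.univ
  have hsig : ∀ t : ℝ, Tendsto (fun n : ℕ => Real.sigmoid (√n + n * t)) atTop (𝓝 (if t < 0 then 0 else 1)) := by
    intro t
    have hsq : Tendsto (fun n : ℕ => √(n:ℝ)) atTop atTop := Real.tendsto_sqrt_atTop.comp tendsto_natCast_atTop_atTop
    split_ifs with ht
    · refine Real.tendsto_sigmoid_atBot.comp ?_
      have e : (fun n : ℕ => √(n:ℝ) + n * t) = fun n : ℕ => √(n:ℝ) * (1 + √(n:ℝ) * t) := by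
        funext n
        have := Real.mul_self_sqrt (Nat.cast_nonneg (α := ℝ) n)
        nlinarith
      rw [e]
      exact hsq.atTop_mul_atBot₀ (tendsto_atBot_add_const_left _ _ (hsq.atTop_mul_const_of_neg ht))
    · refine Real.tendsto_sigmoid_atTop.comp ?_
      refine tendsto_atTop_mono (fun n => ?_) hsq
      have : 0 ≤ (n:ℝ) * t := mul_nonneg (Nat.cast_nonneg _) (not_lt.1 ht)
      linarith
  have hlim : ∀ z, Tendsto (fun n => f n z) atTop (𝓝 (E.indicator (fun _ => 1) z)) := by
    intro z
    have : Tendsto (fun n => f n z) atTop (𝓝 (∏ i, (1 - ∏ j, (if c i j - z (i, j) < 0 then (0:ℝ) else 1)))) := by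
      refine tendsto_finset_prod _ fun i _ => tendsto_const_nhds.sub (tendsto_finset_prod _ fun j _ => ?_)
      have := hsig (c i j - z (i, j))
      refine this.congr fun n => ?_
      congr 1; ring
    convert this using 2
    by_cases hz : z ∈ E
    · rw [Set.indicator_of_mem hz]
      symm
      refine Finset.prod_eq_one fun i _ => ?_
      obtain ⟨j, hj⟩ := hz i
      rw [Finset.prod_eq_zero (Finset.mem_univ j), sub_zero]
      rw [if_pos]; linarith
    · rw [Set.indicator_of_notMem hz]
      symm
      simp only [hE, Set.mem_ofPred_eq] at hz
      push Not at hz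
      obtain ⟨i, hi⟩ := hz
      refine Finset.prod_eq_zero (Finset.mem_univ i) ?_
      rw [Finset.prod_eq_one, sub_self]
      intro j _
      rw [if_neg]; linarith [hi j]
  have hint : ∀ (ρ : Measure (I × J → ℝ)) [IsProbabilityMeasure ρ], Tendsto (fun n => ∫ x, f n x ∂ρ) atTop (𝓝 (ρ.real E)) := by
    intro ρ _
    have : ρ.real E = ∫ x, E.indicator (fun _ => 1) x ∂ρ := by
      rw [integral_indicator hEm]; simp
    rw [this]
    refine tendsto_integral_of_dominated_convergence (fun _ => 1) (fun n => (hP n).1.aestronglyMeasurable) (integrable_const _)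
      (fun n => ae_of_all _ fun x => ?_) (ae_of_all _ hlim)
    obtain ⟨_, _, _, _, hp, _⟩ := hP n
    rw [Real.norm_eq_abs, abs_of_nonneg (hp x).1]; exact (hp x).2
  exact le_of_tendsto_of_tendsto' (hint ν) (hint μ) fun n => (hP n).compare hμ hν h1 h2

end Gordon
end

section
open MeasureTheory ProbabilityTheory Filter Topology

def CL2 {Ω : Type*} [MeasurableSpace Ω] (μ : Measure Ω) (f : Ω → ℝ) : Prop := MemLp f 2 μ ∧ ∫ x, f x ∂μ = 0

section cl2
variable {Ω Ω' : Type*} [MeasurableSpace Ω] [MeasurableSpace Ω'] {μ : Measure Ω} {ν : Measure Ω'}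

lemma CL2.const_mul {f : Ω → ℝ} (hf : CL2 μ f) (c : ℝ) : CL2 μ (fun x => c * f x) :=
  ⟨hf.1.const_mul c, by rw [integral_const_mul, hf.2, mul_zero]⟩

lemma CL2_gauss (v : NNReal) (c : ℝ) : CL2 (gaussianReal 0 v) (fun x => c * x) :=
  CL2.const_mul ⟨memLp_id_gaussianReal' 2 (by norm_num), integral_id_gaussianReal⟩ c

lemma gauss_cov (v : NNReal) (c d : ℝ) : ∫ x, (c * x) * (d * x) ∂(gaussianReal 0 v) = c * d * v := by
  have h := variance_of_integral_eq_zero (X := fun x : ℝ => x) (μ := gaussianReal 0 v) aemeasurable_id integral_id_gaussianReal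
  rw [variance_fun_id_gaussianReal] at h
  rw [h, ← integral_const_mul]
  refine integral_congr_ae (ae_of_all _ fun x => ?_)
  simp; ring

lemma CL2.prod [IsProbabilityMeasure μ] [IsProbabilityMeasure ν] {f : Ω → ℝ} {g : Ω' → ℝ} (hf : CL2 μ f) (hg : CL2 ν g) :
    CL2 (μ.prod ν) (fun p => f p.1 + g p.2) := by
  refine ⟨(hf.1.comp_fst ν).add (hg.1.comp_snd μ), ?_⟩
  rw [integral_add ((hf.1.comp_fst ν).integrable (by norm_num)) ((hg.1.comp_snd μ).integrable (by norm_num)),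
    integral_fun_fst, integral_fun_snd, hf.2, hg.2]; simp

lemma prod_cov [IsProbabilityMeasure μ] [IsProbabilityMeasure ν] {f f' : Ω → ℝ} {g g' : Ω' → ℝ} (hf : CL2 μ f) (hg : CL2 ν g)
    (hf' : CL2 μ f') (hg' : CL2 ν g') :
    ∫ p, (f p.1 + g p.2) * (f' p.1 + g' p.2) ∂(μ.prod ν) = (∫ x, f x * f' x ∂μ) + ∫ y, g y * g' y ∂ν := by
  have i1 : Integrable (fun p : Ω × Ω' => f p.1 * f' p.1) (μ.prod ν) := (hf.1.comp_fst ν).integrable_mul (hf'.1.comp_fst ν)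
  have i2 : Integrable (fun p : Ω × Ω' => f p.1 * g' p.2) (μ.prod ν) := (hf.1.comp_fst ν).integrable_mul (hg'.1.comp_snd μ)
  have i3 : Integrable (fun p : Ω × Ω' => g p.2 * f' p.1) (μ.prod ν) := (hg.1.comp_snd μ).integrable_mul (hf'.1.comp_fst ν)
  have i4 : Integrable (fun p : Ω × Ω' => g p.2 * g' p.2) (μ.prod ν) := (hg.1.comp_snd μ).integrable_mul (hg'.1.comp_snd μ)
  have e : ∀ p : Ω × Ω', (f p.1 + g p.2) * (f' p.1 + g' p.2) = (f p.1 * f' p.1 + f p.1 * g' p.2) + (g p.2 * f' p.1 + g p.2 * g' p.2) := fun p => by ring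
  simp_rw [e]
  refine (integral_add (i1.add i2) (i3.add i4)).trans ?_
  simp only [Pi.add_apply]
  rw [integral_add i1 i2, integral_add i3 i4]
  rw [integral_prod_mul f g', hf.2]
  have : ∫ p : Ω × Ω', g p.2 * f' p.1 ∂(μ.prod ν) = 0 := by
    simp_rw [mul_comm (g _)]; rw [integral_prod_mul f' g, hf'.2, zero_mul]
  rw [this, integral_fun_fst (fun x => f x * f' x), integral_fun_snd (fun x => g x * g' x)]; simp
end cl2

section pi
variable {ι : Type*} [Fintype ι] {Ω : ι → Type*} [∀ i, MeasurableSpace (Ω i)] {μ : ∀ i, Measure (Ω i)} [∀ i, IsProbabilityMeasure (μ i)]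

lemma CL2.pi_sum {f : ∀ i, Ω i → ℝ} (hf : ∀ i, CL2 (μ i) (f i)) : CL2 (Measure.pi μ) (fun x => ∑ i, f i (x i)) := by
  have h : ∀ i, MemLp (fun x : ∀ i, Ω i => f i (x i)) 2 (Measure.pi μ) := fun i => (hf i).1.comp_measurePreserving (measurePreserving_eval μ i)
  refine ⟨memLp_finsetSum _ fun i _ => h i, ?_⟩
  rw [integral_finsetSum _ fun i _ => (h i).integrable (by norm_num)]
  refine Finset.sum_eq_zero fun i _ => ?_
  rw [integral_comp_eval (μ := μ) (hf i).1.1, (hf i).2]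

lemma pi_cov {f g : ∀ i, Ω i → ℝ} (hf : ∀ i, CL2 (μ i) (f i)) (hg : ∀ i, CL2 (μ i) (g i)) :
    ∫ x, (∑ i, f i (x i)) * (∑ i, g i (x i)) ∂(Measure.pi μ) = ∑ i, ∫ x, f i x * g i x ∂(μ i) := by
  classical
  have h : ∀ i, MemLp (fun x : ∀ i, Ω i => f i (x i)) 2 (Measure.pi μ) := fun i => (hf i).1.comp_measurePreserving (measurePreserving_eval μ i)
  have h' : ∀ i, MemLp (fun x : ∀ i, Ω i => g i (x i)) 2 (Measure.pi μ) := fun i => (hg i).1.comp_measurePreserving (measurePreserving_eval μ i)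
  have hh : ∀ i j, Integrable (fun x : ∀ i, Ω i => f i (x i) * g j (x j)) (Measure.pi μ) := fun i j => (h i).integrable_mul (h' j)
  simp_rw [Finset.sum_mul_sum]
  rw [integral_finsetSum _ fun i _ => integrable_finsetSum _ fun j _ => hh i j]
  refine Finset.sum_congr rfl fun i _ => ?_
  rw [integral_finsetSum _ fun j _ => hh i j]
  rw [Finset.sum_eq_single i]
  · exact integral_comp_eval (μ := μ) (f := fun x => f i x * g i x) ((hf i).1.1.mul (hg i).1.1)
  · intro j _ hj
    have ind := (iIndepFun_pi (μ := μ) (X := fun _ => id) (fun _ => aemeasurable_id)).indepFun (Ne.symm hj)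
    have := ind.integral_fun_comp_mul_comp (f := f i) (g := g j) (measurable_pi_apply i).aemeasurable (measurable_pi_apply j).aemeasurable
      (by simpa [(measurePreserving_eval μ i).map_eq] using (hf i).1.1) (by simpa [(measurePreserving_eval μ j).map_eq] using (hg j).1.1)
    refine this.trans ?_
    have e : ∫ x, f i (id (x i)) ∂(Measure.pi μ) = 0 := by
      exact (integral_comp_eval (μ := μ) (hf i).1.1).trans (hf i).2
    rw [e, zero_mul]
  · simp
end pi

lemma CL2_vec (d : ℕ) (v : NNReal) (c : Fin d → ℝ) : CL2 (Measure.pi fun _ : Fin d => gaussianReal 0 v) (fun x => ∑ i, c i * x i) :=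
  CL2.pi_sum (f := fun i x => c i * x) fun i => CL2_gauss v (c i)

lemma vec_cov (d : ℕ) (v : NNReal) (c b : Fin d → ℝ) :
    ∫ x, (∑ i, c i * x i) * (∑ i, b i * x i) ∂(Measure.pi fun _ : Fin d => gaussianReal 0 v) = (∑ i, c i * b i) * v := by
  rw [pi_cov (f := fun i x => c i * x) (g := fun i x => b i * x) (fun i => CL2_gauss v (c i)) (fun i => CL2_gauss v (b i)), Finset.sum_mul]
  exact Finset.sum_congr rfl fun i _ => gauss_cov _ _ _

lemma CL2_mat (m n : ℕ) (c : Fin m → Fin n → ℝ) :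
    CL2 (Measure.pi fun _ : Fin m => Measure.pi fun _ : Fin n => gaussianReal 0 1) (fun x => ∑ i, ∑ j, c i j * x i j) :=
  CL2.pi_sum (Ω := fun _ : Fin m => Fin n → ℝ) (μ := fun _ => Measure.pi fun _ : Fin n => gaussianReal 0 1) (f := fun i x => ∑ j, c i j * x j) fun i => CL2_vec n 1 (c i)

lemma mat_cov (m n : ℕ) (c b : Fin m → Fin n → ℝ) :
    ∫ x, (∑ i, ∑ j, c i j * x i j) * (∑ i, ∑ j, b i j * x i j) ∂(Measure.pi fun _ : Fin m => Measure.pi fun _ : Fin n => gaussianReal 0 1)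
      = ∑ i, ∑ j, c i j * b i j := by
  rw [pi_cov (Ω := fun _ : Fin m => Fin n → ℝ) (μ := fun _ => Measure.pi fun _ : Fin n => gaussianReal 0 1) (f := fun i x => ∑ j, c i j * x j) (g := fun i x => ∑ j, b i j * x j) (fun i => CL2_vec n 1 (c i)) (fun i => CL2_vec n 1 (b i))]
  refine Finset.sum_congr rfl fun i _ => ?_
  rw [vec_cov]; simp

/-- processes -/
noncomputable def nrm (σ : ℝ) {n : ℕ} (w : Fin n → ℝ) : ℝ := √(e2norm w ^ 2 + σ ^ 2)

noncomputable def muX (m n : ℕ) (σ : ℝ) := (muAv m n σ).prod (gaussianReal 0 1)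
noncomputable def muY (m n : ℕ) := (muGH m n).prod (gaussianReal 0 1)

noncomputable def XP {m n : ℕ} (σ : ℝ) (w : Fin n → ℝ) (u : Fin m → ℝ) (p : ((Fin m → Fin n → ℝ) × (Fin m → ℝ)) × ℝ) : ℝ :=
  ((∑ i, ∑ j, (-(u i * w j)) * p.1.1 i j) + ∑ i, u i * p.1.2 i) + nrm σ w * p.2

noncomputable def YP {m n : ℕ} (σ : ℝ) (w : Fin n → ℝ) (u : Fin m → ℝ) (p : ((Fin m → ℝ) × (Fin n → ℝ)) × ℝ) : ℝ :=
  ((∑ i, (nrm σ w * u i) * p.1.1 i) + ∑ j, w j * p.1.2 j) + σ * p.2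

instance (m n : ℕ) (σ : ℝ) : IsProbabilityMeasure (muAv m n σ) := by unfold muAv; infer_instance
instance (m n : ℕ) : IsProbabilityMeasure (muGH m n) := by unfold muGH; infer_instance
instance (m n : ℕ) (σ : ℝ) : IsProbabilityMeasure (muX m n σ) := by unfold muX; infer_instance
instance (m n : ℕ) : IsProbabilityMeasure (muY m n) := by unfold muY; infer_instance

instance (m n : ℕ) (σ : ℝ) : IsGaussian (muX m n σ) := by
  have h1 : IsGaussian (Measure.pi fun _ : Fin m => Measure.pi fun _ : Fin n => gaussianReal 0 1) := by
    have : IsGaussian (Measure.pi fun _ : Fin n => gaussianReal 0 1) := isGaussian_pi _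
    exact isGaussian_pi _
  have h2 : IsGaussian (Measure.pi fun _ : Fin m => gaussianReal 0 (σ ^ 2).toNNReal) := isGaussian_pi _
  unfold muX muAv; infer_instance
instance (m n : ℕ) : IsGaussian (muY m n) := by
  have h1 : IsGaussian (Measure.pi fun _ : Fin n => gaussianReal 0 1) := isGaussian_pi _
  have h2 : IsGaussian (Measure.pi fun _ : Fin m => gaussianReal 0 1) := isGaussian_pi _
  unfold muY muGH; infer_instance

lemma CL2_XP {m n : ℕ} (σ : ℝ) (w : Fin n → ℝ) (u : Fin m → ℝ) : CL2 (muX m n σ) (XP σ w u) :=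
  ((CL2_mat m n _).prod (CL2_vec m _ _)).prod (CL2_gauss 1 _)

lemma CL2_YP {m n : ℕ} (σ : ℝ) (w : Fin n → ℝ) (u : Fin m → ℝ) : CL2 (muY m n) (YP σ w u) :=
  ((CL2_vec m 1 _).prod (CL2_vec n 1 _)).prod (CL2_gauss 1 _)

lemma cov_XP {m n : ℕ} (σ : ℝ) (w w' : Fin n → ℝ) (u u' : Fin m → ℝ) :
    ∫ p, XP σ w u p * XP σ w' u' p ∂(muX m n σ) = (∑ i, u i * u' i) * (σ ^ 2 + ∑ j, w j * w' j) + nrm σ w * nrm σ w' := by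
  have e := prod_cov ((CL2_mat m n fun i j => -(u i * w j)).prod (CL2_vec m (σ ^ 2).toNNReal u)) (CL2_gauss 1 (nrm σ w))
    ((CL2_mat m n fun i j => -(u' i * w' j)).prod (CL2_vec m (σ ^ 2).toNNReal u')) (CL2_gauss 1 (nrm σ w'))
  refine e.trans ?_
  rw [prod_cov (CL2_mat m n fun i j => -(u i * w j)) (CL2_vec m (σ ^ 2).toNNReal u) (CL2_mat m n fun i j => -(u' i * w' j)) (CL2_vec m (σ ^ 2).toNNReal u'),
    mat_cov, vec_cov, gauss_cov]
  have : ∑ i, ∑ j, -(u i * w j) * -(u' i * w' j) = (∑ i, u i * u' i) * ∑ j, w j * w' j := by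
    rw [Finset.sum_mul_sum]
    exact Finset.sum_congr rfl fun i _ => Finset.sum_congr rfl fun j _ => by ring
  rw [this, Real.coe_toNNReal _ (sq_nonneg σ)]
  push_cast; ring

lemma cov_YP {m n : ℕ} (σ : ℝ) (w w' : Fin n → ℝ) (u u' : Fin m → ℝ) :
    ∫ p, YP σ w u p * YP σ w' u' p ∂(muY m n) = nrm σ w * nrm σ w' * (∑ i, u i * u' i) + (∑ j, w j * w' j) + σ ^ 2 := by
  have e := prod_cov ((CL2_vec m 1 fun i => nrm σ w * u i).prod (CL2_vec n 1 w)) (CL2_gauss 1 σ)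
    ((CL2_vec m 1 fun i => nrm σ w' * u' i).prod (CL2_vec n 1 w')) (CL2_gauss 1 σ)
  refine e.trans ?_
  rw [prod_cov (CL2_vec m 1 fun i => nrm σ w * u i) (CL2_vec n 1 w) (CL2_vec m 1 fun i => nrm σ w' * u' i) (CL2_vec n 1 w'),
    vec_cov, vec_cov, gauss_cov]
  have : ∑ i, (nrm σ w * u i) * (nrm σ w' * u' i) = nrm σ w * nrm σ w' * ∑ i, u i * u' i := by
    rw [Finset.mul_sum]; exact Finset.sum_congr rfl fun i _ => by ring
  rw [this]
  simp only [NNReal.coe_one, mul_one]; ring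

lemma nrm_mul_ge {n : ℕ} (σ : ℝ) (w w' : Fin n → ℝ) : σ ^ 2 + ∑ j, w j * w' j ≤ nrm σ w * nrm σ w' := by
  unfold nrm
  rw [← Real.sqrt_mul (by positivity)]
  refine Real.le_sqrt_of_sq_le ?_
  have h1 := abs_sum_mul_le_e2norm w w'
  have h2 := sq_le_sq' (abs_le.1 h1).1 (abs_le.1 h1).2
  have h3 := (abs_le.1 h1).2
  nlinarith [sq_nonneg (σ * (e2norm w - e2norm w')), mul_nonneg (sq_nonneg σ) (sub_nonneg.2 h3)]

lemma nrm_sq {n : ℕ} (σ : ℝ) (w : Fin n → ℝ) : nrm σ w * nrm σ w = e2norm w ^ 2 + σ ^ 2 :=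
  Real.mul_self_sqrt (by positivity)

lemma cov_le {m n : ℕ} (σ : ℝ) (w w' : Fin n → ℝ) (u u' : Fin m → ℝ) (hu : e2norm u = 1) (hu' : e2norm u' = 1) :
    ∫ p, YP σ w u p * YP σ w' u' p ∂(muY m n) ≤ ∫ p, XP σ w u p * XP σ w' u' p ∂(muX m n σ) := by
  rw [cov_XP, cov_YP]
  have h1 := sum_mul_le_e2norm u u'
  rw [hu, hu', mul_one] at h1
  nlinarith [nrm_mul_ge σ w w']

lemma cov_eq_w {m n : ℕ} (σ : ℝ) (w : Fin n → ℝ) (u u' : Fin m → ℝ) :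
    ∫ p, YP σ w u p * YP σ w u' p ∂(muY m n) = ∫ p, XP σ w u p * XP σ w u' p ∂(muX m n σ) := by
  rw [cov_XP, cov_YP, nrm_sq]
  have : ∑ j, w j * w j = e2norm w ^ 2 := by rw [e2norm_sq]; simp [pow_two]
  rw [this]; ring

lemma cov_eq_u {m n : ℕ} (σ : ℝ) (w w' : Fin n → ℝ) (u : Fin m → ℝ) (hu : e2norm u = 1) :
    ∫ p, YP σ w u p * YP σ w' u p ∂(muY m n) = ∫ p, XP σ w u p * XP σ w' u p ∂(muX m n σ) := by
  rw [cov_XP, cov_YP]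
  have : ∑ j, u j * u j = 1 := by
    have h : e2norm u ^ 2 = 1 := by rw [hu]; norm_num
    rw [e2norm_sq] at h; simpa [pow_two] using h
  rw [this]; ring
end

section
open MeasureTheory ProbabilityTheory Filter Topology

section
variable {E E' : Type*} [NormedAddCommGroup E] [NormedSpace ℝ E] [MeasurableSpace E] [BorelSpace E] [SecondCountableTopology E] [CompleteSpace E]
  [NormedAddCommGroup E'] [NormedSpace ℝ E'] [MeasurableSpace E'] [BorelSpace E'] [SecondCountableTopology E'] [CompleteSpace E']

lemma map_mean {κ : Type*} [Fintype κ] (P : Measure E) [IsGaussian P] (X : κ → (E →L[ℝ] ℝ)) (h : ∀ k, ∫ p, X k p ∂P = 0) :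
    ∫ x, x ∂(P.map (ContinuousLinearMap.pi X)) = 0 := by
  rw [integral_map (ContinuousLinearMap.pi X).continuous.measurable.aemeasurable (f := fun x : κ → ℝ => x) continuous_id.aestronglyMeasurable]
  have hid := IsGaussian.integrable_fun_id (μ := P)
  rw [ContinuousLinearMap.integral_comp_comm _ hid]
  ext k
  have := ContinuousLinearMap.integral_comp_comm (X k) hid
  rw [h k] at this
  simpa using this.symm

lemma map_cov {κ : Type*} [Fintype κ] (P : Measure E) [IsGaussian P] (X : κ → (E →L[ℝ] ℝ)) (k l : κ) :
    ∫ x, x k * x l ∂(P.map (ContinuousLinearMap.pi X)) = ∫ p, X k p * X l p ∂P := by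
  rw [integral_map (ContinuousLinearMap.pi X).continuous.measurable.aemeasurable]
  · rfl
  · exact (Continuous.aestronglyMeasurable (by fun_prop))

lemma gordon_clm {I J : Type*} [Fintype I] [Fintype J] [DecidableEq I] [DecidableEq J] (PX : Measure E) (PY : Measure E') [IsGaussian PX] [IsGaussian PY]
    (X : I → J → (E →L[ℝ] ℝ)) (Y : I → J → (E' →L[ℝ] ℝ)) (hX0 : ∀ i j, ∫ p, X i j p ∂PX = 0) (hY0 : ∀ i j, ∫ p, Y i j p ∂PY = 0)
    (h1 : ∀ i j j', ∫ p, Y i j p * Y i j' p ∂PY = ∫ p, X i j p * X i j' p ∂PX)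
    (h2 : ∀ i i' j j', ∫ p, Y i j p * Y i' j' p ∂PY ≤ ∫ p, X i j p * X i' j' p ∂PX) (c : ℝ) :
    PX {p | ∃ i, ∀ j, X i j p ≤ c} ≤ PY {p | ∃ i, ∀ j, Y i j p ≤ c} := by
  have g := gordon_finite (μ := PX.map (ContinuousLinearMap.pi fun k : I × J => X k.1 k.2)) (ν := PY.map (ContinuousLinearMap.pi fun k : I × J => Y k.1 k.2))
    (map_mean _ _ fun k => hX0 _ _) (map_mean _ _ fun k => hY0 _ _) (fun i j j' => by rw [map_cov, map_cov]; exact h1 _ _ _)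
    (fun i i' j j' _ => by rw [map_cov, map_cov]; exact h2 _ _ _ _) (fun _ _ => c)
  have hm : MeasurableSet {x : I × J → ℝ | ∀ i, ∃ j, c < x (i, j)} := by
    have : {x : I × J → ℝ | ∀ i, ∃ j, c < x (i, j)} = ⋂ i, ⋃ j, {x | c < x (i, j)} := by ext x; simp
    rw [this]
    exact MeasurableSet.iInter fun i => MeasurableSet.iUnion fun j => measurableSet_lt measurable_const (measurable_pi_apply _)
  rw [map_measureReal_apply (ContinuousLinearMap.continuous _).measurable hm, map_measureReal_apply (ContinuousLinearMap.continuous _).measurable hm] at g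
  have g' := (ENNReal.toReal_le_toReal (measure_ne_top _ _) (measure_ne_top _ _)).1 g
  have hm1 := (ContinuousLinearMap.continuous (ContinuousLinearMap.pi fun k : I × J => X k.1 k.2)).measurable hm
  have hm2 := (ContinuousLinearMap.continuous (ContinuousLinearMap.pi fun k : I × J => Y k.1 k.2)).measurable hm
  have e1 : {p | ∃ i, ∀ j, X i j p ≤ c} = ((ContinuousLinearMap.pi fun k : I × J => X k.1 k.2) ⁻¹' {x : I × J → ℝ | ∀ i, ∃ j, c < x (i, j)})ᶜ := by
    ext p; simp
  have e2 : {p | ∃ i, ∀ j, Y i j p ≤ c} = ((ContinuousLinearMap.pi fun k : I × J => Y k.1 k.2) ⁻¹' {x : I × J → ℝ | ∀ i, ∃ j, c < x (i, j)})ᶜ := by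
    ext p; simp
  rw [e1, e2, prob_compl_eq_one_sub hm1, prob_compl_eq_one_sub hm2]
  exact tsub_le_tsub_left g' 1

lemma count_lim {Ω Ω' : Type*} [MeasurableSpace Ω] [MeasurableSpace Ω'] (μ : Measure Ω) (ν : Measure Ω') [IsFiniteMeasure μ] [IsFiniteMeasure ν]
    (S : ℕ → ℕ → Set Ω) (T : ℕ → ℕ → Set Ω') (hT : ∀ i j, MeasurableSet (T i j))
    (h : ∀ N M : ℕ, μ {p | ∃ i : Fin N, ∀ j : Fin M, p ∈ S i j} ≤ ν {p | ∃ i : Fin N, ∀ j : Fin M, p ∈ T i j}) :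
    μ {p | ∃ i, ∀ j, p ∈ S i j} ≤ ν {p | ∃ i, ∀ j, p ∈ T i j} := by
  have step : ∀ N : ℕ, μ {p | ∃ i : Fin N, ∀ j, p ∈ S i j} ≤ ν {p | ∃ i : Fin N, ∀ j, p ∈ T i j} := by
    intro N
    have hanti : Antitone fun M : ℕ => {p | ∃ i : Fin N, ∀ j : Fin M, p ∈ T i j} := by
      intro M M' hM p ⟨i, hi⟩
      exact ⟨i, fun j => hi ⟨j, j.2.trans_le hM⟩⟩
    have e : {p | ∃ i : Fin N, ∀ j, p ∈ T i j} = ⋂ M : ℕ, {p | ∃ i : Fin N, ∀ j : Fin M, p ∈ T i j} := by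
      ext p
      simp only [Set.mem_ofPred_eq, Set.mem_iInter]
      constructor
      · rintro ⟨i, hi⟩ M; exact ⟨i, fun j => hi j⟩
      · intro hp
        by_contra hcon
        push Not at hcon
        choose j hj using hcon
        obtain ⟨i, hi⟩ := hp (∑ i, j i + 1)
        exact hj i (hi ⟨j i, Nat.lt_succ_of_le (Finset.single_le_sum (fun _ _ => Nat.zero_le _) (Finset.mem_univ i))⟩)
    have ht := tendsto_measure_iInter_atTop (μ := ν) (s := fun M : ℕ => {p | ∃ i : Fin N, ∀ j : Fin M, p ∈ T i j})
      (fun M => by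
        have : {p | ∃ i : Fin N, ∀ j : Fin M, p ∈ T i j} = ⋃ i : Fin N, ⋂ j : Fin M, T i j := by ext; simp
        rw [this]
        exact (MeasurableSet.iUnion fun i => MeasurableSet.iInter fun j => hT _ _).nullMeasurableSet) hanti ⟨0, measure_ne_top _ _⟩
    rw [e]
    refine ge_of_tendsto' ht fun M => le_trans (measure_mono ?_) (h N M)
    rintro p ⟨i, hi⟩; exact ⟨i, fun j => hi j⟩
  have hmono : Monotone fun N : ℕ => {p | ∃ i : Fin N, ∀ j, p ∈ S i j} := by
    intro N N' hN p ⟨i, hi⟩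
    exact ⟨⟨i, i.2.trans_le hN⟩, hi⟩
  have e : {p | ∃ i, ∀ j, p ∈ S i j} = ⋃ N : ℕ, {p | ∃ i : Fin N, ∀ j, p ∈ S i j} := by
    ext p
    simp only [Set.mem_ofPred_eq, Set.mem_iUnion]
    constructor
    · rintro ⟨i, hi⟩; exact ⟨i + 1, ⟨i, Nat.lt_succ_self i⟩, hi⟩
    · rintro ⟨N, i, hi⟩; exact ⟨i, hi⟩
  have ht := tendsto_measure_iUnion_atTop (μ := μ) hmono
  rw [e]
  refine le_of_tendsto' ht fun N => (step N).trans (measure_mono ?_)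
  rintro p ⟨i, hi⟩; exact ⟨i, hi⟩

lemma gordon_count (PX : Measure E) (PY : Measure E') [IsGaussian PX] [IsGaussian PY]
    (X : ℕ → ℕ → (E →L[ℝ] ℝ)) (Y : ℕ → ℕ → (E' →L[ℝ] ℝ)) (hX0 : ∀ i j, ∫ p, X i j p ∂PX = 0) (hY0 : ∀ i j, ∫ p, Y i j p ∂PY = 0)
    (h1 : ∀ i j j', ∫ p, Y i j p * Y i j' p ∂PY = ∫ p, X i j p * X i j' p ∂PX)
    (h2 : ∀ i i' j j', ∫ p, Y i j p * Y i' j' p ∂PY ≤ ∫ p, X i j p * X i' j' p ∂PX) (c : ℝ) :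
    PX {p | ∃ i, ∀ j, X i j p ≤ c} ≤ PY {p | ∃ i, ∀ j, Y i j p ≤ c} := by
  refine count_lim PX PY (fun i j => {p | X i j p ≤ c}) (fun i j => {p | Y i j p ≤ c}) (fun i j => ?_) fun N M => ?_
  · exact measurableSet_le (Y i j).continuous.measurable measurable_const
  · exact gordon_clm (I := Fin N) (J := Fin M) PX PY (fun i j => X i j) (fun i j => Y i j) (fun _ _ => hX0 _ _) (fun _ _ => hY0 _ _)
      (fun _ _ _ => h1 _ _ _) (fun _ _ _ _ => h2 _ _ _ _) c
end

lemma XP_clm {m n : ℕ} (σ : ℝ) (w : Fin n → ℝ) (u : Fin m → ℝ) :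
    ∃ L : (((Fin m → Fin n → ℝ) × (Fin m → ℝ)) × ℝ) →L[ℝ] ℝ, ∀ p, L p = XP σ w u p := by
  have h : IsLinearMap ℝ (XP σ w u : (((Fin m → Fin n → ℝ) × (Fin m → ℝ)) × ℝ) → ℝ) := by
    constructor
    · intro p q; simp only [XP, Prod.fst_add, Prod.snd_add, Pi.add_apply, mul_add, Finset.sum_add_distrib]; ring
    · intro c p
      simp only [XP, Prod.smul_fst, Prod.smul_snd, Pi.smul_apply, smul_eq_mul, mul_add, Finset.mul_sum]
      congr 1
      · congr 1
        · exact Finset.sum_congr rfl fun i _ => Finset.sum_congr rfl fun j _ => by ring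
        · exact Finset.sum_congr rfl fun i _ => by ring
      · ring
  exact ⟨LinearMap.toContinuousLinearMap (h.mk' _), fun p => rfl⟩

lemma YP_clm {m n : ℕ} (σ : ℝ) (w : Fin n → ℝ) (u : Fin m → ℝ) :
    ∃ L : (((Fin m → ℝ) × (Fin n → ℝ)) × ℝ) →L[ℝ] ℝ, ∀ p, L p = YP σ w u p := by
  have h : IsLinearMap ℝ (YP σ w u : (((Fin m → ℝ) × (Fin n → ℝ)) × ℝ) → ℝ) := by
    constructor
    · intro p q; simp only [YP, Prod.fst_add, Prod.snd_add, Pi.add_apply, mul_add, Finset.sum_add_distrib]; ring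
    · intro c p
      simp only [YP, Prod.smul_fst, Prod.smul_snd, Pi.smul_apply, smul_eq_mul, mul_add, Finset.mul_sum]
      congr 1
      · congr 1
        · exact Finset.sum_congr rfl fun i _ => by ring
        · exact Finset.sum_congr rfl fun i _ => by ring
      · ring
  exact ⟨LinearMap.toContinuousLinearMap (h.mk' _), fun p => rfl⟩

/-- rows `w`, columns `u` -/
lemma gordon_w {m n : ℕ} (σ : ℝ) (w : ℕ → Fin n → ℝ) (u : ℕ → Fin m → ℝ) (hu : ∀ j, e2norm (u j) = 1) (c : ℝ) :
    muX m n σ {p | ∃ i, ∀ j, XP σ (w i) (u j) p ≤ c} ≤ muY m n {p | ∃ i, ∀ j, YP σ (w i) (u j) p ≤ c} := by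
  choose LX hLX using fun i j => XP_clm σ (w i) (u j)
  choose LY hLY using fun i j => YP_clm σ (w i) (u j)
  have := gordon_count (muX m n σ) (muY m n) LX LY (fun i j => by simp_rw [hLX]; exact (CL2_XP _ _ _).2) (fun i j => by simp_rw [hLY]; exact (CL2_YP _ _ _).2)
    (fun i j j' => by simp_rw [hLX, hLY]; exact cov_eq_w _ _ _ _) (fun i i' j j' => by simp_rw [hLX, hLY]; exact cov_le _ _ _ _ _ (hu _) (hu _)) c
  simpa only [hLX, hLY] using this

/-- rows `u`, columns `w`, negated -/
lemma gordon_u {m n : ℕ} (σ : ℝ) (w : ℕ → Fin n → ℝ) (u : ℕ → Fin m → ℝ) (hu : ∀ j, e2norm (u j) = 1) (c : ℝ) :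
    muX m n σ {p | ∃ i, ∀ j, c ≤ XP σ (w j) (u i) p} ≤ muY m n {p | ∃ i, ∀ j, c ≤ YP σ (w j) (u i) p} := by
  choose LX hLX using fun i j => XP_clm σ (w i) (u j)
  choose LY hLY using fun i j => YP_clm σ (w i) (u j)
  have := gordon_count (muX m n σ) (muY m n) (fun i j => -LX j i) (fun i j => -LY j i)
    (fun i j => by simp only [ContinuousLinearMap.neg_apply, integral_neg, hLX]; rw [(CL2_XP _ _ _).2, neg_zero])
    (fun i j => by simp only [ContinuousLinearMap.neg_apply, integral_neg, hLY]; rw [(CL2_YP _ _ _).2, neg_zero])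
    (fun i j j' => by simp only [ContinuousLinearMap.neg_apply, hLX, hLY, neg_mul_neg]; exact cov_eq_u _ _ _ _ (hu _))
    (fun i i' j j' => by simp only [ContinuousLinearMap.neg_apply, hLX, hLY, neg_mul_neg]; exact cov_le _ _ _ _ _ (hu _) (hu _)) (-c)
  simpa only [ContinuousLinearMap.neg_apply, hLX, hLY, neg_le_neg_iff] using this
end

section
open MeasureTheory ProbabilityTheory Filter Topology

noncomputable def resid {m n : ℕ} (ω : (Fin m → Fin n → ℝ) × (Fin m → ℝ)) (w : Fin n → ℝ) : Fin m → ℝ :=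
  fun i => ω.2 i - ∑ j, ω.1 i j * w j

noncomputable def YN {m n : ℕ} (σ : ℝ) (w : Fin n → ℝ) (p : ((Fin m → ℝ) × (Fin n → ℝ)) × ℝ) : ℝ :=
  nrm σ w * e2norm p.1.1 + (∑ j, p.1.2 j * w j) + σ * p.2

lemma lassoVal_eq {m n : ℕ} (xt : Fin n → ℝ) (ω : (Fin m → Fin n → ℝ) × (Fin m → ℝ)) (x : Fin n → ℝ) :
    lassoVal m n xt ω x = e2norm (resid ω (x - xt)) := by
  unfold lassoVal resid
  congr 1; funext i
  simp only [Pi.sub_apply, mul_sub, Finset.sum_sub_distrib]; ring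

lemma continuous_resid {m n : ℕ} (ω : (Fin m → Fin n → ℝ) × (Fin m → ℝ)) : Continuous (resid ω) := by
  unfold resid; fun_prop

lemma nrm_nonneg {n : ℕ} (σ : ℝ) (w : Fin n → ℝ) : 0 ≤ nrm σ w := Real.sqrt_nonneg _

lemma continuous_nrm {n : ℕ} (σ : ℝ) : Continuous (nrm σ : (Fin n → ℝ) → ℝ) := by
  have := continuous_e2norm (d := n)
  unfold nrm; fun_prop

lemma continuous_YN {m n : ℕ} (σ : ℝ) (p : ((Fin m → ℝ) × (Fin n → ℝ)) × ℝ) : Continuous (fun w => YN σ w p) := by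
  have := continuous_nrm (n := n) σ
  unfold YN; fun_prop

lemma XP_eq {m n : ℕ} (σ : ℝ) (w : Fin n → ℝ) (u : Fin m → ℝ) (p : ((Fin m → Fin n → ℝ) × (Fin m → ℝ)) × ℝ) :
    XP σ w u p = (∑ i, u i * resid p.1 w i) + nrm σ w * p.2 := by
  unfold XP resid
  congr 1
  rw [← Finset.sum_add_distrib]
  refine Finset.sum_congr rfl fun i _ => ?_
  rw [mul_sub, Finset.mul_sum]
  have : ∑ j, -(u i * w j) * p.1.1 i j = - ∑ j, u i * (p.1.1 i j * w j) := by
    rw [← Finset.sum_neg_distrib]; exact Finset.sum_congr rfl fun j _ => by ring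
  rw [this]; ring

lemma YP_eq {m n : ℕ} (σ : ℝ) (w : Fin n → ℝ) (u : Fin m → ℝ) (p : ((Fin m → ℝ) × (Fin n → ℝ)) × ℝ) :
    YP σ w u p = nrm σ w * (∑ i, u i * p.1.1 i) + (∑ j, p.1.2 j * w j) + σ * p.2 := by
  unfold YP
  rw [Finset.mul_sum]
  congr 1; congr 1
  · exact Finset.sum_congr rfl fun i _ => by ring
  · exact Finset.sum_congr rfl fun i _ => by ring

lemma YP_le_YN {m n : ℕ} (σ : ℝ) (w : Fin n → ℝ) (u : Fin m → ℝ) (hu : e2norm u = 1) (p : ((Fin m → ℝ) × (Fin n → ℝ)) × ℝ) :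
    YP σ w u p ≤ YN σ w p := by
  rw [YP_eq]; unfold YN
  have := sum_mul_le_e2norm u p.1.1
  rw [hu, one_mul] at this
  have := mul_le_mul_of_nonneg_left this (nrm_nonneg σ w)
  linarith

lemma exists_unit {m : ℕ} (hm : 0 < m) (g : Fin m → ℝ) : ∃ u : Fin m → ℝ, e2norm u = 1 ∧ ∑ i, u i * g i = e2norm g := by
  by_cases hg : e2norm g = 0
  · refine ⟨Pi.single ⟨0, hm⟩ 1, ?_, ?_⟩
    · unfold e2norm
      rw [Finset.sum_eq_single (⟨0, hm⟩ : Fin m)] <;> simp +contextual [Pi.single_apply]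
    · have h0 : ∀ i, g i = 0 := fun i => by
        have := abs_coord_le_e2norm g i
        rw [hg] at this; exact abs_nonpos_iff.1 this
      simp [h0, e2norm]
  · have hp : 0 < e2norm g := lt_of_le_of_ne (e2norm_nonneg g) (Ne.symm hg)
    refine ⟨(e2norm g)⁻¹ • g, ?_, ?_⟩
    · rw [e2norm_smul, abs_of_pos (inv_pos.2 hp), inv_mul_cancel₀ hg]
    · have : ∑ i, ((e2norm g)⁻¹ • g) i * g i = (e2norm g)⁻¹ * e2norm g ^ 2 := by
        rw [e2norm_sq, Finset.mul_sum]
        exact Finset.sum_congr rfl fun i _ => by simp; ring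
      rw [this]; field_simp

lemma gauss_half : 1 ≤ 2 * gaussianReal 0 1 (Set.Iic 0) ∧ 1 ≤ 2 * gaussianReal 0 1 (Set.Ici 0) := by
  have hs : gaussianReal 0 1 (Set.Ici 0) = gaussianReal 0 1 (Set.Iic 0) := by
    have h : (gaussianReal 0 1).map (fun x => -x) = gaussianReal 0 1 := by
      rw [gaussianReal_map_neg, neg_zero]
    conv_lhs => rw [← h]
    rw [Measure.map_apply measurable_neg measurableSet_Ici]
    congr 1; ext x; simp
  have h1 : (1 : ENNReal) ≤ gaussianReal 0 1 (Set.Iic 0) + gaussianReal 0 1 (Set.Ici 0) := by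
    rw [← measure_univ (μ := gaussianReal 0 1), ← Set.Iic_union_Ici (a := (0:ℝ))]
    exact measure_union_le _ _
  rw [hs] at h1 ⊢
  rw [two_mul]; exact ⟨h1, h1⟩

lemma prod_half {Ω : Type*} [MeasurableSpace Ω] (μ : Measure Ω) [IsProbabilityMeasure μ] (s : Set Ω) (t : Set ℝ) (ht : 1 ≤ 2 * gaussianReal 0 1 t)
    (T : Set (Ω × ℝ)) (h : s ×ˢ t ⊆ T) : μ s ≤ 2 * (μ.prod (gaussianReal 0 1)) T := by
  calc μ s = μ s * 1 := (mul_one _).symm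
    _ ≤ μ s * (2 * gaussianReal 0 1 t) := by gcongr
    _ = 2 * (μ.prod (gaussianReal 0 1)) (s ×ˢ t) := by rw [Measure.prod_prod]; ring
    _ ≤ _ := by gcongr

/-- a dense sequence in a nonempty set -/
lemma exists_seq {X : Type*} [MetricSpace X] [SecondCountableTopology X] (S : Set X) (hS : S.Nonempty) :
    ∃ w : ℕ → X, (∀ i, w i ∈ S) ∧ ∀ O : Set X, IsOpen O → (O ∩ S).Nonempty → ∃ i, w i ∈ O := by
  haveI : Nonempty S := hS.to_subtype
  refine ⟨fun i => (TopologicalSpace.denseSeq S i : X), fun i => (TopologicalSpace.denseSeq S i).2, fun O hO ⟨x, hxO, hxS⟩ => ?_⟩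
  have := (TopologicalSpace.denseRange_denseSeq S).exists_mem_open (hO.preimage continuous_subtype_val) ⟨⟨x, hxS⟩, hxO⟩
  exact this

theorem G1 {m n : ℕ} (hm : 0 < m) (σ : ℝ) (S : Set (Fin n → ℝ)) (c η : ℝ) (hη : 0 < η) :
    muAv m n σ {ω | ∃ w ∈ S, e2norm (resid ω w) ≤ c} ≤ 2 * muY m n {p | ∃ w ∈ S, YN σ w p ≤ c + η} := by
  rcases S.eq_empty_or_nonempty with rfl | hS
  · simp
  obtain ⟨w, hwS, hw⟩ := exists_seq S hS
  have hUne : {u : Fin m → ℝ | e2norm u = 1}.Nonempty := by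
    obtain ⟨u, hu, _⟩ := exists_unit hm 0; exact ⟨u, hu⟩
  obtain ⟨u, hu1, hu⟩ := exists_seq _ hUne
  have g := gordon_w (m := m) σ w u hu1 (c + η)
  refine (prod_half (muAv m n σ) _ _ gauss_half.1 {p | ∃ i, ∀ j, XP σ (w i) (u j) p ≤ c + η} ?_).trans ?_
  · rintro ⟨ω, γ⟩ ⟨⟨w0, hw0, hle⟩, hγ⟩
    obtain ⟨i, hi⟩ := hw {x | e2norm (resid ω x) < c + η} (isOpen_lt (continuous_e2norm.comp (continuous_resid ω)) continuous_const)
      ⟨w0, by simp only [Set.mem_ofPred_eq]; simp only at hle; linarith, hw0⟩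
    refine ⟨i, fun j => ?_⟩
    rw [XP_eq]
    have h1 := sum_mul_le_e2norm (u j) (resid ω (w i))
    rw [show e2norm (u j) = 1 from hu1 j, one_mul] at h1
    have h2 : nrm σ (w i) * γ ≤ 0 := mul_nonpos_of_nonneg_of_nonpos (nrm_nonneg _ _) hγ
    simp only [Set.mem_ofPred_eq] at hi ⊢
    linarith
  · refine mul_le_mul_right (g.trans (measure_mono ?_)) 2
    rintro p ⟨i, hi⟩
    refine ⟨w i, hwS i, ?_⟩
    by_contra hcon
    push Not at hcon
    obtain ⟨u0, hu0, hu0g⟩ := exists_unit hm p.1.1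
    have : Continuous fun u : Fin m → ℝ => YP σ (w i) u p := by unfold YP; fun_prop
    obtain ⟨j, hj⟩ := hu {x | c + η < YP σ (w i) x p} (isOpen_lt continuous_const this) ⟨u0, by
      simp only [Set.mem_ofPred_eq]; rw [YP_eq, hu0g]; exact hcon, hu0⟩
    exact absurd (hi j) (not_le.2 hj)

lemma dual_cert {m n : ℕ} (S : Set (Fin n → ℝ)) (hS : S.Nonempty) (hc : IsCompact S) (hcv : Convex ℝ S)
    (ω : (Fin m → Fin n → ℝ) × (Fin m → ℝ)) (c : ℝ) (hc0 : 0 < c) (h : ∀ w ∈ S, c ≤ e2norm (resid ω w)) :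
    ∃ u : Fin m → ℝ, e2norm u = 1 ∧ ∀ w ∈ S, c ≤ ∑ i, u i * resid ω w i := by
  obtain ⟨w0, hw0, hmin⟩ := hc.exists_isMinOn hS (continuous_e2norm.comp (continuous_resid ω)).continuousOn
  have hpos : 0 < e2norm (resid ω w0) := hc0.trans_le (h w0 hw0)
  refine ⟨(e2norm (resid ω w0))⁻¹ • resid ω w0, ?_, fun w hw => ?_⟩
  · rw [e2norm_smul, abs_of_pos (inv_pos.2 hpos), inv_mul_cancel₀ hpos.ne']
  have key : e2norm (resid ω w0) ^ 2 ≤ ∑ i, resid ω w0 i * resid ω w i := by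
    set r0 := resid ω w0
    set r := resid ω w
    by_contra hcon
    push Not at hcon
    set b := ∑ i, r0 i * r i with hb
    set q := e2norm (r - r0) ^ 2 with hq
    have hq0 : 0 ≤ q := sq_nonneg _
    set d := e2norm r0 ^ 2 - b with hd
    have hd0 : 0 < d := by rw [hd]; linarith
    have ht : ∀ t : ℝ, 0 ≤ t → t ≤ 1 → 0 ≤ -(2 * t * d) + t ^ 2 * q := by
      intro t ht0 ht1
      have hmem : (1 - t) • w0 + t • w ∈ S := hcv hw0 hw (by linarith) ht0 (by ring)
      have h1 : e2norm r0 ≤ e2norm (resid ω ((1 - t) • w0 + t • w)) := hmin hmem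
      have h2 : resid ω ((1 - t) • w0 + t • w) = r0 + t • (r - r0) := by
        funext i
        simp only [r0, r, resid, Pi.add_apply, Pi.smul_apply, smul_eq_mul, Pi.sub_apply]
        have : ∑ j, ω.1 i j * ((1 - t) * w0 j + t * w j) = (1 - t) * (∑ j, ω.1 i j * w0 j) + t * ∑ j, ω.1 i j * w j := by
          rw [Finset.mul_sum, Finset.mul_sum, ← Finset.sum_add_distrib]
          exact Finset.sum_congr rfl fun j _ => by ring
        rw [this]; ring
      rw [h2] at h1
      have h3 := pow_le_pow_left₀ (e2norm_nonneg _) h1 2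
      have h4 : e2norm (r0 + t • (r - r0)) ^ 2 = e2norm r0 ^ 2 + (-(2 * t * d) + t ^ 2 * q) := by
        rw [hq, hd, e2norm_sq, e2norm_sq, e2norm_sq, hb, ← Finset.sum_sub_distrib, Finset.mul_sum, Finset.mul_sum, ← Finset.sum_neg_distrib,
          ← Finset.sum_add_distrib, ← Finset.sum_add_distrib]
        refine Finset.sum_congr rfl fun i _ => ?_
        simp only [Pi.add_apply, Pi.smul_apply, smul_eq_mul, Pi.sub_apply]; ring
      linarith
    have h5 := ht (d / (d + q)) (by positivity) (by rw [div_le_one (by positivity)]; linarith)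
    have h6 : -(2 * (d / (d + q)) * d) + (d / (d + q)) ^ 2 * q = -(d ^ 2 / (d + q)) * (2 - q / (d + q)) := by field_simp; ring
    have h7 : q / (d + q) ≤ 1 := by rw [div_le_one (by positivity)]; linarith
    have h8 : 0 < d ^ 2 / (d + q) := by positivity
    rw [h6] at h5
    nlinarith
  have e : ∑ i, ((e2norm (resid ω w0))⁻¹ • resid ω w0) i * resid ω w i = (e2norm (resid ω w0))⁻¹ * ∑ i, resid ω w0 i * resid ω w i := by
    rw [Finset.mul_sum]; exact Finset.sum_congr rfl fun i _ => by simp; ring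
  rw [e]
  refine (h w0 hw0).trans ?_
  rw [inv_mul_eq_div, le_div_iff₀ hpos]
  nlinarith

theorem G2 {m n : ℕ} (hm : 0 < m) (σ : ℝ) (S : Set (Fin n → ℝ)) (hS : S.Nonempty) (hc : IsCompact S) (hcv : Convex ℝ S) (c η : ℝ) (hc0 : 0 < c) (hη : 0 < η) :
    muAv m n σ {ω | ∀ w ∈ S, c ≤ e2norm (resid ω w)} ≤ 2 * muY m n {p | ∀ w ∈ S, c - η ≤ YN σ w p} := by
  obtain ⟨w, hwS, hw⟩ := exists_seq S hS
  have hUne : {u : Fin m → ℝ | e2norm u = 1}.Nonempty := by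
    obtain ⟨u, hu, _⟩ := exists_unit hm 0; exact ⟨u, hu⟩
  obtain ⟨u, hu1, hu⟩ := exists_seq _ hUne
  have g := gordon_u (m := m) σ w u hu1 (c - η)
  refine (prod_half (muAv m n σ) _ _ gauss_half.2 {p | ∃ i, ∀ j, c - η ≤ XP σ (w j) (u i) p} ?_).trans ?_
  · rintro ⟨ω, γ⟩ ⟨hω, hγ⟩
    obtain ⟨u0, hu0, hcert⟩ := dual_cert S hS hc hcv ω c hc0 hω
    obtain ⟨R, hR⟩ := (hc.image (continuous_e2norm.comp (continuous_resid ω))).bddAbove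
    have hR' : ∀ j, e2norm (resid ω (w j)) ≤ R := fun j => hR ⟨w j, hwS j, rfl⟩
    have hR0 : 0 ≤ R := (e2norm_nonneg _).trans (hR' 0)
    have hcont : Continuous fun x : Fin m → ℝ => e2norm (x - u0) := continuous_e2norm.comp (continuous_id.sub continuous_const)
    obtain ⟨i, hi⟩ := hu {x | e2norm (x - u0) < η / (R + 1)} (isOpen_lt hcont continuous_const) ⟨u0, by
      simp only [Set.mem_ofPred_eq, sub_self, e2norm_zero]; positivity, hu0⟩
    refine ⟨i, fun j => ?_⟩
    rw [XP_eq]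
    simp only [Set.mem_ofPred_eq] at hi
    have h1 := (abs_le.1 (abs_sum_mul_le_e2norm (u i - u0) (resid ω (w j)))).1
    have h2 : 0 ≤ nrm σ (w j) * γ := mul_nonneg (nrm_nonneg _ _) hγ
    have h3 := hcert (w j) (hwS j)
    have h4 : ∑ k, (u i - u0) k * resid ω (w j) k = (∑ k, u i k * resid ω (w j) k) - ∑ k, u0 k * resid ω (w j) k := by
      rw [← Finset.sum_sub_distrib]; exact Finset.sum_congr rfl fun k _ => by simp; ring
    have h5 : e2norm (u i - u0) * e2norm (resid ω (w j)) ≤ η := by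
      calc _ ≤ η / (R + 1) * R := mul_le_mul hi.le (hR' j) (e2norm_nonneg _) (by positivity)
        _ ≤ η / (R + 1) * (R + 1) := by gcongr; linarith
        _ = η := by field_simp
    simp only
    linarith
  · refine mul_le_mul_right (g.trans (measure_mono ?_)) 2
    rintro p ⟨i, hi⟩ w0 hw0
    by_contra hcon
    push Not at hcon
    obtain ⟨j, hj⟩ := hw {x | YN σ x p < c - η} (isOpen_lt (continuous_YN σ p) continuous_const) ⟨w0, hcon, hw0⟩
    have := (hi j).trans (YP_le_YN σ (w j) (u i) (hu1 i) p)
    exact absurd this (not_le.2 hj)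
end

section
open MeasureTheory ProbabilityTheory Filter Topology

def Kc (n k : ℕ) : Set (Fin n → ℝ) :=
  {z | ∃ ν : ℝ, 0 ≤ ν ∧ (∀ i : Fin n, n - k ≤ (i : ℕ) → z i = ν) ∧ (∀ i : Fin n, (i : ℕ) < n - k → |z i| ≤ ν)}

noncomputable def dfun (n k : ℕ) (w : Fin n → ℝ) : ℝ := ∑ i : Fin n, if (i : ℕ) < n - k then |w i| else w i

def Dc (n k : ℕ) : Set (Fin n → ℝ) := {w | dfun n k w ≤ 0}

noncomputable def Hf (n k : ℕ) (h : Fin n → ℝ) : ℝ := sInf ((fun z => e2norm (h + z)) '' Kc n k)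

lemma HgenFun_eq {m n k : ℕ} (p : (Fin m → ℝ) × (Fin n → ℝ)) : HgenFun m n k p = Hf n k p.2 := by
  unfold HgenFun Hf
  congr 1
  ext y
  simp only [Set.mem_image, Set.mem_ofPred_eq, Kc]
  constructor
  · rintro ⟨ν, lam, h0, h1, h2, rfl⟩
    refine ⟨fun i => ν - lam i, ⟨ν, h0, fun i hi => by simp [h1 i hi], fun i hi => ?_⟩, ?_⟩
    · have := h2 i hi; rw [abs_le]; constructor <;> linarith
    · congr 1; funext i; simp only [Pi.add_apply]; ring
  · rintro ⟨z, ⟨ν, h0, h1, h2⟩, rfl⟩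
    refine ⟨ν, fun i => ν - z i, h0, fun i hi => by simp [h1 i hi], fun i hi => ?_, ?_⟩
    · have := abs_le.1 (h2 i hi); constructor <;> linarith
    · congr 1; funext i; simp only [Pi.add_apply]; ring

lemma Kc_zero (n k : ℕ) : (0 : Fin n → ℝ) ∈ Kc n k := ⟨0, le_rfl, by simp, by simp⟩

lemma Kc_add {n k : ℕ} {z z' : Fin n → ℝ} (h : z ∈ Kc n k) (h' : z' ∈ Kc n k) : z + z' ∈ Kc n k := by
  obtain ⟨ν, h0, h1, h2⟩ := h
  obtain ⟨ν', h0', h1', h2'⟩ := h'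
  refine ⟨ν + ν', by positivity, fun i hi => by simp [h1 i hi, h1' i hi], fun i hi => ?_⟩
  exact (abs_add_le _ _).trans (add_le_add (h2 i hi) (h2' i hi))

lemma Kc_smul {n k : ℕ} {z : Fin n → ℝ} (h : z ∈ Kc n k) {c : ℝ} (hc : 0 ≤ c) : c • z ∈ Kc n k := by
  obtain ⟨ν, h0, h1, h2⟩ := h
  refine ⟨c * ν, by positivity, fun i hi => by simp [h1 i hi], fun i hi => ?_⟩
  simp only [Pi.smul_apply, smul_eq_mul, abs_mul, abs_of_nonneg hc]
  exact mul_le_mul_of_nonneg_left (h2 i hi) hc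

lemma Kc_closed {n k : ℕ} (hk : 1 ≤ k) (hkn : k ≤ n) : IsClosed (Kc n k) := by
  have hlt : n - 1 < n := by omega
  have : Kc n k = {z | 0 ≤ z ⟨n - 1, hlt⟩} ∩ (⋂ i : Fin n, {z | n - k ≤ (i : ℕ) → z i = z ⟨n - 1, hlt⟩}) ∩
      (⋂ i : Fin n, {z | (i : ℕ) < n - k → |z i| ≤ z ⟨n - 1, hlt⟩}) := by
    ext z
    simp only [Kc, Set.mem_inter_iff, Set.mem_iInter, Set.mem_ofPred_eq]
    constructor
    · rintro ⟨ν, h0, h1, h2⟩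
      have : z ⟨n - 1, hlt⟩ = ν := h1 ⟨n - 1, hlt⟩ (by simp; omega)
      rw [this]; exact ⟨⟨h0, h1⟩, h2⟩
    · rintro ⟨⟨h0, h1⟩, h2⟩
      exact ⟨_, h0, h1, h2⟩
  rw [this]
  refine ((isClosed_le (by fun_prop) (by fun_prop)).inter (isClosed_iInter fun i => ?_)).inter (isClosed_iInter fun i => ?_)
  · by_cases hi : n - k ≤ (i : ℕ)
    · simp only [hi, forall_const]; exact isClosed_eq (by fun_prop) (by fun_prop)
    · simp [hi]
  · by_cases hi : (i : ℕ) < n - k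
    · simp only [hi, forall_const]; exact isClosed_le (by fun_prop) (by fun_prop)
    · simp [hi]

lemma isCompact_e2 {n : ℕ} {S : Set (Fin n → ℝ)} (hS : IsClosed S) (r : ℝ) : IsCompact (S ∩ {w | e2norm w ≤ r}) := by
  refine Metric.isCompact_of_isClosed_isBounded (hS.inter (isClosed_le continuous_e2norm continuous_const)) ?_
  refine (Metric.isBounded_closedBall (x := (0 : Fin n → ℝ)) (r := |r|)).subset ?_
  rintro w ⟨_, hw⟩
  rw [Metric.mem_closedBall, dist_zero_right, pi_norm_le_iff_of_nonneg (abs_nonneg _)]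
  intro i
  exact (abs_coord_le_e2norm w i).trans (hw.trans (le_abs_self r))

lemma Kc_min {n k : ℕ} (hk : 1 ≤ k) (hkn : k ≤ n) (h : Fin n → ℝ) :
    ∃ z ∈ Kc n k, e2norm (h + z) = Hf n k h ∧ ∀ z' ∈ Kc n k, e2norm (h + z) ≤ e2norm (h + z') := by
  have hc := isCompact_e2 (Kc_closed hk hkn) (2 * e2norm h)
  obtain ⟨z, ⟨hz, _⟩, hmin⟩ := hc.exists_isMinOn (f := fun z => e2norm (h + z)) ⟨0, Kc_zero n k, by
    simp [e2norm_zero, e2norm_nonneg]⟩ ((continuous_e2norm.comp (continuous_const.add continuous_id)).continuousOn)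
  have hall : ∀ z' ∈ Kc n k, e2norm (h + z) ≤ e2norm (h + z') := by
    intro z' hz'
    by_cases hb : e2norm z' ≤ 2 * e2norm h
    · exact hmin ⟨hz', hb⟩
    · push Not at hb
      have h1 : e2norm (h + z) ≤ e2norm h := by
        have := hmin (show (0 : Fin n → ℝ) ∈ _ from ⟨Kc_zero n k, by simp [e2norm_zero, e2norm_nonneg]⟩)
        simpa using this
      have h2 : e2norm z' ≤ e2norm (h + z') + e2norm h := by
        have := e2norm_sub_le (h + z') h
        simpa using this
      linarith
  refine ⟨z, hz, ?_, hall⟩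
  refine le_antisymm ?_ ?_
  · apply le_csInf ⟨_, Set.mem_image_of_mem _ hz⟩
    rintro _ ⟨z', hz', rfl⟩; exact hall z' hz'
  · exact csInf_le ⟨0, by rintro _ ⟨z', _, rfl⟩; exact e2norm_nonneg _⟩ ⟨z, hz, rfl⟩

lemma Hf_nonneg {n k : ℕ} (h : Fin n → ℝ) : 0 ≤ Hf n k h := by
  apply Real.sInf_nonneg
  rintro _ ⟨z', _, rfl⟩; exact e2norm_nonneg _

lemma Hf_le {n k : ℕ} (h : Fin n → ℝ) : Hf n k h ≤ e2norm h :=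
  csInf_le ⟨0, by rintro _ ⟨z', _, rfl⟩; exact e2norm_nonneg _⟩ ⟨0, Kc_zero n k, by simp⟩

lemma Kc_Dc {n k : ℕ} {z w : Fin n → ℝ} (hz : z ∈ Kc n k) (hw : w ∈ Dc n k) : ∑ i, z i * w i ≤ 0 := by
  obtain ⟨ν, h0, h1, h2⟩ := hz
  have : ∑ i, z i * w i ≤ ν * dfun n k w := by
    unfold dfun; rw [Finset.mul_sum]
    refine Finset.sum_le_sum fun i _ => ?_
    split_ifs with hi
    · calc z i * w i ≤ |z i * w i| := le_abs_self _
        _ = |z i| * |w i| := abs_mul _ _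
        _ ≤ _ := mul_le_mul_of_nonneg_right (h2 i hi) (abs_nonneg _)
    · rw [h1 i (by omega)]
  exact this.trans (mul_nonpos_of_nonneg_of_nonpos h0 hw)

lemma Hf_weak {n k : ℕ} (h : Fin n → ℝ) {w : Fin n → ℝ} (hw : w ∈ Dc n k) :
    -(∑ i, h i * w i) ≤ Hf n k h * e2norm w := by
  by_cases h0 : e2norm w = 0
  · have := abs_sum_mul_le_e2norm h w
    rw [h0, mul_zero] at this ⊢
    exact (neg_le_abs _).trans this
  have hpos : 0 < e2norm w := lt_of_le_of_ne (e2norm_nonneg w) (Ne.symm h0)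
  rw [← div_le_iff₀ hpos]
  apply le_csInf ⟨_, Set.mem_image_of_mem _ (Kc_zero n k)⟩
  rintro _ ⟨z, hz, rfl⟩
  simp only
  rw [div_le_iff₀ hpos]
  have h1 := abs_le.1 (abs_sum_mul_le_e2norm (h + z) w)
  have h2 := Kc_Dc hz hw
  have : ∑ i, (h + z) i * w i = ∑ i, h i * w i + ∑ i, z i * w i := by
    rw [← Finset.sum_add_distrib]; refine Finset.sum_congr rfl fun i _ => ?_; simp [add_mul]
  linarith [h1.1]

lemma Dc_zero (n k : ℕ) : (0 : Fin n → ℝ) ∈ Dc n k := by simp [Dc, dfun]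

lemma dfun_smul {n k : ℕ} {w : Fin n → ℝ} {c : ℝ} (hc : 0 ≤ c) : dfun n k (c • w) = c * dfun n k w := by
  unfold dfun; rw [Finset.mul_sum]
  refine Finset.sum_congr rfl fun i _ => ?_
  split_ifs
  · simp [abs_mul, abs_of_nonneg hc]
  · simp

lemma dfun_add {n k : ℕ} (w w' : Fin n → ℝ) : dfun n k (w + w') ≤ dfun n k w + dfun n k w' := by
  unfold dfun; rw [← Finset.sum_add_distrib]
  refine Finset.sum_le_sum fun i _ => ?_
  split_ifs
  · exact abs_add_le _ _
  · simp

lemma Dc_smul {n k : ℕ} {w : Fin n → ℝ} (hw : w ∈ Dc n k) {c : ℝ} (hc : 0 ≤ c) : c • w ∈ Dc n k := by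
  unfold Dc at *; rw [Set.mem_ofPred_eq] at *
  rw [dfun_smul hc]; exact mul_nonpos_of_nonneg_of_nonpos hc hw

lemma Dc_convex (n k : ℕ) : Convex ℝ (Dc n k) := by
  intro x hx y hy a b ha hb hab
  have h1 := Dc_smul hx ha
  have h2 := Dc_smul hy hb
  unfold Dc at *; rw [Set.mem_ofPred_eq] at *
  exact (dfun_add _ _).trans (by linarith)

lemma Dc_closed (n k : ℕ) : IsClosed (Dc n k) := by
  refine isClosed_le ?_ continuous_const
  unfold dfun
  refine continuous_finsetSum _ fun i _ => ?_
  split_ifs <;> fun_prop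

lemma Hf_strong {n k : ℕ} (hk : 1 ≤ k) (hkn : k ≤ n) (h : Fin n → ℝ) :
    ∃ w ∈ Dc n k, e2norm w ≤ 1 ∧ -(∑ i, h i * w i) = Hf n k h := by
  obtain ⟨z, hz, hH, hmin⟩ := Kc_min hk hkn h
  by_cases h0 : Hf n k h = 0
  · exact ⟨0, Dc_zero n k, by simp [e2norm_zero], by simp [h0]⟩
  have hpos : 0 < Hf n k h := lt_of_le_of_ne (Hf_nonneg h) (Ne.symm h0)
  set q := h + z with hq
  -- first-order conditions
  have hfo : ∀ d : Fin n → ℝ, (∃ t0 > (0:ℝ), ∀ t, 0 < t → t ≤ t0 → z + t • d ∈ Kc n k) → 0 ≤ ∑ i, q i * d i := by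
    rintro d ⟨t0, ht0, ht⟩
    by_contra hneg
    push Not at hneg
    have key : ∀ t, 0 < t → t ≤ t0 → 0 ≤ 2 * (∑ i, q i * d i) + t * e2norm d ^ 2 := by
      intro t h1 h2
      have h3 := hmin _ (ht t h1 h2)
      have h4 : e2norm q ^ 2 ≤ e2norm (h + (z + t • d)) ^ 2 := by
        gcongr; exact e2norm_nonneg _
      have h5 : e2norm (h + (z + t • d)) ^ 2 = e2norm q ^ 2 + t * (2 * (∑ i, q i * d i) + t * e2norm d ^ 2) := by
        rw [e2norm_sq, e2norm_sq, e2norm_sq, Finset.mul_sum, Finset.mul_sum, ← Finset.sum_add_distrib, Finset.mul_sum,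
          ← Finset.sum_add_distrib]
        refine Finset.sum_congr rfl fun i _ => ?_
        simp [hq]; ring
      have h6 : 0 ≤ t * (2 * (∑ i, q i * d i) + t * e2norm d ^ 2) := by linarith
      exact nonneg_of_mul_nonneg_right h6 h1
    set s := ∑ i, q i * d i
    have hb := sq_nonneg (e2norm d)
    set b := e2norm d ^ 2
    have h7 := key (min t0 (-s / (b + 1))) (lt_min ht0 (div_pos (by linarith) (by linarith))) (min_le_left _ _)
    have h8 : min t0 (-s / (b + 1)) * b ≤ -s := by
      calc _ ≤ (-s / (b + 1)) * b := mul_le_mul_of_nonneg_right (min_le_right _ _) hb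
        _ = -s * (b / (b + 1)) := by ring
        _ ≤ -s * 1 := by
          refine mul_le_mul_of_nonneg_left ?_ (by linarith)
          rw [div_le_one (by linarith)]; linarith
        _ = -s := mul_one _
    linarith
  have hz1 : 0 ≤ ∑ i, q i * z i := hfo z ⟨1, one_pos, fun t h1 _ => Kc_add hz (Kc_smul hz h1.le)⟩
  have hz2 : 0 ≤ ∑ i, q i * (-z) i := hfo (-z) ⟨1, one_pos, fun t h1 h2 => by
    have : z + t • -z = (1 - t) • z := by rw [sub_smul, one_smul, smul_neg, sub_eq_add_neg]
    rw [this]; exact Kc_smul hz (by linarith)⟩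
  have hz0 : ∑ i, q i * z i = 0 := by
    simp only [Pi.neg_apply, mul_neg, Finset.sum_neg_distrib] at hz2; linarith
  have hqD : (-q) ∈ Dc n k := by
    set e : Fin n → ℝ := fun i => if (i : ℕ) < n - k then -(SignType.sign (q i) : ℝ) else 1 with he
    have heK : e ∈ Kc n k := by
      refine ⟨1, zero_le_one, fun i hi => by simp [he, not_lt.2 hi], fun i hi => ?_⟩
      simp only [he, hi, if_true, abs_neg]
      rcases lt_trichotomy (q i) 0 with h | h | h <;> simp [h]
    have := hfo e ⟨1, one_pos, fun t h1 _ => Kc_add hz (Kc_smul heK h1.le)⟩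
    have h9 : dfun n k (-q) = - ∑ i, q i * e i := by
      unfold dfun; rw [← Finset.sum_neg_distrib]
      refine Finset.sum_congr rfl fun i _ => ?_
      simp only [he]
      split_ifs with hi
      · simp only [Pi.neg_apply, abs_neg, mul_neg, neg_neg]; rw [self_mul_sign]
      · simp
    show dfun n k (-q) ≤ 0
    rw [h9]; linarith
  refine ⟨(Hf n k h)⁻¹ • (-q), Dc_smul hqD (by positivity), ?_, ?_⟩
  · rw [e2norm_smul, e2norm_neg, hH, abs_of_pos (by positivity), inv_mul_cancel₀ h0]
  · have h10 : ∑ i, q i * h i = Hf n k h ^ 2 := by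
      rw [← hH, e2norm_sq]
      have : ∑ i, q i ^ 2 = ∑ i, q i * h i + ∑ i, q i * z i := by
        rw [← Finset.sum_add_distrib]; refine Finset.sum_congr rfl fun i _ => ?_; simp [hq]; ring
      linarith
    have h11 : ∑ i, h i * ((Hf n k h)⁻¹ • (-q)) i = -((Hf n k h)⁻¹ * ∑ i, q i * h i) := by
      rw [Finset.mul_sum, ← Finset.sum_neg_distrib]
      refine Finset.sum_congr rfl fun i _ => ?_; simp; ring
    rw [h11, h10]; field_simp

lemma Hf_lip {n k : ℕ} (hk : 1 ≤ k) (hkn : k ≤ n) (h h' : Fin n → ℝ) :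
    |Hf n k h - Hf n k h'| ≤ 1 * e2norm (h - h') := by
  have key : ∀ h h' : Fin n → ℝ, Hf n k h - Hf n k h' ≤ e2norm (h - h') := by
    intro h h'
    obtain ⟨w, hw, hw1, he⟩ := Hf_strong hk hkn h
    have h1 := Hf_weak h' hw
    have h2 := abs_le.1 (abs_sum_mul_le_e2norm (h - h') w)
    have h3 : ∑ i, (h - h') i * w i = ∑ i, h i * w i - ∑ i, h' i * w i := by
      rw [← Finset.sum_sub_distrib]; refine Finset.sum_congr rfl fun i _ => ?_; simp [sub_mul]
    have h4 : Hf n k h' * e2norm w ≤ Hf n k h' * 1 := mul_le_mul_of_nonneg_left hw1 (Hf_nonneg _)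
    have h5 : e2norm (h - h') * e2norm w ≤ e2norm (h - h') * 1 := mul_le_mul_of_nonneg_left hw1 (e2norm_nonneg _)
    linarith [h2.1]
  rw [one_mul, abs_le]
  have := key h h'; have h2 := key h' h; rw [e2norm_sub_comm] at h2
  constructor <;> linarith
end

section
open MeasureTheory ProbabilityTheory Filter Topology

noncomputable def GE (m : ℕ) : ℝ := ∫ x, e2norm x ∂(stdG m)
noncomputable def HE (n k : ℕ) : ℝ := ∫ x, Hf n k x ∂(stdG n)
noncomputable def kap : ℝ := ∫ x, max x 0 ∂(gaussianReal 0 1)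

lemma integrable_posg : Integrable (fun x : ℝ => max x 0) (gaussianReal 0 1) := by
  have : Integrable (fun x : ℝ => x) (gaussianReal 0 1) := (memLp_id_gaussianReal 1).integrable le_rfl
  exact this.pos_part

lemma kap_pos : 0 < kap := by
  unfold kap
  rw [integral_pos_iff_support_of_nonneg (f := fun x : ℝ => max x 0) (fun x => le_max_right x (0:ℝ)) integrable_posg]
  have : Function.support (fun x : ℝ => max x 0) = Set.Ioi 0 := by
    ext x; simp only [Function.mem_support, Set.mem_Ioi, ne_eq]
    constructor
    · intro h; by_contra h'; exact h (max_eq_right (not_lt.1 h'))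
    · intro h; rw [max_eq_left h.le]; exact h.ne'
  rw [this]
  by_contra h
  have h0 : gaussianReal 0 1 (Set.Ioi 0) = 0 := by simpa using h
  have h1 := gaussianReal_absolutelyContinuous' 0 (one_ne_zero (α := NNReal)) h0
  simp at h1

lemma integral_coord {d : ℕ} (i : Fin d) (f : ℝ → ℝ) (hf : Measurable f) :
    ∫ x, f (x i) ∂(stdG d) = ∫ x, f x ∂(gaussianReal 0 1) := by
  have := (measurePreserving_eval (fun _ : Fin d => gaussianReal 0 1) i)
  rw [← this.map_eq, integral_map this.aemeasurable hf.aestronglyMeasurable]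

lemma integrable_coord {d : ℕ} (i : Fin d) (f : ℝ → ℝ) (hf : Integrable f (gaussianReal 0 1)) :
    Integrable (fun x => f (x i)) (stdG d) :=
  (measurePreserving_eval (fun _ : Fin d => gaussianReal 0 1) i).integrable_comp_of_integrable hf

lemma integrable_sqg : Integrable (fun x : ℝ => x ^ 2) (gaussianReal 0 1) :=
  (memLp_id_gaussianReal 2).integrable_sq

lemma integral_sqg : ∫ x, x ^ 2 ∂(gaussianReal 0 1) = 1 := by
  have := variance_fun_id_gaussianReal (μ := 0) (v := 1)
  rw [variance_eq_integral (by fun_prop)] at this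
  simpa using this

lemma integrable_e2sq (d : ℕ) : Integrable (fun x => e2norm x ^ 2) (stdG d) := by
  simp_rw [e2norm_sq]
  exact integrable_finsetSum _ fun i _ => integrable_coord i _ integrable_sqg

lemma integral_e2sq (d : ℕ) : ∫ x, e2norm x ^ 2 ∂(stdG d) = d := by
  simp_rw [e2norm_sq]
  rw [integral_finsetSum _ fun i _ => integrable_coord i _ integrable_sqg]
  simp_rw [integral_coord _ (fun x : ℝ => x ^ 2) (by fun_prop), integral_sqg]
  simp

lemma GE_le (m : ℕ) : GE m ≤ √m := by
  have h : (GE m) ^ 2 ≤ m := by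
    have h1 : ∫ x, (e2norm x - GE m) ^ 2 ∂(stdG m) = m - GE m ^ 2 := by
      have : ∀ x : Fin m → ℝ, (e2norm x - GE m) ^ 2 = e2norm x ^ 2 - (2 * GE m) * e2norm x + GE m ^ 2 := fun x => by ring
      simp_rw [this]
      have hh : Integrable (fun x : Fin m → ℝ => e2norm x ^ 2 - (2 * GE m) * e2norm x) (stdG m) :=
        (integrable_e2sq m).sub (integrable_e2norm.const_mul _)
      rw [integral_add hh (integrable_const _),
        integral_sub (integrable_e2sq m) (integrable_e2norm.const_mul _), integral_const_mul, integral_e2sq]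
      have : ∫ x, e2norm x ∂(stdG m) = GE m := rfl
      rw [this]; simp; ring
    have h2 : 0 ≤ ∫ x, (e2norm x - GE m) ^ 2 ∂(stdG m) := integral_nonneg fun x => sq_nonneg _
    linarith
  exact Real.le_sqrt_of_sq_le h

lemma GE_ge (m : ℕ) : kap * √m ≤ GE m := by
  rcases Nat.eq_zero_or_pos m with rfl | hm
  · simp [GE]; exact integral_nonneg fun x => e2norm_nonneg _
  have hp : ∀ x : Fin m → ℝ, ∑ i, max (x i) 0 ≤ e2norm x * √m := by
    intro x
    have h1 := sum_mul_le_e2norm (fun i => |x i|) (fun _ : Fin m => (1:ℝ))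
    have h2 : e2norm (fun i => |x i|) = e2norm x := by simp [e2norm]
    have h3 : e2norm (fun _ : Fin m => (1:ℝ)) = √m := by simp [e2norm]
    rw [h2, h3] at h1
    refine le_trans (Finset.sum_le_sum fun i _ => ?_) h1
    rw [mul_one]; exact max_le (le_abs_self _) (abs_nonneg _)
  have h := integral_mono (μ := stdG m) (integrable_finsetSum _ fun i _ => integrable_coord i _ integrable_posg)
    (integrable_e2norm.mul_const _) hp
  rw [integral_finsetSum _ fun i _ => integrable_coord i _ integrable_posg, integral_mul_const] at h
  simp_rw [integral_coord _ (fun x : ℝ => max x 0) (by fun_prop)] at h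
  have hs : (0:ℝ) < √m := Real.sqrt_pos.2 (by exact_mod_cast hm)
  have : (∑ i : Fin m, ∫ x, max x 0 ∂(gaussianReal 0 1)) = (√m * √m) * kap := by
    rw [Real.mul_self_sqrt (by positivity)]; simp [kap]
  rw [this] at h
  change _ ≤ GE m * √m at h
  nlinarith

lemma integrable_Hf {n k : ℕ} (hk : 1 ≤ k) (hkn : k ≤ n) : Integrable (fun x => Hf n k x) (stdG n) :=
  integrable_of_e2lip (Hf_lip hk hkn)

lemma HE_le {n k : ℕ} (hk : 1 ≤ k) (hkn : k ≤ n) : HE n k ≤ √n :=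
  (integral_mono (integrable_Hf hk hkn) integrable_e2norm fun x => Hf_le x).trans (GE_le n)

lemma card_last {n k : ℕ} (hkn : k ≤ n) : (Finset.univ.filter fun i : Fin n => ¬ (i : ℕ) < n - k).card = k := by
  have h1 := Finset.card_filter_add_card_filter_not (s := (Finset.univ : Finset (Fin n))) (fun i : Fin n => (i : ℕ) < n - k)
  have h2 : (Finset.univ.filter fun i : Fin n => (i : ℕ) < n - k).card = n - k := by
    rw [Fin.card_filter_val_lt]; omega
  rw [h2] at h1; simp at h1; simp; omega

lemma HE_ge {n k : ℕ} (hk : 1 ≤ k) (hkn : k ≤ n) : kap * √k ≤ HE n k := by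
  set S := Finset.univ.filter fun i : Fin n => ¬ (i : ℕ) < n - k with hS
  have hp : ∀ x : Fin n → ℝ, ∑ i ∈ S, max (x i) 0 ≤ Hf n k x * √k := by
    intro x
    set w : Fin n → ℝ := fun i => if (i : ℕ) < n - k then 0 else if 0 < x i then -1 else 0 with hw
    have hwD : w ∈ Dc n k := by
      show dfun n k w ≤ 0
      unfold dfun
      refine Finset.sum_nonpos fun i _ => ?_
      simp only [hw]; split_ifs <;> simp
    have h1 := Hf_weak x hwD
    have h2 : -(∑ i, x i * w i) = ∑ i ∈ S, max (x i) 0 := by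
      rw [hS, Finset.sum_filter, ← Finset.sum_neg_distrib]
      refine Finset.sum_congr rfl fun i _ => ?_
      simp only [hw]
      split_ifs with a b
      · simp
      · simp [b.le]
      · simp [not_lt.1 b]
    have h3 : e2norm w ≤ √k := by
      refine Real.sqrt_le_sqrt ?_
      have : ((k : ℕ) : ℝ) = ∑ i ∈ S, (1:ℝ) := by simp only [Finset.sum_const, hS, card_last hkn]; simp
      rw [this, hS, Finset.sum_filter]
      refine Finset.sum_le_sum fun i _ => ?_
      simp only [hw]
      split_ifs <;> simp
    rw [h2] at h1
    exact h1.trans (mul_le_mul_of_nonneg_left h3 (Hf_nonneg _))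
  have h := integral_mono (μ := stdG n) (integrable_finsetSum _ fun i _ => integrable_coord i _ integrable_posg)
    ((integrable_Hf hk hkn).mul_const _) hp
  rw [integral_finsetSum _ fun i _ => integrable_coord i _ integrable_posg, integral_mul_const] at h
  simp_rw [integral_coord _ (fun x : ℝ => max x 0) (by fun_prop)] at h
  have hs : (0:ℝ) < √k := Real.sqrt_pos.2 (by exact_mod_cast hk)
  have : (∑ i ∈ S, ∫ x, max x 0 ∂(gaussianReal 0 1)) = (√k * √k) * kap := by
    rw [Real.mul_self_sqrt (by positivity), Finset.sum_const, hS, card_last hkn]; simp [kap]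
  rw [this] at h
  change _ ≤ HE n k * √k at h
  nlinarith

lemma integral_GH_H (m n k : ℕ) : ∫ p, HgenFun m n k p ∂(muGH m n) = HE n k := by
  simp_rw [HgenFun_eq]
  unfold muGH
  rw [integral_fun_snd (μ := stdG m) (ν := stdG n) (fun h => Hf n k h)]; simp [HE]

lemma integral_GH_g (m n : ℕ) : ∫ p, e2norm p.1 ∂(muGH m n) = GE m := by
  unfold muGH
  rw [integral_fun_fst (μ := stdG m) (ν := stdG n) (fun h => e2norm h)]; simp [GE]
end

section
open MeasureTheory ProbabilityTheory Filter Topology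
open scoped ENNReal

noncomputable def psi (u : ℝ) : ℝ≥0∞ := ENNReal.ofReal ((√u)⁻¹ ^ (3/2 : ℝ))

noncomputable def psi1 (u : ℝ) : ℝ≥0∞ := (Set.Ioc (0:ℝ) 1).indicator (fun u => ENNReal.ofReal (u ^ (-(3/4) : ℝ))) u

lemma measurable_psi : Measurable psi := by unfold psi; fun_prop
lemma measurable_psi1 : Measurable psi1 := by
  unfold psi1; exact Measurable.indicator (by fun_prop) measurableSet_Ioc

lemma psi_le (u : ℝ) : psi u ≤ psi1 u + 1 := by
  by_cases h0 : u ≤ 0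
  · have : psi u = 0 := by
      unfold psi; rw [Real.sqrt_eq_zero_of_nonpos h0, inv_zero, Real.zero_rpow (by norm_num)]; simp
    rw [this]; exact zero_le
  push Not at h0
  by_cases h1 : u ≤ 1
  · have : psi u = psi1 u := by
      unfold psi psi1; rw [Set.indicator_of_mem (show u ∈ Set.Ioc (0:ℝ) 1 from ⟨h0, h1⟩)]
      congr 1
      rw [Real.sqrt_eq_rpow, ← Real.rpow_neg h0.le, ← Real.rpow_mul h0.le]; norm_num
    rw [this]; exact le_self_add
  · push Not at h1
    refine le_trans ?_ le_add_self
    unfold psi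
    rw [ENNReal.ofReal_le_one]
    refine Real.rpow_le_one (by positivity) ?_ (by norm_num)
    apply inv_le_one_of_one_le₀
    rw [Real.one_le_sqrt]; exact h1.le

lemma psi1_fin : ∫⁻ u, psi1 u < ∞ := by
  unfold psi1
  rw [lintegral_indicator measurableSet_Ioc]
  have h : IntegrableOn (fun u : ℝ => u ^ (-(3/4) : ℝ)) (Set.Ioc 0 1) := by
    have := intervalIntegral.intervalIntegrable_rpow' (a := 0) (b := 1) (r := (-(3/4) : ℝ)) (by norm_num)
    rwa [intervalIntegrable_iff_integrableOn_Ioc_of_le zero_le_one] at this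
  exact h.lintegral_lt_top

lemma psi1_cov (a : ℝ) : ∫⁻ r in Set.Ioi (0:ℝ), ENNReal.ofReal r * psi1 (r ^ 2 + a) ≤ ∫⁻ u, psi1 u := by
  have h := lintegral_image_eq_lintegral_abs_deriv_mul (s := Set.Ioi (0:ℝ)) (f := fun r => r ^ 2 + a)
    (f' := fun r => 2 * r) measurableSet_Ioi
    (fun x _ => by simpa using ((hasDerivAt_pow 2 x).add_const a).hasDerivWithinAt)
    (by
      intro x hx y hy hxy
      simp only [add_left_inj] at hxy
      exact (pow_left_inj₀ (le_of_lt hx) (le_of_lt hy) two_ne_zero).1 hxy) psi1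
  calc _ ≤ ∫⁻ r in Set.Ioi (0:ℝ), ENNReal.ofReal |2 * r| * psi1 (r ^ 2 + a) := by
        refine setLIntegral_mono' measurableSet_Ioi fun r hr => ?_
        gcongr
        have : (0:ℝ) < r := hr
        rw [abs_of_pos (by positivity)]; linarith
    _ = _ := h.symm
    _ ≤ _ := setLIntegral_le_lintegral _ _

lemma exp_fin : ∫⁻ r in Set.Ioi (0:ℝ), ENNReal.ofReal (r * Real.exp (-(r^2)/2)) < ∞ := by
  have h := integrable_mul_exp_neg_mul_sq (b := 1/2) (by norm_num)
  have h2 : Integrable (fun r : ℝ => r * Real.exp (-(r^2)/2)) := by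
    refine h.congr (ae_of_all _ fun x => ?_)
    simp only; congr 2; ring
  exact h2.integrableOn.lintegral_lt_top

lemma pdf_prod (x y : ℝ) : gaussianPDF 0 1 x * gaussianPDF 0 1 y ≤ ENNReal.ofReal (Real.exp (-(x^2+y^2)/2)) := by
  unfold gaussianPDF
  rw [← ENNReal.ofReal_mul (gaussianPDFReal_nonneg _ _ _)]
  apply ENNReal.ofReal_le_ofReal
  unfold gaussianPDFReal
  have h1 : (√(2 * Real.pi * ((1:NNReal):ℝ)))⁻¹ ≤ 1 := by
    apply inv_le_one_of_one_le₀
    rw [Real.one_le_sqrt]; simp; nlinarith [Real.pi_gt_three]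
  have h0 : 0 ≤ (√(2 * Real.pi * ((1:NNReal):ℝ)))⁻¹ := by positivity
  set c := (√(2 * Real.pi * ((1:NNReal):ℝ)))⁻¹
  have : c * Real.exp (-(x - 0) ^ 2 / (2 * ((1:NNReal):ℝ))) * (c * Real.exp (-(y - 0) ^ 2 / (2 * ((1:NNReal):ℝ)))) =
    c * c * Real.exp (-(x^2+y^2)/2) := by
    have : Real.exp (-(x^2+y^2)/2) = Real.exp (-(x - 0) ^ 2 / (2 * ((1:NNReal):ℝ))) * Real.exp (-(y - 0) ^ 2 / (2 * ((1:NNReal):ℝ))) := by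
      rw [← Real.exp_add]; congr 1; simp; ring
    rw [this]; ring
  rw [this]
  have hcc : c * c ≤ 1 := by nlinarith
  exact mul_le_of_le_one_left (Real.exp_nonneg _) hcc

lemma psi_2d : ∃ C : ℝ, 0 < C ∧ ∀ a : ℝ, ∫⁻ x, ∫⁻ y, psi (x ^ 2 + y ^ 2 + a) ∂(gaussianReal 0 1) ∂(gaussianReal 0 1) ≤ ENNReal.ofReal C := by
  set C1 : ℝ≥0∞ := ENNReal.ofReal (2 * Real.pi) * ((∫⁻ u, psi1 u) + ∫⁻ r in Set.Ioi (0:ℝ), ENNReal.ofReal (r * Real.exp (-(r^2)/2))) with hC1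
  have hfin : C1 ≠ ∞ := ENNReal.mul_ne_top ENNReal.ofReal_ne_top (ENNReal.add_ne_top.2 ⟨psi1_fin.ne, exp_fin.ne⟩)
  suffices H : ∀ a : ℝ, ∫⁻ x, ∫⁻ y, psi (x ^ 2 + y ^ 2 + a) ∂(gaussianReal 0 1) ∂(gaussianReal 0 1) ≤ C1 by
    refine ⟨C1.toReal + 1, by positivity, fun a => (H a).trans ?_⟩
    rw [← ENNReal.ofReal_toReal hfin]
    exact ENNReal.ofReal_le_ofReal (by rw [ENNReal.toReal_ofReal ENNReal.toReal_nonneg]; linarith)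
  intro a
  have hm := measurable_psi
  have hg := measurable_gaussianPDF 0 1
  have e1 : ∫⁻ x, ∫⁻ y, psi (x ^ 2 + y ^ 2 + a) ∂(gaussianReal 0 1) ∂(gaussianReal 0 1)
      = ∫⁻ p : ℝ × ℝ, gaussianPDF 0 1 p.1 * gaussianPDF 0 1 p.2 * psi (p.1 ^ 2 + p.2 ^ 2 + a) := by
    rw [Measure.volume_eq_prod, lintegral_prod _ (by fun_prop)]
    rw [gaussianReal_of_var_ne_zero 0 one_ne_zero]
    rw [lintegral_withDensity_eq_lintegral_mul _ hg]
    · refine lintegral_congr fun x => ?_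
      simp only [Pi.mul_apply]
      rw [lintegral_withDensity_eq_lintegral_mul _ hg (by fun_prop), ← lintegral_const_mul _ (by fun_prop)]
      refine lintegral_congr fun y => ?_
      simp only [Pi.mul_apply, mul_assoc]
    · exact Measurable.lintegral_prod_right (f := fun x y : ℝ => psi (x ^ 2 + y ^ 2 + a)) (by unfold Function.uncurry; fun_prop)
  rw [e1, ← lintegral_comp_polarCoord_symm]
  calc _ ≤ ∫⁻ p in polarCoord.target, ENNReal.ofReal (p.1) * (psi1 (p.1 ^ 2 + a)) + ENNReal.ofReal (p.1 * Real.exp (-(p.1^2)/2)) := by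
        refine setLIntegral_mono' polarCoord.open_target.measurableSet fun p hp => ?_
        have hp1 : 0 < p.1 := hp.1
        have hsum : (p.1 * Real.cos p.2) ^ 2 + (p.1 * Real.sin p.2) ^ 2 = p.1 ^ 2 := by
          have := Real.sin_sq_add_cos_sq p.2
          linear_combination p.1 ^ 2 * this
        have h1 := pdf_prod (p.1 * Real.cos p.2) (p.1 * Real.sin p.2)
        simp only [polarCoord_symm_apply, smul_eq_mul]
        rw [hsum] at h1 ⊢
        have h2 := psi_le (p.1 ^ 2 + a)
        have he : ENNReal.ofReal (Real.exp (-(p.1^2)/2)) ≤ 1 := by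
          rw [ENNReal.ofReal_le_one, Real.exp_le_one_iff]; nlinarith [sq_nonneg p.1]
        calc _ ≤ ENNReal.ofReal p.1 * (ENNReal.ofReal (Real.exp (-(p.1^2)/2)) * (psi1 (p.1 ^ 2 + a) + 1)) := by gcongr
          _ = ENNReal.ofReal p.1 * (ENNReal.ofReal (Real.exp (-(p.1^2)/2)) * psi1 (p.1 ^ 2 + a)) + ENNReal.ofReal p.1 * ENNReal.ofReal (Real.exp (-(p.1^2)/2)) := by ring
          _ ≤ ENNReal.ofReal p.1 * (1 * psi1 (p.1 ^ 2 + a)) + ENNReal.ofReal p.1 * ENNReal.ofReal (Real.exp (-(p.1^2)/2)) := by gcongr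
          _ = _ := by rw [one_mul, ← ENNReal.ofReal_mul hp1.le]
    _ = ∫⁻ r in Set.Ioi (0:ℝ), ∫⁻ _ in Set.Ioo (-Real.pi) Real.pi, (ENNReal.ofReal r * (psi1 (r ^ 2 + a)) + ENNReal.ofReal (r * Real.exp (-(r^2)/2))) := by
        have := measurable_psi1
        rw [polarCoord_target, Measure.volume_eq_prod, ← Measure.prod_restrict, lintegral_prod _ (by fun_prop)]
    _ = ENNReal.ofReal (2 * Real.pi) * ∫⁻ r in Set.Ioi (0:ℝ), (ENNReal.ofReal r * (psi1 (r ^ 2 + a)) + ENNReal.ofReal (r * Real.exp (-(r^2)/2))) := by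
        have := measurable_psi1
        rw [← lintegral_const_mul _ (by fun_prop)]
        refine lintegral_congr fun r => ?_
        rw [lintegral_const, Measure.restrict_apply_univ, Real.volume_Ioo, mul_comm]; congr 2; ring
    _ ≤ _ := by
        have := measurable_psi1
        rw [lintegral_add_left (by fun_prop), hC1]
        have := psi1_cov a
        exact mul_le_mul_right (add_le_add this le_rfl) _
end

section
open MeasureTheory ProbabilityTheory Filter Topology
open scoped ENNReal

lemma stdG_split {d : ℕ} (F : ℝ → ℝ≥0∞) (hF : Measurable F) :
    ∫⁻ g, F (e2norm g ^ 2) ∂(stdG (d + 1)) = ∫⁻ g, ∫⁻ x, F (x ^ 2 + e2norm g ^ 2) ∂(gaussianReal 0 1) ∂(stdG d) := by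
  have mp := measurePreserving_piFinSuccAbove (fun _ : Fin (d + 1) => gaussianReal 0 1) 0
  have h1 := mp.lintegral_comp (f := fun q : ℝ × (Fin d → ℝ) => F (q.1 ^ 2 + e2norm q.2 ^ 2)) (by fun_prop)
  rw [lintegral_prod_symm' _ (by fun_prop)] at h1
  rw [← h1]
  refine lintegral_congr fun g => ?_
  congr 1
  rw [e2norm_sq, e2norm_sq, Fin.sum_univ_succ]
  rfl

lemma psi_stdG : ∃ C : ℝ, 0 < C ∧ ∀ (m : ℕ) (a : ℝ), 2 ≤ m →
    ∫⁻ g, psi (e2norm g ^ 2 + a) ∂(stdG m) ≤ ENNReal.ofReal C := by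
  obtain ⟨C, hC, h⟩ := psi_2d
  refine ⟨C, hC, fun m a hm => ?_⟩
  obtain ⟨d, rfl⟩ : ∃ d, m = d + 2 := ⟨m - 2, by omega⟩
  have hmp := measurable_psi
  rw [stdG_split (fun u => psi (u + a)) (by fun_prop)]
  rw [stdG_split (fun u => ∫⁻ x, psi (x ^ 2 + u + a) ∂(gaussianReal 0 1))
    (Measurable.lintegral_prod_right (f := fun u x : ℝ => psi (x ^ 2 + u + a)) (by unfold Function.uncurry; fun_prop))]
  calc _ ≤ ∫⁻ g : Fin d → ℝ, ENNReal.ofReal C ∂(stdG d) := by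
        refine lintegral_mono fun g => ?_
        refine le_trans (le_of_eq ?_) (h (e2norm g ^ 2 + a))
        refine lintegral_congr fun x => lintegral_congr fun y => ?_
        congr 1; ring
    _ = _ := by simp

lemma measurable_Hf {n k : ℕ} (hk : 1 ≤ k) (hkn : k ≤ n) : Measurable (Hf n k) :=
  (continuous_of_e2lip (Hf_lip hk hkn)).measurable

lemma measurable_wgen {m n k : ℕ} (hk : 1 ≤ k) (hkn : k ≤ n) (σ : ℝ) : Measurable (wgen m n k σ) := by
  have := measurable_Hf hk hkn
  unfold wgen; simp_rw [HgenFun_eq]; fun_prop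

lemma wgen_nonneg {m n k : ℕ} {σ : ℝ} (hσ : 0 < σ) (p) : 0 ≤ wgen m n k σ p := by
  unfold wgen; rw [HgenFun_eq]
  have := Hf_nonneg (k := k) p.2
  positivity

lemma wgen_moment {σ : ℝ} (hσ : 0 < σ) : ∃ C : ℝ, 0 < C ∧ ∀ (m n k : ℕ), 2 ≤ m → 1 ≤ k → k ≤ n →
    ∫⁻ p, ENNReal.ofReal (wgen m n k σ p ^ (3/2 : ℝ)) ∂(muGH m n) ≤ ENNReal.ofReal (C * (1 + n)) := by
  obtain ⟨C, hC, h⟩ := psi_stdG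
  refine ⟨C * (1 + σ ^ 2), by positivity, fun m n k hm hk hkn => ?_⟩
  have hmp := measurable_psi
  have hmw := measurable_wgen (m := m) hk hkn σ
  have hmH := measurable_Hf hk hkn
  unfold muGH
  rw [lintegral_prod_symm' _ (by fun_prop)]
  calc _ ≤ ∫⁻ y : Fin n → ℝ, ENNReal.ofReal (C * (1 + σ ^ 2 * e2norm y ^ 2)) ∂(stdG n) := by
        refine lintegral_mono fun y => ?_
        have hH := Hf_nonneg (k := k) y
        have hH2 := Hf_le (k := k) y
        have e : ∀ x : Fin m → ℝ, ENNReal.ofReal (wgen m n k σ (x, y) ^ (3/2 : ℝ)) =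
            ENNReal.ofReal ((σ * Hf n k y) ^ (3/2 : ℝ)) * psi (e2norm x ^ 2 + -Hf n k y ^ 2) := by
          intro x
          unfold psi
          rw [← ENNReal.ofReal_mul (by positivity), ← Real.mul_rpow (by positivity) (by positivity), ← sub_eq_add_neg, ← div_eq_mul_inv]
          unfold wgen; rw [HgenFun_eq]
        simp_rw [e]
        rw [lintegral_const_mul _ (by fun_prop), mul_comm C, ENNReal.ofReal_mul (by positivity)]
        refine mul_le_mul' (ENNReal.ofReal_le_ofReal ?_) (h m _ hm)
        have hb : σ * Hf n k y ≤ σ * e2norm y := by gcongr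
        have h0 : 0 ≤ σ * Hf n k y := by positivity
        set t := σ * Hf n k y
        have ht : t ^ (3/2:ℝ) ≤ 1 + t ^ 2 := by
          by_cases h1 : t ≤ 1
          · have := Real.rpow_le_one h0 h1 (show (0:ℝ) ≤ 3/2 by norm_num)
            nlinarith [sq_nonneg t]
          · push Not at h1
            have := Real.rpow_le_rpow_of_exponent_le h1.le (show (3/2:ℝ) ≤ 2 by norm_num)
            rw [Real.rpow_two] at this; linarith
        refine ht.trans ?_
        rw [← mul_pow]; gcongr
    _ = ENNReal.ofReal (∫ y : Fin n → ℝ, (C * (1 + σ ^ 2 * e2norm y ^ 2)) ∂(stdG n)) := by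
        rw [ofReal_integral_eq_lintegral_ofReal]
        · exact ((integrable_const _).add ((integrable_e2sq n).const_mul _)).const_mul _
        · exact ae_of_all _ fun y => by simp only [Pi.zero_apply]; positivity
    _ ≤ _ := by
        apply ENNReal.ofReal_le_ofReal
        rw [integral_const_mul, integral_add (integrable_const _) ((integrable_e2sq n).const_mul _), integral_const_mul, integral_e2sq]
        simp only [integral_const, probReal_univ, smul_eq_mul, mul_one]
        rw [mul_assoc]
        gcongr
        have : (0:ℝ) ≤ n := by positivity
        nlinarith [sq_nonneg σ]

lemma young {w s : ℝ} (hw : 0 ≤ w) (hs : 0 < s) : w ≤ s * w ^ (3/2 : ℝ) + (s ^ 2)⁻¹ := by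
  by_cases h : w ≤ (s^2)⁻¹
  · have : 0 ≤ s * w ^ (3/2 : ℝ) := by positivity
    linarith
  · push Not at h
    have hw0 : 0 < w := lt_of_le_of_lt (by positivity) h
    have h1 : s⁻¹ ≤ √w := by
      apply Real.le_sqrt_of_sq_le; rw [inv_pow]; exact h.le
    have h2 : w ^ (3/2 : ℝ) = w * √w := by
      rw [Real.sqrt_eq_rpow]; nth_rewrite 2 [← Real.rpow_one w]; rw [← Real.rpow_add hw0]; norm_num
    have h3 : 1 ≤ s * √w := by
      calc 1 = s * s⁻¹ := by field_simp
        _ ≤ _ := by gcongr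
    have : 0 ≤ (s^2)⁻¹ := by positivity
    rw [h2]; nlinarith

lemma wgen_integral {σ : ℝ} (hσ : 0 < σ) : ∃ C : ℝ, 0 < C ∧ ∀ (m n k : ℕ), 2 ≤ m → 1 ≤ k → k ≤ n →
    ∀ (B : Set ((Fin m → ℝ) × (Fin n → ℝ))) (lo hi s b : ℝ), MeasurableSet B → 0 ≤ lo → 0 ≤ hi → 0 < s →
    (muGH m n).real B ≤ b → (∀ p ∉ B, lo ≤ wgen m n k σ p ∧ wgen m n k σ p ≤ hi) →
    lo * (1 - b) ≤ ∫ p, wgen m n k σ p ∂(muGH m n) ∧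
    ∫ p, wgen m n k σ p ∂(muGH m n) ≤ hi + s * (C * (1 + n)) + (s ^ 2)⁻¹ * b := by
  obtain ⟨C, hC, h⟩ := wgen_moment hσ
  refine ⟨C, hC, fun m n k hm hk hkn B lo hi s b hB hlo hhi hs hb hw => ?_⟩
  have hmw := measurable_wgen (m := m) hk hkn σ
  have hK := h m n k hm hk hkn
  have hi1 : Integrable (fun p => wgen m n k σ p ^ (3/2 : ℝ)) (muGH m n) := by
    refine ⟨(by fun_prop : Measurable _).aestronglyMeasurable, ?_⟩
    rw [hasFiniteIntegral_iff_ofReal (ae_of_all _ fun p => Real.rpow_nonneg (wgen_nonneg hσ p) _)]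
    exact hK.trans_lt ENNReal.ofReal_lt_top
  have hKr : ∫ p, wgen m n k σ p ^ (3/2 : ℝ) ∂(muGH m n) ≤ C * (1 + n) := by
    rw [← ENNReal.ofReal_le_ofReal_iff (by positivity), ofReal_integral_eq_lintegral_ofReal hi1
      (ae_of_all _ fun p => Real.rpow_nonneg (wgen_nonneg hσ p) _)]
    exact hK
  have hi2 : Integrable (fun p => wgen m n k σ p) (muGH m n) := by
    refine ((hi1.const_mul 1).add (integrable_const ((1:ℝ) ^ 2)⁻¹)).mono' hmw.aestronglyMeasurable (ae_of_all _ fun p => ?_)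
    rw [Real.norm_eq_abs, abs_of_nonneg (wgen_nonneg hσ p)]
    exact young (wgen_nonneg hσ p) one_pos
  constructor
  · have h1 : ∫ p, (Bᶜ).indicator (fun _ => lo) p ∂(muGH m n) ≤ ∫ p, wgen m n k σ p ∂(muGH m n) := by
      refine integral_mono ((integrable_const _).indicator hB.compl) hi2 fun p => ?_
      by_cases hp : p ∈ B
      · simp [hp, wgen_nonneg hσ p]
      · simp [hp, (hw p hp).1]
    rw [integral_indicator_const _ hB.compl, probReal_compl_eq_one_sub hB, smul_eq_mul] at h1
    refine le_trans ?_ h1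
    rw [mul_comm]; gcongr
  · have h1 : ∫ p, wgen m n k σ p ∂(muGH m n) ≤ ∫ p, (hi + s * wgen m n k σ p ^ (3/2 : ℝ)) + B.indicator (fun _ => (s^2)⁻¹) p ∂(muGH m n) := by
      refine integral_mono hi2 (((integrable_const _).add (hi1.const_mul _)).add ((integrable_const _).indicator hB)) fun p => ?_
      have hw0 := wgen_nonneg (m := m) (k := k) hσ p
      have hr : 0 ≤ s * wgen m n k σ p ^ (3/2 : ℝ) := by positivity
      by_cases hp : p ∈ B
      · simp only [hp, Set.indicator_of_mem]; have := young hw0 hs; linarith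
      · simp only [hp, not_false_eq_true, Set.indicator_of_notMem]; linarith [(hw p hp).2]
    have hh : Integrable (fun p => hi + s * wgen m n k σ p ^ (3/2 : ℝ)) (muGH m n) := (integrable_const _).add (hi1.const_mul _)
    rw [integral_add hh ((integrable_const _).indicator hB),
      integral_add (integrable_const _) (hi1.const_mul _), integral_const_mul, integral_indicator_const _ hB, smul_eq_mul] at h1
    simp only [integral_const, probReal_univ, smul_eq_mul, one_mul] at h1
    refine h1.trans ?_
    have : (muGH m n).real B * (s ^ 2)⁻¹ ≤ (s^2)⁻¹ * b := by rw [mul_comm]; gcongr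
    have : s * ∫ p, wgen m n k σ p ^ (3/2 : ℝ) ∂(muGH m n) ≤ s * (C * (1 + n)) := by gcongr
    linarith
end

section
open MeasureTheory ProbabilityTheory Filter Topology
open scoped ENNReal

lemma le_of_sq_le_sq_aux {a b : ℝ} (h : a ^ 2 ≤ b ^ 2) (hb : 0 ≤ b) : a ≤ b := by
  by_contra h'
  push Not at h'
  nlinarith

noncomputable def fr (σ ρ r : ℝ) : ℝ := √(r ^ 2 + σ ^ 2) - ρ * r
noncomputable def rs (σ ρ : ℝ) : ℝ := σ * ρ / √(1 - ρ ^ 2)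

lemma sqrt_add_le' {r σ : ℝ} (hr : 0 ≤ r) (hσ : 0 ≤ σ) : √(r ^ 2 + σ ^ 2) ≤ r + σ := by
  apply Real.sqrt_le_iff.2 ⟨by positivity, by nlinarith [mul_nonneg hr hσ]⟩

lemma c_bounds {ρ δ : ℝ} (h0 : 0 < ρ) (hδ : 0 < δ) (h1 : ρ ≤ 1 - δ) :
    0 < 1 - ρ ^ 2 ∧ δ ≤ 1 - ρ ^ 2 ∧ δ ≤ √(1 - ρ ^ 2) ∧ √(1 - ρ ^ 2) ≤ 1 := by
  have h2 : δ ≤ 1 - ρ ^ 2 := by nlinarith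
  refine ⟨by linarith, h2, ?_, ?_⟩
  · apply Real.le_sqrt_of_sq_le; nlinarith
  · rw [Real.sqrt_le_one]; nlinarith

lemma fr_rs {σ ρ : ℝ} (hσ : 0 < σ) (h1 : 0 < 1 - ρ ^ 2) : fr σ ρ (rs σ ρ) = σ * √(1 - ρ ^ 2) := by
  set c := √(1 - ρ ^ 2) with hc
  have hcp : 0 < c := Real.sqrt_pos.2 h1
  have hc2 : c ^ 2 = 1 - ρ ^ 2 := Real.sq_sqrt h1.le
  have hA : √((rs σ ρ) ^ 2 + σ ^ 2) = σ / c := by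
    have : (rs σ ρ) ^ 2 + σ ^ 2 = (σ / c) ^ 2 := by
      unfold rs; rw [← hc]; field_simp; rw [hc2]; ring
    rw [this, Real.sqrt_sq (by positivity)]
  unfold fr; rw [hA]; unfold rs; rw [← hc]; field_simp; rw [hc2]

lemma gap_unif {σ ρ0 δ ε : ℝ} (hσ : 0 < σ) (hρ0 : 0 < ρ0) (hδ : 0 < δ) (hε : 0 < ε) :
    ∃ Δ > 0, ∃ R > 0, ∀ ρ, ρ0 ≤ ρ → ρ ≤ 1 - δ →
      rs σ ρ ≤ R ∧ σ * ρ0 ≤ rs σ ρ ∧ ∀ r, 0 ≤ r → r ≤ 2 * rs σ ρ → ε * rs σ ρ ≤ |r - rs σ ρ| →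
        fr σ ρ (rs σ ρ) + Δ ≤ fr σ ρ r := by
  refine ⟨δ * (ε * (σ * ρ0)) ^ 2 / (4 * (σ / δ) + 2 * σ), by positivity, σ / δ, by positivity, fun ρ h0 h1 => ?_⟩
  obtain ⟨hc1, hc2, hc3, hc4⟩ := c_bounds (hρ0.trans_le h0) hδ h1
  have hrsq := fr_rs hσ hc1
  set c := √(1 - ρ ^ 2) with hc
  have hcp : 0 < c := Real.sqrt_pos.2 hc1
  have hcsq : c ^ 2 = 1 - ρ ^ 2 := Real.sq_sqrt hc1.le
  have hρ : 0 < ρ := hρ0.trans_le h0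
  have hρ1 : ρ ≤ 1 := by linarith
  have hrs : rs σ ρ = σ * ρ / c := rfl
  have hR : rs σ ρ ≤ σ / δ := by
    rw [hrs]
    have : σ * ρ ≤ σ := by nlinarith
    gcongr
  have hL : σ * ρ0 ≤ rs σ ρ := by
    rw [hrs, le_div_iff₀ hcp]
    calc σ * ρ0 * c ≤ σ * ρ0 * 1 := by gcongr
      _ ≤ σ * ρ := by rw [mul_one]; gcongr
  refine ⟨hR, hL, fun r hr hr2 hrε => ?_⟩
  rw [hrsq]; unfold fr
  have hA := sqrt_add_le' hr hσ.le
  have hA0 := Real.sqrt_nonneg (r ^ 2 + σ ^ 2)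
  have hA2 : √(r ^ 2 + σ ^ 2) ^ 2 = r ^ 2 + σ ^ 2 := Real.sq_sqrt (by positivity)
  set A := √(r ^ 2 + σ ^ 2)
  have hden : 0 < A + ρ * r + σ * c := by positivity
  have hden2 : A + ρ * r + σ * c ≤ 4 * (σ / δ) + 2 * σ := by nlinarith
  have hid : (A - ρ * r - σ * c) * (A + ρ * r + σ * c) = c ^ 2 * (r - rs σ ρ) ^ 2 := by
    rw [hrs]
    have : c ^ 2 * (r - σ * ρ / c) ^ 2 = (c * r - σ * ρ) ^ 2 := by field_simp
    rw [this]
    linear_combination hA2 - (r^2 - (0:ℝ)) * hcsq - (σ^2) * hcsq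
  have hid2 : A - ρ * r - σ * c = c ^ 2 * (r - rs σ ρ) ^ 2 / (A + ρ * r + σ * c) := by
    rw [eq_div_iff hden.ne', hid]
  have : δ * (ε * (σ * ρ0)) ^ 2 / (4 * (σ / δ) + 2 * σ) ≤ c ^ 2 * (r - rs σ ρ) ^ 2 / (A + ρ * r + σ * c) := by
    rw [hcsq]
    have h5 : (ε * (σ * ρ0)) ^ 2 ≤ (r - rs σ ρ) ^ 2 := by
      rw [← sq_abs (r - rs σ ρ)]
      gcongr
      exact le_trans (by gcongr) hrε
    gcongr
  linarith

lemma aux_e1 {ε : ℝ} (hε : 0 < ε) (hε1 : ε < 1) : (1 - ε) ^ 2 * (1 + ε / 4) ≤ (1 - ε / 4) ^ 2 := by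
  have h : 0 ≤ ε * (5/4 - 7/16 * ε - ε * ε / 4) := mul_nonneg hε.le (by nlinarith)
  linear_combination h

lemma aux_e2 {ε : ℝ} (hε : 0 < ε) (hε1 : ε < 1) : (1 + ε / 4) ^ 2 ≤ (1 + ε) ^ 2 * (1 - ε / 4) := by
  have h : 0 ≤ ε * (5/4 + 7/16 * ε - ε * ε / 4) := mul_nonneg hε.le (by nlinarith)
  linear_combination h

set_option maxHeartbeats 800000 in
lemma w_bound {σ ρ0 δ ε τ : ℝ} (hσ : 0 < σ) (hρ0 : 0 < ρ0) (hδ : 0 < δ) (hε : 0 < ε) (hε1 : ε < 1)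
    (hτ : 0 ≤ τ) (hτ1 : τ ≤ ρ0 * ε / 4) (hτ2 : τ ≤ δ * ε / 8) {ρ : ℝ} (h0 : ρ0 ≤ ρ) (h1 : ρ ≤ 1 - δ)
    {G x H : ℝ} (hG : 0 < G) (hx1 : G - τ * G ≤ x) (hx2 : x ≤ G + τ * G)
    (hH1 : ρ * G - τ * G ≤ H) (hH2 : H ≤ ρ * G + τ * G) (hH0 : 0 ≤ H) :
    (1 - ε) * rs σ ρ ≤ σ * H / √(x ^ 2 - H ^ 2) ∧ σ * H / √(x ^ 2 - H ^ 2) ≤ (1 + ε) * rs σ ρ := by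
  obtain ⟨hc1, hc2, hc3, hc4⟩ := c_bounds (hρ0.trans_le h0) hδ h1
  have hrs : rs σ ρ = σ * ρ / √(1 - ρ ^ 2) := rfl
  have hρ : 0 < ρ := hρ0.trans_le h0
  have hτρ : τ ≤ ρ * (ε / 4) := by nlinarith
  have hτ3 : 2 * τ * (1 + ρ) ≤ (1 - ρ ^ 2) * (ε / 4) := by
    have : δ * ε ≤ (1 - ρ) * ε := by gcongr; linarith
    have : 2 * τ ≤ (1 - ρ) * (ε / 4) := by linarith
    nlinarith
  have hd1 : 0 < 1 - τ := by nlinarith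
  -- denominators
  have hlow : G ^ 2 * ((1 - ρ ^ 2) * (1 - ε / 4)) ≤ x ^ 2 - H ^ 2 := by
    have e1 : ((1 - τ) * G) ^ 2 ≤ x ^ 2 := by
      have : (1 - τ) * G ≤ x := by linarith
      gcongr
    have e2 : H ^ 2 ≤ ((ρ + τ) * G) ^ 2 := by
      have : H ≤ (ρ + τ) * G := by linarith
      gcongr
    have e3 : (1 - ρ ^ 2) * (1 - ε / 4) ≤ (1 - τ) ^ 2 - (ρ + τ) ^ 2 := by nlinarith
    calc _ ≤ G ^ 2 * ((1 - τ) ^ 2 - (ρ + τ) ^ 2) := by gcongr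
      _ = ((1 - τ) * G) ^ 2 - ((ρ + τ) * G) ^ 2 := by ring
      _ ≤ _ := by linarith
  have hx0 : 0 ≤ x := le_trans (by nlinarith) hx1
  have hρτ : 0 ≤ ρ - τ := by nlinarith
  have hhigh : x ^ 2 - H ^ 2 ≤ G ^ 2 * ((1 - ρ ^ 2) * (1 + ε / 4)) := by
    have e1 : x ^ 2 ≤ ((1 + τ) * G) ^ 2 := by
      have : x ≤ (1 + τ) * G := by linarith
      gcongr
    have e2 : ((ρ - τ) * G) ^ 2 ≤ H ^ 2 := by
      have : (ρ - τ) * G ≤ H := by linarith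
      gcongr
    have e3 : (1 + τ) ^ 2 - (ρ - τ) ^ 2 ≤ (1 - ρ ^ 2) * (1 + ε / 4) := by nlinarith
    calc _ ≤ ((1 + τ) * G) ^ 2 - ((ρ - τ) * G) ^ 2 := by linarith
      _ = G ^ 2 * ((1 + τ) ^ 2 - (ρ - τ) ^ 2) := by ring
      _ ≤ _ := by gcongr
  have hpos : 0 < x ^ 2 - H ^ 2 := lt_of_lt_of_le (by
    have : 0 < 1 - ε / 4 := by linarith
    positivity) hlow
  set y := √(x ^ 2 - H ^ 2) with hy
  have hyp : 0 < y := Real.sqrt_pos.2 hpos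
  have hy2 : y ^ 2 = x ^ 2 - H ^ 2 := Real.sq_sqrt hpos.le
  set c := √(1 - ρ ^ 2) with hc
  have hcp : 0 < c := Real.sqrt_pos.2 hc1
  have hcsq : c ^ 2 = 1 - ρ ^ 2 := Real.sq_sqrt hc1.le
  rw [← hcsq] at hlow hhigh
  rw [← hy2] at hlow hhigh
  have hg2 : 0 < G ^ 2 * c ^ 2 := by positivity
  rw [hrs]
  constructor
  · have : (1 - ε) * ρ * y ≤ H * c := by
      refine le_of_sq_le_sq_aux ?_ (by positivity)
      have e2 : (ρ * (1 - ε / 4) * G) ^ 2 ≤ H ^ 2 := by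
        have : ρ * (1 - ε / 4) * G ≤ H := by nlinarith
        have : 0 ≤ ρ * (1 - ε / 4) * G := by have : 0 < 1 - ε / 4 := by linarith
                                             positivity
        gcongr
      have e3 : (1 - ε) ^ 2 * (1 + ε / 4) ≤ (1 - ε / 4) ^ 2 := aux_e1 hε hε1
      calc ((1 - ε) * ρ * y) ^ 2 = (1 - ε) ^ 2 * ρ ^ 2 * y ^ 2 := by ring
        _ ≤ (1 - ε) ^ 2 * ρ ^ 2 * (G ^ 2 * (c ^ 2 * (1 + ε / 4))) := by gcongr
        _ = (ρ ^ 2 * (G ^ 2 * c ^ 2)) * ((1 - ε) ^ 2 * (1 + ε / 4)) := by ring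
        _ ≤ (ρ ^ 2 * (G ^ 2 * c ^ 2)) * (1 - ε / 4) ^ 2 := by gcongr
        _ = (ρ * (1 - ε / 4) * G) ^ 2 * c ^ 2 := by ring
        _ ≤ H ^ 2 * c ^ 2 := by gcongr
        _ = (H * c) ^ 2 := by ring
    rw [← mul_div_assoc, div_le_div_iff₀ hcp hyp]
    linarith [mul_le_mul_of_nonneg_left this hσ.le]
  · have : H * c ≤ (1 + ε) * ρ * y := by
      refine le_of_sq_le_sq_aux ?_ (by positivity)
      have e2 : H ^ 2 ≤ (ρ * (1 + ε / 4) * G) ^ 2 := by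
        have : H ≤ ρ * (1 + ε / 4) * G := by nlinarith
        gcongr
      have e3 : (1 + ε / 4) ^ 2 ≤ (1 + ε) ^ 2 * (1 - ε / 4) := aux_e2 hε hε1
      calc (H * c) ^ 2 = H ^ 2 * c ^ 2 := by ring
        _ ≤ (ρ * (1 + ε / 4) * G) ^ 2 * c ^ 2 := by gcongr
        _ = (ρ ^ 2 * (G ^ 2 * c ^ 2)) * (1 + ε / 4) ^ 2 := by ring
        _ ≤ (ρ ^ 2 * (G ^ 2 * c ^ 2)) * ((1 + ε) ^ 2 * (1 - ε / 4)) := by gcongr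
        _ = (1 + ε) ^ 2 * ρ ^ 2 * (G ^ 2 * (c ^ 2 * (1 - ε / 4))) := by ring
        _ ≤ (1 + ε) ^ 2 * ρ ^ 2 * y ^ 2 := by gcongr
        _ = ((1 + ε) * ρ * y) ^ 2 := by ring
    rw [← mul_div_assoc, div_le_div_iff₀ hyp hcp]
    linarith [mul_le_mul_of_nonneg_left this hσ.le]
end

section
open MeasureTheory ProbabilityTheory Filter Topology
open scoped ENNReal

noncomputable def Mx {n : ℕ} (T : Set (Fin n → ℝ)) (r : ℝ) (h : Fin n → ℝ) : ℝ :=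
  sSup ((fun w => -(∑ i, h i * w i)) '' (T ∩ {w | e2norm w ≤ r}))

section Mx
variable {n : ℕ} {T : Set (Fin n → ℝ)} {r : ℝ}

lemma Mx_img_compact (hT : IsClosed T) (r : ℝ) (h : Fin n → ℝ) :
    IsCompact ((fun w => -(∑ i, h i * w i)) '' (T ∩ {w | e2norm w ≤ r})) :=
  (isCompact_e2 hT r).image (by fun_prop)

lemma Mx_ge (hT : IsClosed T) (h : Fin n → ℝ) {w : Fin n → ℝ} (hw : w ∈ T) (hwr : e2norm w ≤ r) :
    -(∑ i, h i * w i) ≤ Mx T r h :=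
  le_csSup (Mx_img_compact hT r h).bddAbove ⟨w, ⟨hw, hwr⟩, rfl⟩

lemma Mx_att (hT : IsClosed T) (h0 : (0 : Fin n → ℝ) ∈ T) (hr : 0 ≤ r) (h : Fin n → ℝ) :
    ∃ w ∈ T, e2norm w ≤ r ∧ -(∑ i, h i * w i) = Mx T r h := by
  have := (Mx_img_compact hT r h).sSup_mem ⟨_, ⟨0, ⟨h0, by simp [e2norm_zero, hr]⟩, rfl⟩⟩
  obtain ⟨w, ⟨hw, hwr⟩, he⟩ := this
  exact ⟨w, hw, hwr, he⟩

lemma Mx_lip (hT : IsClosed T) (h0 : (0 : Fin n → ℝ) ∈ T) (hr : 0 ≤ r) (h h' : Fin n → ℝ) :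
    |Mx T r h - Mx T r h'| ≤ r * e2norm (h - h') := by
  have key : ∀ h h' : Fin n → ℝ, Mx T r h - Mx T r h' ≤ r * e2norm (h - h') := by
    intro h h'
    obtain ⟨w, hw, hwr, he⟩ := Mx_att hT h0 hr h
    have h1 := Mx_ge hT h' hw hwr
    have h2 := abs_le.1 (abs_sum_mul_le_e2norm (h - h') w)
    have h3 : ∑ i, (h - h') i * w i = ∑ i, h i * w i - ∑ i, h' i * w i := by
      rw [← Finset.sum_sub_distrib]; refine Finset.sum_congr rfl fun i _ => ?_; simp [sub_mul]
    have h5 : e2norm (h - h') * e2norm w ≤ e2norm (h - h') * r := mul_le_mul_of_nonneg_left hwr (e2norm_nonneg _)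
    linarith [h2.1]
  rw [abs_le]
  have := key h h'; have h2 := key h' h; rw [e2norm_sub_comm] at h2
  constructor <;> linarith

lemma Mx_scale (hT : IsClosed T) (hcv : Convex ℝ T) (h0 : (0 : Fin n → ℝ) ∈ T) {r1 : ℝ} (hr : 0 < r) (hr1 : r ≤ r1) (h : Fin n → ℝ) :
    (r / r1) * Mx T r1 h ≤ Mx T r h := by
  have hr1p : 0 < r1 := hr.trans_le hr1
  obtain ⟨w, hw, hwr, he⟩ := Mx_att hT h0 hr1p.le h
  have h1 : (r / r1) • w ∈ T := hcv.smul_mem_of_zero_mem h0 hw ⟨by positivity, (div_le_one hr1p).2 hr1⟩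
  have h2 : e2norm ((r / r1) • w) ≤ r := by
    rw [e2norm_smul, abs_of_pos (by positivity)]
    calc r / r1 * e2norm w ≤ r / r1 * r1 := by gcongr
      _ = r := by field_simp
  have := Mx_ge hT h h1 h2
  refine le_trans (le_of_eq ?_) this
  rw [← he, mul_neg, Finset.mul_sum]; congr 1
  refine Finset.sum_congr rfl fun i _ => ?_
  simp; ring

lemma Mx_le_Hf {k : ℕ} (hT : IsClosed T) (h0 : (0 : Fin n → ℝ) ∈ T) (hTD : T ⊆ Dc n k) (hr : 0 ≤ r) (h : Fin n → ℝ) :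
    Mx T r h ≤ r * Hf n k h := by
  obtain ⟨w, hw, hwr, he⟩ := Mx_att hT h0 hr h
  rw [← he]
  refine (Hf_weak h (hTD hw)).trans ?_
  rw [mul_comm]; exact mul_le_mul_of_nonneg_right hwr (Hf_nonneg h)

end Mx

lemma meas_le_of_real {Ω : Type*} [MeasurableSpace Ω] {μ : Measure Ω} [IsFiniteMeasure μ] {s : Set Ω} {q : ℝ}
    (h : μ.real s ≤ q) : μ s ≤ ENNReal.ofReal q := by
  rw [← ofReal_measureReal]; exact ENNReal.ofReal_le_ofReal h

lemma muGH_fst {m n : ℕ} {S : Set (Fin m → ℝ)} (hS : MeasurableSet S) : muGH m n {p | p.1 ∈ S} = stdG m S := by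
  have : {p : (Fin m → ℝ) × (Fin n → ℝ) | p.1 ∈ S} = S ×ˢ Set.univ := by ext; simp
  rw [this]; unfold muGH; rw [Measure.prod_prod]; simp

lemma muGH_snd {m n : ℕ} {S : Set (Fin n → ℝ)} (hS : MeasurableSet S) : muGH m n {p | p.2 ∈ S} = stdG n S := by
  have : {p : (Fin m → ℝ) × (Fin n → ℝ) | p.2 ∈ S} = Set.univ ×ˢ S := by ext; simp
  rw [this]; unfold muGH; rw [Measure.prod_prod]; simp

lemma muY_fst {m n : ℕ} {S : Set ((Fin m → ℝ) × (Fin n → ℝ))} : muY m n {p | p.1 ∈ S} = muGH m n S := by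
  have : {p : ((Fin m → ℝ) × (Fin n → ℝ)) × ℝ | p.1 ∈ S} = S ×ˢ Set.univ := by ext; simp
  rw [this]; unfold muY; rw [Measure.prod_prod]; simp

lemma muY_snd {m n : ℕ} {S : Set ℝ} : muY m n {p | p.2 ∈ S} = gaussianReal 0 1 S := by
  have : {p : ((Fin m → ℝ) × (Fin n → ℝ)) × ℝ | p.2 ∈ S} = Set.univ ×ˢ S := by ext; simp
  rw [this]; unfold muY; rw [Measure.prod_prod]; simp

lemma gauss1_tail {t : ℝ} (ht : 0 ≤ t) : gaussianReal 0 1 {x | t ≤ x} ≤ ENNReal.ofReal (Real.exp (-(t ^ 2 / 5))) ∧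
    gaussianReal 0 1 {x | x ≤ -t} ≤ ENNReal.ofReal (Real.exp (-(t ^ 2 / 5))) := by
  have mp := measurePreserving_eval (fun _ : Fin 1 => gaussianReal 0 1) 0
  have hl : ∀ x y : Fin 1 → ℝ, |x 0 - y 0| ≤ 1 * e2norm (x - y) := fun x y => by
    rw [one_mul]; exact abs_coord_le_e2norm (x - y) 0
  have hm : ∫ x : Fin 1 → ℝ, x 0 ∂(stdG 1) = 0 := by
    rw [integral_coord 0 (fun x => x) measurable_id]; simp
  have h1 := meas_le_of_real (gauss_conc_upper (F := fun x : Fin 1 → ℝ => x 0) one_pos hl ht)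
  have h2 := meas_le_of_real (gauss_conc_lower (F := fun x : Fin 1 → ℝ => x 0) one_pos hl ht)
  rw [hm] at h1 h2
  simp only [zero_add, zero_sub, one_pow, mul_one] at h1 h2
  have m1 : MeasurableSet {x : ℝ | t ≤ x} := measurableSet_Ici
  have m2 : MeasurableSet {x : ℝ | x ≤ -t} := measurableSet_Iic
  constructor
  · rw [← mp.measure_preimage m1.nullMeasurableSet]; exact h1
  · rw [← mp.measure_preimage m2.nullMeasurableSet]; exact h2

/-- bad event for (g, h): norm of g, lower tail of F₀ and upper tail of F₁ -/
def Bgh {m n : ℕ} (G t : ℝ) (F0 F1 : (Fin n → ℝ) → ℝ) (a0 a1 : ℝ) : Set ((Fin m → ℝ) × (Fin n → ℝ)) :=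
  ({p | e2norm p.1 ≤ G - t} ∪ {p | G + t ≤ e2norm p.1}) ∪ ({p | F0 p.2 ≤ a0} ∪ {p | a1 ≤ F1 p.2})

lemma Bgh_meas {m n : ℕ} {G t : ℝ} {F0 F1 : (Fin n → ℝ) → ℝ} {a0 a1 : ℝ} (h0 : Measurable F0) (h1 : Measurable F1) :
    MeasurableSet (Bgh (m := m) G t F0 F1 a0 a1) := by
  unfold Bgh
  refine ((measurableSet_le ?_ ?_).union (measurableSet_le ?_ ?_)).union ((measurableSet_le ?_ ?_).union (measurableSet_le ?_ ?_)) <;> fun_prop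

lemma Bgh_prob {m n : ℕ} {t : ℝ} (ht : 0 ≤ t) {F0 F1 : (Fin n → ℝ) → ℝ} {r0 r1 : ℝ} (hr0 : 0 < r0) (hr1 : 0 < r1)
    (h0 : ∀ x y, |F0 x - F0 y| ≤ r0 * e2norm (x - y)) (h1 : ∀ x y, |F1 x - F1 y| ≤ r1 * e2norm (x - y)) :
    muGH m n (Bgh (GE m) t F0 F1 (∫ x, F0 x ∂(stdG n) - t * r0) (∫ x, F1 x ∂(stdG n) + t * r1)) ≤
      4 * ENNReal.ofReal (Real.exp (-(t ^ 2 / 5))) := by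
  set q := ENNReal.ofReal (Real.exp (-(t ^ 2 / 5))) with hq
  have hl : ∀ x y : Fin m → ℝ, |e2norm x - e2norm y| ≤ 1 * e2norm (x - y) := fun x y => by
    rw [one_mul]; exact abs_e2norm_sub_le x y
  have hF0 := (continuous_of_e2lip h0).measurable
  have hF1 := (continuous_of_e2lip h1).measurable
  have a1 : muGH m n {p | e2norm p.1 ≤ GE m - t} ≤ q := by
    have := meas_le_of_real (gauss_conc_lower (F := fun x : Fin m → ℝ => e2norm x) one_pos hl ht)
    simp only [one_pow, mul_one] at this
    exact (muGH_fst (measurableSet_le measurable_e2norm measurable_const)).le.trans this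
  have a2 : muGH m n {p | GE m + t ≤ e2norm p.1} ≤ q := by
    have := meas_le_of_real (gauss_conc_upper (F := fun x : Fin m → ℝ => e2norm x) one_pos hl ht)
    simp only [one_pow, mul_one] at this
    exact (muGH_fst (measurableSet_le measurable_const measurable_e2norm)).le.trans this
  have ee : ∀ r : ℝ, 0 < r → (t * r) ^ 2 / (5 * r ^ 2) = t ^ 2 / 5 := fun r hr => by field_simp
  have a3 : muGH m n {p | F0 p.2 ≤ ∫ x, F0 x ∂(stdG n) - t * r0} ≤ q := by
    have := meas_le_of_real (gauss_conc_lower hr0 h0 (mul_nonneg ht hr0.le))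
    rw [ee r0 hr0] at this
    exact (muGH_snd (measurableSet_le hF0 measurable_const)).le.trans this
  have a4 : muGH m n {p | ∫ x, F1 x ∂(stdG n) + t * r1 ≤ F1 p.2} ≤ q := by
    have := meas_le_of_real (gauss_conc_upper hr1 h1 (mul_nonneg ht hr1.le))
    rw [ee r1 hr1] at this
    exact (muGH_snd (measurableSet_le measurable_const hF1)).le.trans this
  unfold Bgh
  calc _ ≤ (q + q) + (q + q) := by
        refine (measure_union_le _ _).trans (add_le_add ?_ ?_)
        · exact (measure_union_le _ _).trans (add_le_add a1 a2)
        · exact (measure_union_le _ _).trans (add_le_add a3 a4)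
    _ = 4 * q := by ring

def BY {m n : ℕ} (B : Set ((Fin m → ℝ) × (Fin n → ℝ))) (t : ℝ) : Set (((Fin m → ℝ) × (Fin n → ℝ)) × ℝ) :=
  {p | p.1 ∈ B} ∪ ({p | p.2 ∈ {x : ℝ | t ≤ x}} ∪ {p | p.2 ∈ {x : ℝ | x ≤ -t}})

lemma BY_prob {m n : ℕ} {B : Set ((Fin m → ℝ) × (Fin n → ℝ))} {t : ℝ} (ht : 0 ≤ t)
    (hB : muGH m n B ≤ 4 * ENNReal.ofReal (Real.exp (-(t ^ 2 / 5)))) :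
    muY m n (BY B t) ≤ 6 * ENNReal.ofReal (Real.exp (-(t ^ 2 / 5))) := by
  set q := ENNReal.ofReal (Real.exp (-(t ^ 2 / 5))) with hq
  unfold BY
  calc _ ≤ 4 * q + (q + q) := by
        refine (measure_union_le _ _).trans (add_le_add (muY_fst.le.trans hB) ?_)
        exact (measure_union_le _ _).trans (add_le_add (muY_snd.le.trans (gauss1_tail ht).1) (muY_snd.le.trans (gauss1_tail ht).2))
    _ = 6 * q := by ring

lemma sep {m n : ℕ} (hm : 0 < m) (σ : ℝ) (S1 S2 : Set (Fin n → ℝ)) (hne : S2.Nonempty) (hc : IsCompact S2) (hcv : Convex ℝ S2)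
    (c η : ℝ) (hc0 : 0 < c) (hη : 0 < η) (Bad : Set (((Fin m → ℝ) × (Fin n → ℝ)) × ℝ))
    (h : ∀ p ∉ Bad, (∀ w ∈ S1, c + η < YN σ w p) ∧ (∃ w ∈ S2, YN σ w p < c - η)) :
    muAv m n σ {ω | ¬ ((∀ w ∈ S1, c < e2norm (resid ω w)) ∧ (∃ w ∈ S2, e2norm (resid ω w) < c))} ≤ 4 * muY m n Bad := by
  have h1 := G1 (m := m) hm σ S1 c η hη
  have h2 := G2 (m := m) hm σ S2 hne hc hcv c η hc0 hη
  have s1 : {p : ((Fin m → ℝ) × (Fin n → ℝ)) × ℝ | ∃ w ∈ S1, YN σ w p ≤ c + η} ⊆ Bad := by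
    rintro p ⟨w, hw, hle⟩
    by_contra hp
    exact absurd ((h p hp).1 w hw) (not_lt.2 hle)
  have s2 : {p : ((Fin m → ℝ) × (Fin n → ℝ)) × ℝ | ∀ w ∈ S2, c - η ≤ YN σ w p} ⊆ Bad := by
    intro p hall
    by_contra hp
    obtain ⟨w, hw, hlt⟩ := (h p hp).2
    exact absurd hlt (not_lt.2 (hall w hw))
  have s3 : {ω : (Fin m → Fin n → ℝ) × (Fin m → ℝ) | ¬ ((∀ w ∈ S1, c < e2norm (resid ω w)) ∧ (∃ w ∈ S2, e2norm (resid ω w) < c))} ⊆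
      {ω | ∃ w ∈ S1, e2norm (resid ω w) ≤ c} ∪ {ω | ∀ w ∈ S2, c ≤ e2norm (resid ω w)} := by
    intro ω hω
    simp only [Set.mem_ofPred_eq, not_and_or] at hω
    rcases hω with hω | hω
    · left; push Not at hω; exact hω
    · right; push Not at hω; exact hω
  calc _ ≤ 2 * muY m n Bad + 2 * muY m n Bad := by
        refine (measure_mono s3).trans ((measure_union_le _ _).trans (add_le_add (h1.trans ?_) (h2.trans ?_)))
        · exact mul_le_mul_right (measure_mono s1) 2
        · exact mul_le_mul_right (measure_mono s2) 2
    _ = 4 * muY m n Bad := by ring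
end

section
open MeasureTheory ProbabilityTheory Filter Topology
open scoped ENNReal

lemma e2ball_convex {n : ℕ} (r : ℝ) : Convex ℝ {w : Fin n → ℝ | e2norm w ≤ r} := by
  intro x hx y hy a b ha hb hab
  simp only [Set.mem_ofPred_eq] at *
  calc e2norm (a • x + b • y) ≤ a * e2norm x + b * e2norm y := by
        refine (e2norm_add_le _ _).trans (le_of_eq ?_)
        rw [e2norm_smul, e2norm_smul, abs_of_nonneg ha, abs_of_nonneg hb]
    _ ≤ a * r + b * r := by gcongr
    _ = r := by rw [← add_mul, hab, one_mul]

lemma upper_sep {m n k : ℕ} (hm : 0 < m) (hk : 1 ≤ k) (hkn : k ≤ n) {σ ρ τ Δ R r1 : ℝ} (hσ : 0 < σ)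
    (hG : 0 < GE m) (hH : HE n k = ρ * GE m) (hρ : 0 < ρ) (hρ1 : 0 < 1 - ρ ^ 2) (hR : rs σ ρ ≤ R) (hr : 0 < rs σ ρ)
    (hr1 : rs σ ρ ≤ r1) (hr12 : r1 ≤ 2 * rs σ ρ) (hΔ : 0 < Δ) (hgap : fr σ ρ (rs σ ρ) + Δ ≤ fr σ ρ r1)
    (hτ : 0 < τ) (hτ1 : τ * (4 * R + 2 * σ) < Δ / 4)
    {T : Set (Fin n → ℝ)} (hT : IsClosed T) (hcv : Convex ℝ T) (h0 : (0 : Fin n → ℝ) ∈ T) (hTD : T ⊆ Dc n k) :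
    ∃ c : ℝ, muAv m n σ {ω | ¬ ((∀ w ∈ T ∩ {w | e2norm w = r1}, c < e2norm (resid ω w)) ∧
      (∃ w ∈ T ∩ {w | e2norm w ≤ rs σ ρ}, e2norm (resid ω w) < c))} ≤ 24 * ENNReal.ofReal (Real.exp (-((τ * GE m) ^ 2 / 5))) := by
  set G := GE m with hGdef
  set r := rs σ ρ with hrdef
  have hr1p : 0 < r1 := hr.trans_le hr1
  have hl0 := Mx_lip hT h0 hr.le
  have hl1 := Mx_lip hT h0 hr1p.le
  set E0 := ∫ x, Mx T r x ∂(stdG n) with hE0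
  set E1 := ∫ x, Mx T r1 x ∂(stdG n) with hE1
  have i0 := integrable_of_e2lip hl0
  have i1 := integrable_of_e2lip hl1
  have hE1le : E1 ≤ r1 * (ρ * G) := by
    rw [← hH, HE, ← integral_const_mul]
    exact integral_mono i1 ((integrable_Hf hk hkn).const_mul _) fun x => Mx_le_Hf hT h0 hTD hr1p.le x
  have hE0le : E0 ≤ r * (ρ * G) := by
    rw [← hH, HE, ← integral_const_mul]
    exact integral_mono i0 ((integrable_Hf hk hkn).const_mul _) fun x => Mx_le_Hf hT h0 hTD hr.le x
  have hE01 : r / r1 * E1 ≤ E0 := by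
    rw [hE1, ← integral_const_mul]
    exact integral_mono (i1.const_mul _) i0 fun x => Mx_scale hT hcv h0 hr hr1 x
  have hA0 := sqrt_add_le' hr.le hσ.le
  have hA1 := sqrt_add_le' hr1p.le hσ.le
  have hA0p := Real.sqrt_nonneg (r ^ 2 + σ ^ 2)
  have hA1p := Real.sqrt_nonneg (r1 ^ 2 + σ ^ 2)
  have hfr := fr_rs (ρ := ρ) hσ hρ1
  have hfpos : 0 < fr σ ρ r := by rw [hfr]; exact mul_pos hσ (Real.sqrt_pos.2 hρ1)
  unfold fr at hgap hfpos
  set A0 := √(r ^ 2 + σ ^ 2) with hA0d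
  set A1 := √(r1 ^ 2 + σ ^ 2) with hA1d
  -- level gap
  have hdiff : E1 - E0 ≤ (r1 - r) * (ρ * G) := by
    have e : E1 - r / r1 * E1 = (1 - r / r1) * E1 := by ring
    have e2 : (1 - r / r1) * E1 ≤ (1 - r / r1) * (r1 * (ρ * G)) := by
      refine mul_le_mul_of_nonneg_left hE1le ?_
      rw [sub_nonneg, div_le_one hr1p]; exact hr1
    have e3 : (1 - r / r1) * (r1 * (ρ * G)) = (r1 - r) * (ρ * G) := by field_simp
    linarith
  have hgapG : A0 * G - E0 + G * Δ ≤ A1 * G - E1 := by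
    have := mul_le_mul_of_nonneg_left hgap hG.le
    nlinarith
  have hτG : τ * G * (4 * R + 2 * σ) < G * Δ / 4 := by
    have := mul_lt_mul_of_pos_left hτ1 hG
    linarith
  have ht : 0 < τ * G := by positivity
  have hR1 : r1 ≤ 2 * R := by linarith
  set c := A0 * G - E0 + G * Δ / 2 with hc
  have hcpos : 0 < c := by
    have := mul_pos hG hfpos
    have : 0 < G * Δ := by positivity
    nlinarith
  set B := Bgh (m := m) G (τ * G) (Mx T r) (Mx T r1) (E0 - τ * G * r) (E1 + τ * G * r1) with hB
  have hBp : muGH m n B ≤ 4 * ENNReal.ofReal (Real.exp (-((τ * G) ^ 2 / 5))) :=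
    Bgh_prob ht.le hr hr1p hl0 hl1
  have hBY := BY_prob ht.le hBp
  refine ⟨c, (sep hm σ (T ∩ {w | e2norm w = r1}) (T ∩ {w | e2norm w ≤ r}) ⟨0, h0, by simp [e2norm_zero, hr.le]⟩ (isCompact_e2 hT r) (hcv.inter (e2ball_convex r)) c (G * Δ / 4)
    hcpos (by positivity) (BY B (τ * G)) ?_).trans ?_⟩
  · intro p hp
    simp only [BY, hB, Bgh, Set.mem_union, Set.mem_ofPred_eq, not_or, not_le] at hp
    obtain ⟨⟨⟨hg1, hg2⟩, hM0, hM1⟩, hh1, hh2⟩ := hp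
    constructor
    · rintro w ⟨hw, hwr⟩
      rw [Set.mem_ofPred_eq] at hwr
      unfold YN nrm
      rw [hwr, ← hA1d]
      have h1 := Mx_ge hT p.1.2 hw hwr.le
      have h2 : A1 * (G - τ * G) ≤ A1 * e2norm p.1.1 := by gcongr
      have h3 : σ * (-(τ * G)) ≤ σ * p.2 := by gcongr
      have h4 : τ * G * (A1 + r1 + σ) ≤ τ * G * (4 * R + 2 * σ) := mul_le_mul_of_nonneg_left (by linarith) ht.le
      ring_nf at *
      linarith
    · obtain ⟨w, hw, hwr, he⟩ := Mx_att hT h0 hr.le p.1.2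
      refine ⟨w, ⟨hw, hwr⟩, ?_⟩
      unfold YN nrm
      have hAw : √(e2norm w ^ 2 + σ ^ 2) ≤ A0 := by
        rw [hA0d]; have := e2norm_nonneg w; gcongr
      have h2 : √(e2norm w ^ 2 + σ ^ 2) * e2norm p.1.1 ≤ A0 * (G + τ * G) := by
        have := e2norm_nonneg p.1.1
        gcongr
      have h3 : σ * p.2 ≤ σ * (τ * G) := by gcongr
      have h4 : τ * G * (A0 + r + σ) ≤ τ * G * (4 * R + 2 * σ) := mul_le_mul_of_nonneg_left (by linarith) ht.le
      ring_nf at *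
      linarith
  · calc 4 * muY m n (BY B (τ * G)) ≤ 4 * (6 * ENNReal.ofReal (Real.exp (-((τ * G) ^ 2 / 5)))) := mul_le_mul_right hBY 4
      _ = _ := by ring

lemma lower_sep {m n k : ℕ} (hm : 0 < m) (hk : 1 ≤ k) (hkn : k ≤ n) {σ ρ τ Δ R r2 : ℝ} (hσ : 0 < σ)
    (hG : 0 < GE m) (hH : HE n k = ρ * GE m) (hρ : 0 < ρ) (hρ1 : 0 < 1 - ρ ^ 2) (hR : rs σ ρ ≤ R) (hr : 0 < rs σ ρ)
    (hr2 : r2 ≤ rs σ ρ) (hΔ : 0 < Δ) (hgap : ∀ r, 0 ≤ r → r ≤ r2 → fr σ ρ (rs σ ρ) + Δ ≤ fr σ ρ r)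
    (hτ : 0 < τ) (hτ1 : τ * (4 * R + 2 * σ) < Δ / 4) :
    ∃ c : ℝ, muAv m n σ {ω | ¬ ((∀ w ∈ Dc n k ∩ {w | e2norm w ≤ r2}, c < e2norm (resid ω w)) ∧
      (∃ w ∈ Dc n k ∩ {w | e2norm w ≤ rs σ ρ}, e2norm (resid ω w) < c))} ≤ 24 * ENNReal.ofReal (Real.exp (-((τ * GE m) ^ 2 / 5))) := by
  set G := GE m with hGdef
  set r := rs σ ρ with hrdef
  have hl := Hf_lip hk hkn
  have hA0 := sqrt_add_le' hr.le hσ.le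
  have hA0p := Real.sqrt_nonneg (r ^ 2 + σ ^ 2)
  have hfr := fr_rs (ρ := ρ) hσ hρ1
  have hfpos : 0 < fr σ ρ r := by rw [hfr]; exact mul_pos hσ (Real.sqrt_pos.2 hρ1)
  have hτG : τ * G * (4 * R + 2 * σ) < G * Δ / 4 := by
    have := mul_lt_mul_of_pos_left hτ1 hG
    linarith
  have ht : 0 < τ * G := by positivity
  set c := G * fr σ ρ r + G * Δ / 2 with hc
  have hcpos : 0 < c := by positivity
  set B := Bgh (m := m) G (τ * G) (Hf n k) (Hf n k) (HE n k - τ * G * 1) (HE n k + τ * G * 1) with hB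
  have hBp : muGH m n B ≤ 4 * ENNReal.ofReal (Real.exp (-((τ * G) ^ 2 / 5))) :=
    Bgh_prob ht.le one_pos one_pos hl hl
  have hBY := BY_prob ht.le hBp
  refine ⟨c, (sep hm σ (Dc n k ∩ {w | e2norm w ≤ r2}) (Dc n k ∩ {w | e2norm w ≤ r}) ⟨0, Dc_zero n k, by simp [e2norm_zero, hr.le]⟩ (isCompact_e2 (Dc_closed n k) r)
    ((Dc_convex n k).inter (e2ball_convex r)) c (G * Δ / 4)
    hcpos (by positivity) (BY B (τ * G)) ?_).trans ?_⟩
  · intro p hp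
    simp only [BY, hB, Bgh, Set.mem_union, Set.mem_ofPred_eq, not_or, not_le] at hp
    obtain ⟨⟨⟨hg1, hg2⟩, hM0, hM1⟩, hh1, hh2⟩ := hp
    rw [hH] at hM0 hM1
    constructor
    · rintro w ⟨hw, hwr⟩
      rw [Set.mem_ofPred_eq] at hwr
      have hw0 := e2norm_nonneg w
      have h5 := hgap _ hw0 hwr
      have h1 := Hf_weak p.1.2 hw
      unfold YN nrm
      set s := e2norm w
      have hA := sqrt_add_le' hw0 hσ.le
      have hAp := Real.sqrt_nonneg (s ^ 2 + σ ^ 2)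
      have h5' := mul_le_mul_of_nonneg_left h5 hG.le
      have h6 : G * fr σ ρ s = √(s ^ 2 + σ ^ 2) * G - ρ * s * G := by unfold fr; ring
      set A := √(s ^ 2 + σ ^ 2)
      have h2 : A * (G - τ * G) ≤ A * e2norm p.1.1 := by gcongr
      have h3 : σ * (-(τ * G)) ≤ σ * p.2 := by gcongr
      have h4 : τ * G * (A + s + σ) ≤ τ * G * (4 * R + 2 * σ) := mul_le_mul_of_nonneg_left (by linarith) ht.le
      have h7 : Hf n k p.1.2 * s ≤ (ρ * G + τ * G * 1) * s := by gcongr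
      ring_nf at *
      linarith
    · obtain ⟨w, hw, hwr, he⟩ := Hf_strong hk hkn p.1.2
      have hwn : e2norm (r • w) ≤ r := by
        rw [e2norm_smul, abs_of_pos hr]
        calc r * e2norm w ≤ r * 1 := by gcongr
          _ = r := mul_one r
      refine ⟨r • w, ⟨Dc_smul hw hr.le, hwn⟩, ?_⟩
      unfold YN nrm
      have h6 : G * fr σ ρ r = √(r ^ 2 + σ ^ 2) * G - ρ * r * G := by unfold fr; ring
      have hAw : √(e2norm (r • w) ^ 2 + σ ^ 2) ≤ √(r ^ 2 + σ ^ 2) := by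
        have := e2norm_nonneg (r • w); gcongr
      set A0 := √(r ^ 2 + σ ^ 2) with hA0d
      have h2 : √(e2norm (r • w) ^ 2 + σ ^ 2) * e2norm p.1.1 ≤ A0 * (G + τ * G) := by
        have := e2norm_nonneg p.1.1
        gcongr
      have h3 : σ * p.2 ≤ σ * (τ * G) := by gcongr
      have h4 : τ * G * (A0 + r + σ) ≤ τ * G * (4 * R + 2 * σ) := mul_le_mul_of_nonneg_left (by linarith) ht.le
      have h8 : ∑ j, p.1.2 j * (r • w) j = - (r * Hf n k p.1.2) := by
        rw [← he, mul_neg, neg_neg, Finset.mul_sum]; refine Finset.sum_congr rfl fun i _ => ?_; simp; ring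
      have h9 : r * (ρ * G - τ * G * 1) ≤ r * Hf n k p.1.2 := by gcongr
      rw [h8]
      ring_nf at *
      linarith
  · calc 4 * muY m n (BY B (τ * G)) ≤ 4 * (6 * ENNReal.ofReal (Real.exp (-((τ * G) ^ 2 / 5)))) := mul_le_mul_right hBY 4
      _ = _ := by ring
end

section
open MeasureTheory ProbabilityTheory Filter Topology
open scoped ENNReal

def Tx {n : ℕ} (xt : Fin n → ℝ) : Set (Fin n → ℝ) := {w | l1norm (xt + w) ≤ l1norm xt}

lemma l1_cont {n : ℕ} : Continuous (l1norm : (Fin n → ℝ) → ℝ) := by unfold l1norm; fun_prop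

lemma Tx_zero {n : ℕ} (xt : Fin n → ℝ) : (0 : Fin n → ℝ) ∈ Tx xt := by simp [Tx]

lemma Tx_closed {n : ℕ} (xt : Fin n → ℝ) : IsClosed (Tx xt) :=
  isClosed_le (l1_cont.comp (by fun_prop)) continuous_const

lemma l1_convex_comb {n : ℕ} (x y : Fin n → ℝ) {a b : ℝ} (ha : 0 ≤ a) (hb : 0 ≤ b) :
    l1norm (a • x + b • y) ≤ a * l1norm x + b * l1norm y := by
  unfold l1norm
  rw [Finset.mul_sum, Finset.mul_sum, ← Finset.sum_add_distrib]
  refine Finset.sum_le_sum fun i _ => ?_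
  simp only [Pi.add_apply, Pi.smul_apply, smul_eq_mul]
  refine (abs_add_le _ _).trans (le_of_eq ?_)
  rw [abs_mul, abs_mul, abs_of_nonneg ha, abs_of_nonneg hb]

lemma Tx_convex {n : ℕ} (xt : Fin n → ℝ) : Convex ℝ (Tx xt) := by
  intro x hx y hy a b ha hb hab
  simp only [Tx, Set.mem_ofPred_eq] at *
  have e : xt + (a • x + b • y) = a • (xt + x) + b • (xt + y) := by
    have : xt = (a + b) • xt := by rw [hab, one_smul]
    nth_rewrite 1 [this]; module
  rw [e]
  refine (l1_convex_comb _ _ ha hb).trans ?_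
  calc a * l1norm (xt + x) + b * l1norm (xt + y) ≤ a * l1norm xt + b * l1norm xt := by gcongr
    _ = l1norm xt := by rw [← add_mul, hab, one_mul]

lemma Tx_bdd {n : ℕ} (xt : Fin n → ℝ) {w : Fin n → ℝ} (hw : w ∈ Tx xt) : e2norm w ≤ 2 * l1norm xt := by
  simp only [Tx, Set.mem_ofPred_eq] at hw
  refine (e2norm_le_sum_abs w).trans ?_
  have : ∑ i, |w i| ≤ l1norm (xt + w) + l1norm xt := by
    unfold l1norm
    rw [← Finset.sum_add_distrib]
    refine Finset.sum_le_sum fun i _ => ?_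
    have := abs_sub (xt i + w i) (xt i)
    simpa using this
  linarith

lemma Tx_compact {n : ℕ} (xt : Fin n → ℝ) : IsCompact (Tx xt) := by
  have := isCompact_e2 (Tx_closed xt) (2 * l1norm xt)
  have e : Tx xt ⊆ {w | e2norm w ≤ 2 * l1norm xt} := fun w hw => Tx_bdd xt hw
  rwa [Set.inter_eq_left.2 e] at this

lemma Tx_sub {n k : ℕ} {xt : Fin n → ℝ} (hx : kSparseNonneg n k xt) : Tx xt ⊆ Dc n k := by
  intro w hw
  simp only [Tx, Dc, dfun, l1norm, Set.mem_ofPred_eq] at *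
  have : ∑ i : Fin n, (if (i : ℕ) < n - k then |w i| else w i) ≤ ∑ i, (|(xt + w) i| - |xt i|) := by
    refine Finset.sum_le_sum fun i _ => ?_
    split_ifs with h
    · simp [hx.1 i h]
    · rw [abs_of_nonneg (hx.2 i)]
      have := le_abs_self (xt i + w i)
      simp only [Pi.add_apply]; linarith
  rw [Finset.sum_sub_distrib] at this
  linarith

noncomputable def xbig (n k : ℕ) (Bc : ℝ) : Fin n → ℝ := fun i => if (i : ℕ) < n - k then 0 else Bc

lemma xbig_sparse (n k : ℕ) {Bc : ℝ} (h : 0 ≤ Bc) : kSparseNonneg n k (xbig n k Bc) := by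
  constructor
  · intro i hi; simp [xbig, hi]
  · intro i; unfold xbig; split_ifs <;> simp [h]

lemma xbig_sub (n k : ℕ) {Bc : ℝ} {w : Fin n → ℝ} (hw : w ∈ Dc n k) (h : e2norm w ≤ Bc) : w ∈ Tx (xbig n k Bc) := by
  simp only [Tx, Dc, dfun, l1norm, Set.mem_ofPred_eq] at *
  have hB : 0 ≤ Bc := (e2norm_nonneg w).trans h
  have : ∑ i, (|(xbig n k Bc + w) i| - |xbig n k Bc i|) ≤ ∑ i : Fin n, (if (i : ℕ) < n - k then |w i| else w i) := by
    refine Finset.sum_le_sum fun i _ => ?_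
    have h1 := abs_coord_le_e2norm w i
    simp only [Pi.add_apply, xbig]
    split_ifs with hi
    · simp
    · rw [abs_of_nonneg hB, abs_of_nonneg (by linarith [(abs_le.1 h1).1])]; linarith
  rw [Finset.sum_sub_distrib] at this
  linarith

section
variable {m n : ℕ} {xt : Fin n → ℝ} {ω : (Fin m → Fin n → ℝ) × (Fin m → ℝ)}

lemma mem_Tx_iff {xh : Fin n → ℝ} : xh - xt ∈ Tx xt ↔ l1norm xh ≤ l1norm xt := by
  simp [Tx]

lemma zeta_bdd : BddBelow {r : ℝ | ∃ x : Fin n → ℝ, l1norm x ≤ l1norm xt ∧ r = lassoVal m n xt ω x} :=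
  ⟨0, by rintro r ⟨x, _, rfl⟩; exact e2norm_nonneg _⟩

lemma min_le {xh : Fin n → ℝ} (he : lassoVal m n xt ω xh = zetaObj m n xt ω) {w : Fin n → ℝ} (hw : w ∈ Tx xt) :
    e2norm (resid ω (xh - xt)) ≤ e2norm (resid ω w) := by
  rw [← lassoVal_eq, he]
  refine csInf_le zeta_bdd ⟨xt + w, hw, ?_⟩
  rw [lassoVal_eq]; simp

lemma min_exists : ∃ xh : Fin n → ℝ, l1norm xh ≤ l1norm xt ∧ lassoVal m n xt ω xh = zetaObj m n xt ω := by
  obtain ⟨w0, hw0, hmin⟩ := (Tx_compact xt).exists_isMinOn ⟨0, Tx_zero xt⟩ (continuous_e2norm.comp (continuous_resid ω)).continuousOn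
  refine ⟨xt + w0, hw0, le_antisymm (le_csInf ⟨_, xt, le_rfl, rfl⟩ ?_) (csInf_le zeta_bdd ⟨xt + w0, hw0, rfl⟩)⟩
  rintro r ⟨x, hx, rfl⟩
  rw [lassoVal_eq, lassoVal_eq, add_sub_cancel_left]
  exact hmin (mem_Tx_iff.2 hx)

lemma resid_comb (x y : Fin n → ℝ) {a b : ℝ} (ha : 0 ≤ a) (hb : 0 ≤ b) (hab : a + b = 1) :
    e2norm (resid ω (a • x + b • y)) ≤ a * e2norm (resid ω x) + b * e2norm (resid ω y) := by
  have : resid ω (a • x + b • y) = a • resid ω x + b • resid ω y := by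
    funext i
    simp only [resid, Pi.add_apply, Pi.smul_apply, smul_eq_mul]
    have e : ∑ j, ω.1 i j * (a * x j + b * y j) = a * (∑ j, ω.1 i j * x j) + b * ∑ j, ω.1 i j * y j := by
      rw [Finset.mul_sum, Finset.mul_sum, ← Finset.sum_add_distrib]
      exact Finset.sum_congr rfl fun j _ => by ring
    rw [e]
    have : ω.2 i = (a + b) * ω.2 i := by rw [hab, one_mul]
    nth_rewrite 1 [this]; ring
  rw [this]
  refine (e2norm_add_le _ _).trans (le_of_eq ?_)
  rw [e2norm_smul, e2norm_smul, abs_of_nonneg ha, abs_of_nonneg hb]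

lemma det_upper {c r r1 : ℝ} (hr : r ≤ r1)
    (h1 : ∀ w ∈ Tx xt ∩ {w | e2norm w = r1}, c < e2norm (resid ω w))
    (h2 : ∃ w ∈ Tx xt ∩ {w | e2norm w ≤ r}, e2norm (resid ω w) < c) {xh : Fin n → ℝ} (hx : l1norm xh ≤ l1norm xt)
    (he : lassoVal m n xt ω xh = zetaObj m n xt ω) : e2norm (xh - xt) ≤ r1 := by
  by_contra hcon
  push Not at hcon
  obtain ⟨w0, ⟨hw0, hw0r⟩, hlt⟩ := h2
  have hwm := mem_Tx_iff.2 hx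
  have hle := min_le he hw0
  set w := xh - xt
  have hc : ContinuousOn (fun t : ℝ => e2norm ((1 - t) • w0 + t • w)) (Set.Icc 0 1) :=
    (continuous_e2norm.comp (by fun_prop)).continuousOn
  have hiv := intermediate_value_Icc (zero_le_one) hc
  obtain ⟨t, ht, hte⟩ := hiv (show r1 ∈ Set.Icc _ _ by
    simp only [sub_zero, one_smul, zero_smul, add_zero, sub_self, zero_add]
    exact ⟨le_trans hw0r hr, hcon.le⟩)
  have hmem : (1 - t) • w0 + t • w ∈ Tx xt := Tx_convex xt hw0 hwm (by linarith [ht.2]) ht.1 (by ring)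
  have h3 := h1 _ ⟨hmem, hte⟩
  have h4 := resid_comb (ω := ω) w0 w (a := 1 - t) (b := t) (by linarith [ht.2]) ht.1 (by ring)
  have h5 : t * e2norm (resid ω w) ≤ t * e2norm (resid ω w0) := mul_le_mul_of_nonneg_left hle ht.1
  linarith

lemma det_lower {k : ℕ} {c r r2 Bc : ℝ} (hr : r ≤ Bc) (hB : 0 ≤ Bc)
    (h1 : ∀ w ∈ Dc n k ∩ {w | e2norm w ≤ r2}, c < e2norm (resid ω w))
    (h2 : ∃ w ∈ Dc n k ∩ {w | e2norm w ≤ r}, e2norm (resid ω w) < c) {xh : Fin n → ℝ} (hx : l1norm xh ≤ l1norm (xbig n k Bc))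
    (he : lassoVal m n (xbig n k Bc) ω xh = zetaObj m n (xbig n k Bc) ω) : r2 ≤ e2norm (xh - xbig n k Bc) := by
  by_contra hcon
  push Not at hcon
  obtain ⟨w0, ⟨hw0, hw0r⟩, hlt⟩ := h2
  have hwm := mem_Tx_iff.2 hx
  have hle := min_le he (xbig_sub n k hw0 (le_trans hw0r hr))
  have := h1 _ ⟨Tx_sub (xbig_sparse n k hB) hwm, hcon.le⟩
  linarith
end

lemma prob_compl {Ω : Type*} [MeasurableSpace Ω] (μ : Measure Ω) [IsProbabilityMeasure μ] {good bad : Set Ω} {b : ℝ} (hb : 0 ≤ b)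
    (h : goodᶜ ⊆ bad) (hbad : μ bad ≤ ENNReal.ofReal b) : μ good ≥ ENNReal.ofReal (1 - b) := by
  have h1 : (1 : ℝ≥0∞) ≤ μ good + ENNReal.ofReal b := by
    calc (1 : ℝ≥0∞) = μ Set.univ := measure_univ.symm
      _ ≤ μ (good ∪ bad) := measure_mono fun x _ => by
          by_cases hx : x ∈ good
          · exact Or.inl hx
          · exact Or.inr (h hx)
      _ ≤ μ good + μ bad := measure_union_le _ _
      _ ≤ _ := by gcongr
  rw [ge_iff_le, ENNReal.ofReal_sub _ hb, ENNReal.ofReal_one]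
  exact tsub_le_iff_right.2 h1
end

section
open MeasureTheory ProbabilityTheory Filter Topology
open scoped ENNReal

lemma ev_exp {c : ℝ} (hc : 0 < c) : Tendsto (fun n : ℕ => Real.exp (-(c * n))) atTop (𝓝 0) := by
  have h : Tendsto (fun n : ℕ => c * (n : ℝ)) atTop atTop := tendsto_natCast_atTop_atTop.const_mul_atTop hc
  exact Real.tendsto_exp_neg_atTop_nhds_zero.comp h

lemma ev_pow_exp {c : ℝ} (hc : 0 < c) : Tendsto (fun n : ℕ => (n : ℝ) ^ 4 * (4 * Real.exp (-(c * n)))) atTop (𝓝 0) := by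
  have h : Tendsto (fun n : ℕ => c * (n : ℝ)) atTop atTop := tendsto_natCast_atTop_atTop.const_mul_atTop hc
  have h2 := ((Real.tendsto_pow_mul_exp_neg_atTop_nhds_zero 4).comp h).const_mul (4 / c ^ 4)
  rw [mul_zero] at h2
  refine h2.congr fun n => ?_
  simp only [Function.comp]
  field_simp

lemma ev_inv (C : ℝ) : Tendsto (fun n : ℕ => 2 * C / (n : ℝ)) atTop (𝓝 0) :=
  tendsto_const_div_atTop_nhds_zero_nat _

lemma Ew_bound {σ : ℝ} (hσ : 0 < σ) : ∃ C : ℝ, 0 < C ∧ ∀ {ρ0 δ ε τ : ℝ}, 0 < ρ0 → 0 < δ → 0 < ε → ε < 1 → 0 < τ →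
    τ ≤ ρ0 * ε / 4 → τ ≤ δ * ε / 8 → ∀ {m n k : ℕ} {ρ b : ℝ}, 2 ≤ m → 1 ≤ k → k ≤ n → 0 < GE m → HE n k = ρ * GE m →
    ρ0 ≤ ρ → ρ ≤ 1 - δ → 0 ≤ rs σ ρ → 4 * Real.exp (-((τ * GE m) ^ 2 / 5)) ≤ b →
    (1 - ε) * rs σ ρ * (1 - b) ≤ ∫ p, wgen m n k σ p ∂(muGH m n) ∧
    ∫ p, wgen m n k σ p ∂(muGH m n) ≤ (1 + ε) * rs σ ρ + 2 * C / n + (n : ℝ) ^ 4 * b := by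
  obtain ⟨C, hC, h⟩ := wgen_integral hσ
  refine ⟨C, hC, ?_⟩
  intro ρ0 δ ε τ hρ0 hδ hε hε1 hτ hτ1 hτ2 m n k ρ b hm hk hkn hG hH h0 h1 hrs hb
  have hl := Hf_lip hk hkn
  have ht : 0 < τ * GE m := by positivity
  have hn : (1 : ℝ) ≤ n := by exact_mod_cast hk.trans hkn
  have hBp : muGH m n (Bgh (m := m) (GE m) (τ * GE m) (Hf n k) (Hf n k) (HE n k - τ * GE m * 1) (HE n k + τ * GE m * 1)) ≤ 4 * ENNReal.ofReal (Real.exp (-((τ * GE m) ^ 2 / 5))) :=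
    Bgh_prob ht.le one_pos one_pos hl hl
  set B := Bgh (m := m) (GE m) (τ * GE m) (Hf n k) (Hf n k) (HE n k - τ * GE m * 1) (HE n k + τ * GE m * 1) with hB
  have hBr : (muGH m n).real B ≤ b := by
    refine le_trans ?_ hb
    have := ENNReal.toReal_mono (by finiteness) hBp
    rwa [ENNReal.toReal_mul, ENNReal.toReal_ofReal (Real.exp_pos _).le] at this
  have := h m n k hm hk hkn B ((1 - ε) * rs σ ρ) ((1 + ε) * rs σ ρ) ((n : ℝ) ^ 2)⁻¹ b
    (Bgh_meas (measurable_Hf hk hkn) (measurable_Hf hk hkn)) (mul_nonneg (by linarith) hrs) (mul_nonneg (by linarith) hrs) (by positivity) hBr ?_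
  · refine ⟨this.1, this.2.trans ?_⟩
    have e1 : ((((n : ℝ) ^ 2)⁻¹) ^ 2)⁻¹ = (n : ℝ) ^ 4 := by rw [inv_pow, inv_inv]; ring
    have e2 : ((n : ℝ) ^ 2)⁻¹ * (C * (1 + n)) ≤ 2 * C / n := by
      rw [inv_mul_eq_div, div_le_div_iff₀ (by positivity) (by positivity)]
      have h3 : C * n * (1 + n) ≤ C * n * (2 * n) := by
        have : 0 < C * n := by positivity
        exact mul_le_mul_of_nonneg_left (by linarith) this.le
      nlinarith
    rw [e1]; linarith
  · intro p hp
    simp only [hB, Bgh, Set.mem_union, Set.mem_ofPred_eq, not_or, not_le] at hp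
    obtain ⟨⟨hg1, hg2⟩, hM0, hM1⟩ := hp
    rw [hH, mul_one] at hM0 hM1
    unfold wgen
    rw [HgenFun_eq]
    exact w_bound hσ hρ0 hδ hε hε1 hτ.le hτ1 hτ2 h0 h1 hG hg1.le hg2.le hM0.le hM1.le (Hf_nonneg _)

lemma ceil_le_self {a : ℝ} (ha : a ∈ Set.Ioo (0 : ℝ) 1) (n : ℕ) : ⌈a * (n : ℝ)⌉₊ ≤ n := by
  rw [Nat.ceil_le]
  have : (0 : ℝ) ≤ n := by positivity
  nlinarith [ha.2]

theorem lasso_aux (σ α β : ℝ) (hσ : 0 < σ)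
    (hα : α ∈ Set.Ioo (0 : ℝ) 1) (hβ : β ∈ Set.Ioo (0 : ℝ) 1)
    (hi : ∃ δ > (0 : ℝ), ∃ N₀ : ℕ, ∀ n ≥ N₀, HE n (kDim β n) ≤ (1 - δ) * GE (mDim α n)) (ε : ℝ) (hε : ε ∈ Set.Ioo (0 : ℝ) 1) :
    ∃ c > (0 : ℝ), ∃ N : ℕ, ∀ n ≥ N, ∃ r > (0 : ℝ),
      r * (1 - ε / 4) ≤ ∫ p, wgen (mDim α n) n (kDim β n) σ p ∂(muGH (mDim α n) n) ∧
      ∫ p, wgen (mDim α n) n (kDim β n) σ p ∂(muGH (mDim α n) n) ≤ r * (1 + ε / 4) ∧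
      (∀ xt : Fin n → ℝ, kSparseNonneg n (kDim β n) xt → ∃ bad, muAv (mDim α n) n σ bad ≤ ENNReal.ofReal (Real.exp (-(c * n)) / 2) ∧
        ∀ ω ∉ bad, ∀ xh, l1norm xh ≤ l1norm xt → lassoVal (mDim α n) n xt ω xh = zetaObj (mDim α n) n xt ω →
          e2norm (xh - xt) ≤ r * (1 + ε / 4)) ∧
      (∃ bad, muAv (mDim α n) n σ bad ≤ ENNReal.ofReal (Real.exp (-(c * n)) / 2) ∧
        ∀ ω ∉ bad, ∀ xh, l1norm xh ≤ l1norm (xbig n (kDim β n) r) →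
          lassoVal (mDim α n) n (xbig n (kDim β n) r) ω xh = zetaObj (mDim α n) n (xbig n (kDim β n) r) ω →
          r * (1 - ε / 4) ≤ e2norm (xh - xbig n (kDim β n) r)) := by
  obtain ⟨δ₀, hδ₀, N₀, hi⟩ := hi
  obtain ⟨hε0, hε1⟩ := hε
  set δ := min δ₀ (1 / 2) with hδd
  have hδ : 0 < δ := by positivity
  have hk0 := kap_pos
  set ρ0 := kap * √β with hρ0d
  have hρ0 : 0 < ρ0 := mul_pos hk0 (Real.sqrt_pos.2 hβ.1)
  obtain ⟨Δ, hΔ, R, hR, hgap⟩ := gap_unif (ε := ε / 4) hσ hρ0 hδ (by positivity)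
  obtain ⟨C, hC, hEw⟩ := Ew_bound hσ
  obtain ⟨τ, hτ, hτ1, hτ2, hτ3⟩ : ∃ τ > 0, τ ≤ ρ0 * (ε / 8) / 4 ∧ τ ≤ δ * (ε / 8) / 8 ∧ τ * (4 * R + 2 * σ) < Δ / 4 := by
    refine ⟨min (ρ0 * (ε / 8) / 4) (min (δ * (ε / 8) / 8) (Δ / 5 / (4 * R + 2 * σ))), by positivity, min_le_left _ _,
      (min_le_right _ _).trans (min_le_left _ _), ?_⟩
    have hp : 0 < 4 * R + 2 * σ := by positivity
    calc _ ≤ Δ / 5 / (4 * R + 2 * σ) * (4 * R + 2 * σ) :=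
          mul_le_mul_of_nonneg_right ((min_le_right _ _).trans (min_le_right _ _)) hp.le
      _ = Δ / 5 := by field_simp
      _ < Δ / 4 := by linarith
  set c := (τ * kap) ^ 2 * α / 5 with hcd
  have hα0 := hα.1
  have hc : 0 < c := by positivity
  have hθ : 0 < σ * ρ0 * (ε / 16) := by positivity
  have ev : ∀ᶠ n : ℕ in atTop, N₀ ≤ n ∧ 1 < α * n ∧ 1 ≤ n ∧ 4 * Real.exp (-(c * n)) ≤ ε / 8 ∧
      2 * C / (n : ℝ) ≤ σ * ρ0 * (ε / 16) ∧ (n : ℝ) ^ 4 * (4 * Real.exp (-(c * n))) ≤ σ * ρ0 * (ε / 16) ∧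
      Real.exp (-(c / 2 * n)) ≤ 1 / 48 := by
    have e1 := (ev_exp hc).eventually (eventually_le_nhds (show (0 : ℝ) < ε / 32 by positivity))
    have e2 := (ev_exp (half_pos hc)).eventually (eventually_le_nhds (show (0 : ℝ) < 1 / 48 by positivity))
    have e3 := (ev_pow_exp hc).eventually (eventually_le_nhds hθ)
    have e4 := (ev_inv C).eventually (eventually_le_nhds hθ)
    have e5 := ((tendsto_natCast_atTop_atTop (R := ℝ)).const_mul_atTop hα0).eventually (eventually_gt_atTop 1)
    filter_upwards [e1, e2, e3, e4, e5, eventually_ge_atTop N₀, eventually_ge_atTop 1] with n h1 h2 h3 h4 h5 h6 h7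
    exact ⟨h6, h5, h7, by linarith, h4, h3, h2⟩
  obtain ⟨N, hN⟩ := eventually_atTop.1 ev
  refine ⟨c / 2, half_pos hc, N, fun n hn => ?_⟩
  obtain ⟨n0, n1, n2, n3, n4, n5, n6⟩ := hN n hn
  have hi' := hi n n0
  have hm2 : 2 ≤ mDim α n := by unfold mDim; exact Nat.lt_ceil.2 (by exact_mod_cast n1)
  have hmn : mDim α n ≤ n := ceil_le_self hα n
  have hkn : kDim β n ≤ n := ceil_le_self hβ n
  have hnpos : (0 : ℝ) < n := by exact_mod_cast n2
  have hk1 : 1 ≤ kDim β n := by unfold kDim; exact Nat.ceil_pos.2 (mul_pos hβ.1 hnpos)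
  have hmge : α * n ≤ (mDim α n : ℝ) := Nat.le_ceil _
  have hkge : β * n ≤ (kDim β n : ℝ) := Nat.le_ceil _
  have hmnR : (mDim α n : ℝ) ≤ n := by exact_mod_cast hmn
  have hGle := GE_le (mDim α n)
  have hGge := GE_ge (mDim α n)
  have hHge := HE_ge hk1 hkn
  set m := mDim α n
  set k := kDim β n
  have hmpos : (0 : ℝ) < m := by positivity
  have hG : 0 < GE m := (mul_pos hk0 (Real.sqrt_pos.2 hmpos)).trans_le hGge
  set ρ := HE n k / GE m with hρd
  have hH : HE n k = ρ * GE m := by rw [hρd, div_mul_cancel₀ _ hG.ne']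
  have hρ1 : ρ ≤ 1 - δ := by
    rw [hρd, div_le_iff₀ hG]
    refine hi'.trans (mul_le_mul_of_nonneg_right ?_ hG.le)
    linarith [min_le_left δ₀ (1 / 2)]
  have hρge : ρ0 ≤ ρ := by
    rw [hρd, le_div_iff₀ hG]
    calc ρ0 * GE m ≤ ρ0 * √n := mul_le_mul_of_nonneg_left (hGle.trans (Real.sqrt_le_sqrt hmnR)) hρ0.le
      _ = kap * √(β * n) := by rw [Real.sqrt_mul hβ.1.le, hρ0d]; ring
      _ ≤ kap * √k := mul_le_mul_of_nonneg_left (Real.sqrt_le_sqrt hkge) hk0.le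
      _ ≤ HE n k := hHge
  have hρ : 0 < ρ := hρ0.trans_le hρge
  obtain ⟨hrR, hrge, hgap'⟩ := hgap ρ hρge hρ1
  have hr : 0 < rs σ ρ := (mul_pos hσ hρ0).trans_le hrge
  obtain ⟨hc1, -⟩ := c_bounds hρ hδ hρ1
  have hexp : c * n ≤ (τ * GE m) ^ 2 / 5 := by
    have h1 : τ * (kap * √(α * n)) ≤ τ * GE m := by
      refine mul_le_mul_of_nonneg_left (le_trans ?_ hGge) hτ.le
      exact mul_le_mul_of_nonneg_left (Real.sqrt_le_sqrt hmge) hk0.le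
    have h2 := pow_le_pow_left₀ (by positivity) h1 2
    have h3 : (τ * (kap * √(α * n))) ^ 2 = 5 * (c * n) := by
      rw [← mul_assoc, mul_pow, Real.sq_sqrt (by positivity), hcd]; ring
    linarith
  have hexp2 : Real.exp (-((τ * GE m) ^ 2 / 5)) ≤ Real.exp (-(c * n)) := Real.exp_le_exp.2 (by linarith)
  have hq : 24 * ENNReal.ofReal (Real.exp (-((τ * GE m) ^ 2 / 5))) ≤ ENNReal.ofReal (Real.exp (-(c / 2 * n)) / 2) := by
    have : (24 : ℝ≥0∞) = ENNReal.ofReal 24 := by simp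
    rw [this, ← ENNReal.ofReal_mul (by norm_num)]
    refine ENNReal.ofReal_le_ofReal ?_
    have h1 : Real.exp (-(c * n)) = Real.exp (-(c / 2 * n)) * Real.exp (-(c / 2 * n)) := by rw [← Real.exp_add]; congr 1; ring
    have h2 := Real.exp_pos (-(c / 2 * n))
    have h3 := mul_le_mul_of_nonneg_left n6 h2.le
    linarith
  obtain ⟨w1, w2⟩ := hEw hρ0 hδ (show (0 : ℝ) < ε / 8 by positivity) (by linarith) hτ hτ1 hτ2 hm2 hk1 hkn hG hH hρge hρ1 hr.le
    (show 4 * Real.exp (-((τ * GE m) ^ 2 / 5)) ≤ 4 * Real.exp (-(c * n)) by linarith)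
  refine ⟨rs σ ρ, hr, ?_, ?_, ?_, ?_⟩
  · refine le_trans ?_ w1
    have h1 : (1 - ε / 8) * rs σ ρ * (1 - ε / 8) ≤ (1 - ε / 8) * rs σ ρ * (1 - 4 * Real.exp (-(c * n))) :=
      mul_le_mul_of_nonneg_left (by linarith) (mul_nonneg (by linarith) hr.le)
    refine le_trans ?_ h1
    have : 0 ≤ rs σ ρ * (ε / 8) ^ 2 := by positivity
    linarith
  · have h1 : σ * ρ0 * (ε / 16) ≤ rs σ ρ * (ε / 16) := mul_le_mul_of_nonneg_right hrge (by positivity)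
    linarith
  · intro xt hxt
    have hr1 : rs σ ρ ≤ rs σ ρ * (1 + ε / 4) := le_mul_of_one_le_right hr.le (by linarith)
    have hr12 : rs σ ρ * (1 + ε / 4) ≤ 2 * rs σ ρ := by
      rw [mul_comm]; exact mul_le_mul_of_nonneg_right (by linarith) hr.le
    obtain ⟨c', hc'⟩ := upper_sep (m := m) (by omega) hk1 hkn hσ hG hH hρ hc1 hrR hr hr1 hr12 hΔ
      (hgap' _ (by linarith) hr12 (by
        have e : rs σ ρ * (1 + ε / 4) - rs σ ρ = ε / 4 * rs σ ρ := by ring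
        rw [e]; exact le_abs_self _)) hτ hτ3 (Tx_closed xt) (Tx_convex xt) (Tx_zero xt) (Tx_sub hxt)
    refine ⟨_, hc'.trans hq, fun ω hω xh hx he => ?_⟩
    simp only [Set.mem_ofPred_eq, not_not] at hω
    exact det_upper hr1 hω.1 hω.2 hx he
  · obtain ⟨c', hc'⟩ := lower_sep (m := m) (r2 := rs σ ρ * (1 - ε / 4)) (by omega) hk1 hkn hσ hG hH hρ hc1 hrR hr
      (mul_le_of_le_one_right hr.le (by linarith)) hΔ
      (fun r h0 h1 => by
        have e : rs σ ρ * (1 - ε / 4) = rs σ ρ - ε / 4 * rs σ ρ := by ring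
        have e2 : 0 ≤ ε / 4 * rs σ ρ := by positivity
        refine hgap' r h0 (by linarith) ?_
        rw [abs_sub_comm]
        refine le_trans ?_ (le_abs_self _)
        linarith) hτ hτ3
    refine ⟨_, hc'.trans hq, fun ω hω xh hx he => ?_⟩
    simp only [Set.mem_ofPred_eq, not_not] at hω
    exact det_lower le_rfl hr.le hω.1 hω.2 hx he
end

theorem lasso_stmt16 (σ α β : ℝ) (hσ : 0 < σ)
    (hα : α ∈ Set.Ioo (0 : ℝ) 1) (hβ : β ∈ Set.Ioo (0 : ℝ) 1)
    (hi : ∃ δ > (0 : ℝ), ∃ N₀ : ℕ, ∀ n ≥ N₀,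
      (∫ p, HgenFun (mDim α n) n (kDim β n) p ∂(muGH (mDim α n) n))
        ≤ (1 - δ) * ∫ p, e2norm p.1 ∂(muGH (mDim α n) n)) :
    ∀ ε₁ ∈ Set.Ioo (0 : ℝ) 1, ∃ ε₂ > (0 : ℝ), ∃ ε₃ > (0 : ℝ), ∃ N : ℕ, ∀ n ≥ N,
      (∃ xts : Fin n → ℝ, kSparseNonneg n (kDim β n) xts ∧
        muAv (mDim α n) n σ
          {ω | ∃ xh : Fin n → ℝ, l1norm xh ≤ l1norm xts ∧
            lassoVal (mDim α n) n xts ω xh = zetaObj (mDim α n) n xts ω ∧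
            (1 - ε₁) * (∫ p, wgen (mDim α n) n (kDim β n) σ p ∂(muGH (mDim α n) n))
              ≤ e2norm (xh - xts) ∧
            e2norm (xh - xts)
              ≤ (1 + ε₁) * ∫ p, wgen (mDim α n) n (kDim β n) σ p ∂(muGH (mDim α n) n)}
        ≥ ENNReal.ofReal (1 - Real.exp (-(ε₂ * n)))) ∧
      (∀ xts : Fin n → ℝ, kSparseNonneg n (kDim β n) xts →
        muAv (mDim α n) n σ
          {ω | ∀ xh : Fin n → ℝ, l1norm xh ≤ l1norm xts →
            lassoVal (mDim α n) n xts ω xh = zetaObj (mDim α n) n xts ω →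
            e2norm (xh - xts)
              ≤ (1 + ε₁) * ∫ p, wgen (mDim α n) n (kDim β n) σ p ∂(muGH (mDim α n) n)}
        ≥ ENNReal.ofReal (1 - Real.exp (-(ε₃ * n)))) := by
  intro ε hε
  simp only [integral_GH_H, integral_GH_g] at hi
  obtain ⟨c, hc, N, h⟩ := lasso_aux σ α β hσ hα hβ hi ε hε
  refine ⟨c, hc, c, hc, N, fun n hn => ?_⟩
  obtain ⟨r, hr, h1, h2, h3, bad2, hb2, h4⟩ := h n hn
  obtain ⟨hε0, hε1⟩ := hε
  set W := ∫ p, wgen (mDim α n) n (kDim β n) σ p ∂(muGH (mDim α n) n) with hW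
  have hre : 0 < r * ε := by positivity
  have hup : r * (1 + ε / 4) ≤ (1 + ε) * W := by
    have := mul_le_mul_of_nonneg_left h1 (show 0 ≤ 1 + ε by linarith)
    nlinarith
  have hlo : (1 - ε) * W ≤ r * (1 - ε / 4) := by
    have := mul_le_mul_of_nonneg_left h2 (show 0 ≤ 1 - ε by linarith)
    nlinarith
  have he := Real.exp_pos (-(c * n))
  constructor
  · have hsp := xbig_sparse n (kDim β n) hr.le
    obtain ⟨bad1, hb1, h5⟩ := h3 _ hsp
    refine ⟨_, hsp, prob_compl _ (bad := bad1 ∪ bad2) he.le ?_ ?_⟩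
    · intro ω hω
      by_contra hcon
      rw [Set.mem_union, not_or] at hcon
      refine hω ?_
      obtain ⟨xh, hx1, hx2⟩ := min_exists (xt := xbig n (kDim β n) r) (ω := ω)
      exact ⟨xh, hx1, hx2, hlo.trans (h4 ω hcon.2 xh hx1 hx2), (h5 ω hcon.1 xh hx1 hx2).trans hup⟩
    · refine (measure_union_le _ _).trans ((add_le_add hb1 hb2).trans (le_of_eq ?_))
      rw [← ENNReal.ofReal_add (by positivity) (by positivity), add_halves]
  · intro xt hxt
    obtain ⟨bad1, hb1, h5⟩ := h3 _ hxt
    refine prob_compl _ (bad := bad1) he.le ?_ (hb1.trans (ENNReal.ofReal_le_ofReal (by linarith)))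
    intro ω hω
    by_contra hcon
    exact hω fun xh hx1 hx2 => (h5 ω hcon xh hx1 hx2).trans hup
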